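/- Assume θ̇ has compact support and the tube is twisted. Then μ(s) → 3/4 as s → ∞. (Here 3/4 is the lowest eigenvalue of the one-dimensional harmonic-oscillator operator −d²/dy₁² + y₁²/16 on ℝ supplemented with an additional Dirichlet condition at y₁ = 0, equivalently the second eigenvalue of −d²/dy₁² + y₁²/16 on ℝ.) -/

import Mathlib

open MeasureTheory Real Set Filter

noncomputable section

/-- First partial derivative ∂₁ of a function on ℝ³ = ℝ × ℝ × ℝ. -/
def pd1 {E : Type*} [NormedAddCommGroup E] [NormedSpace ℝ E]
    (ψ : ℝ × ℝ × ℝ → E) (x : ℝ × ℝ × ℝ) : E :=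
  deriv (fun t => ψ (t, x.2.1, x.2.2)) x.1

/-- Second partial derivative ∂₂. -/
def pd2 {E : Type*} [NormedAddCommGroup E] [NormedSpace ℝ E]
    (ψ : ℝ × ℝ × ℝ → E) (x : ℝ × ℝ × ℝ) : E :=
  deriv (fun t => ψ (x.1, t, x.2.2)) x.2.1

/-- Third partial derivative ∂₃. -/
def pd3 {E : Type*} [NormedAddCommGroup E] [NormedSpace ℝ E]
    (ψ : ℝ × ℝ × ℝ → E) (x : ℝ × ℝ × ℝ) : E :=
  deriv (fun t => ψ (x.1, x.2.1, t)) x.2.2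

/-- Transverse angular derivative ∂_τ = x₃∂₂ − x₂∂₃. -/
def pdtau {E : Type*} [NormedAddCommGroup E] [NormedSpace ℝ E]
    (ψ : ℝ × ℝ × ℝ → E) (x : ℝ × ℝ × ℝ) : E :=
  x.2.2 • pd2 ψ x - x.2.1 • pd3 ψ x

/-- The straight tube Ω₀ = ℝ × ω. -/
def Omega0 (ω : Set (ℝ × ℝ)) : Set (ℝ × ℝ × ℝ) := {x | x.2 ∈ ω}

/-- Smooth compactly supported test functions with support in Ω (i.e. C_c^∞(Ω)). -/
def IsTest3 {E : Type*} [NormedAddCommGroup E] [NormedSpace ℝ E]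
    (Ω : Set (ℝ × ℝ × ℝ)) (ψ : ℝ × ℝ × ℝ → E) : Prop :=
  ContDiff ℝ (⊤ : ℕ∞) ψ ∧ HasCompactSupport ψ ∧ tsupport ψ ⊆ Ω

/-- Partial derivatives on ℝ². -/
def pd1' (f : ℝ × ℝ → ℂ) (p : ℝ × ℝ) : ℂ := deriv (fun t => f (t, p.2)) p.1

def pd2' (f : ℝ × ℝ → ℂ) (p : ℝ × ℝ) : ℂ := deriv (fun t => f (p.1, t)) p.2

/-- Smooth compactly supported test functions on the cross-section, C_c^∞(ω). -/
def IsTest2 (ω : Set (ℝ × ℝ)) (f : ℝ × ℝ → ℂ) : Prop :=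
  ContDiff ℝ (⊤ : ℕ∞) f ∧ HasCompactSupport f ∧ tsupport f ⊆ ω

/-- The lowest Dirichlet eigenvalue E₁ of −Δ on ω, defined variationally. -/
def E1 (ω : Set (ℝ × ℝ)) : ℝ :=
  sInf { r : ℝ | ∃ f : ℝ × ℝ → ℂ, IsTest2 ω f ∧ f ≠ 0 ∧
    r = (∫ p in ω, (‖pd1' f p‖ ^ 2 + ‖pd2' f p‖ ^ 2)) / ∫ p in ω, ‖f p‖ ^ 2 }

/-- The twisted quadratic form Q_θ[ψ] = ∫_{Ω₀} (|∂₁ψ − θ̇ ∂_τψ|² + |∇'ψ|²). -/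
def Qform (θ : ℝ → ℝ) (ω : Set (ℝ × ℝ)) (ψ : ℝ × ℝ × ℝ → ℂ) : ℝ :=
  ∫ x in Omega0 ω,
    (‖pd1 ψ x - deriv θ x.1 • pdtau ψ x‖ ^ 2 + ‖pd2 ψ x‖ ^ 2 + ‖pd3 ψ x‖ ^ 2)

/-- Rotation of the plane by angle ϑ about the origin. -/
def rot (ϑ : ℝ) (p : ℝ × ℝ) : ℝ × ℝ :=
  (p.1 * Real.cos ϑ + p.2 * Real.sin ϑ, -p.1 * Real.sin ϑ + p.2 * Real.cos ϑ)

/-- The tube is twisted: θ is not constant and ω is not rotationally symmetric about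
the origin (in the strong sense: some rotated copy of ω differs from ω on a set of
positive Lebesgue measure). -/
def Twisted (θ : ℝ → ℝ) (ω : Set (ℝ × ℝ)) : Prop :=
  (∃ s t : ℝ, θ s ≠ θ t) ∧
  (∃ ϑ ∈ Set.Ioo (0 : ℝ) (2 * Real.pi), volume (symmDiff (rot ϑ '' ω) ω) ≠ 0)

/-- The tube is untwisted: θ is constant or ω is invariant under every rotation
about the origin. -/
def Untwisted (θ : ℝ → ℝ) (ω : Set (ℝ × ℝ)) : Prop :=
  (∀ s t : ℝ, θ s = θ t) ∨ (∀ ϑ : ℝ, rot ϑ '' ω = ω)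

/-- σ_s(y₁) = e^{s/2} θ̇(e^{s/2} y₁). -/
def sigmafun (θ : ℝ → ℝ) (s y₁ : ℝ) : ℝ :=
  Real.exp (s / 2) * deriv θ (Real.exp (s / 2) * y₁)

/-- The quadratic form J_s of the generator of the self-similar evolution:
J_s[v] = ∫|∂₁v − σ_s ∂_τv|² + (1/16)∫ y₁²|v|² + e^s ( ∫|∇'v|² − E₁∫|v|² ). -/
def Jform (θ : ℝ → ℝ) (ω : Set (ℝ × ℝ)) (s : ℝ) (v : ℝ × ℝ × ℝ → ℂ) : ℝ :=
  (∫ y in Omega0 ω, ‖pd1 v y - sigmafun θ s y.1 • pdtau v y‖ ^ 2)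
    + (1 / 16) * (∫ y in Omega0 ω, y.1 ^ 2 * ‖v y‖ ^ 2)
    + Real.exp s * ((∫ y in Omega0 ω, (‖pd2 v y‖ ^ 2 + ‖pd3 v y‖ ^ 2))
        - E1 ω * ∫ y in Omega0 ω, ‖v y‖ ^ 2)

/-- μ(s): the lowest point of the spectrum of the generator of the self-similar
evolution, defined variationally over nonzero v ∈ C_c^∞(Ω₀). -/
def mu (θ : ℝ → ℝ) (ω : Set (ℝ × ℝ)) (s : ℝ) : ℝ :=
  sInf { r : ℝ | ∃ v : ℝ × ℝ × ℝ → ℂ, IsTest3 (Omega0 ω) v ∧ v ≠ 0 ∧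
    r = Jform θ ω s v / ∫ y in Omega0 ω, ‖v y‖ ^ 2 }

/-- The first partial derivative of a real function on the plane. -/
def d1 (f : ℝ × ℝ → ℝ) (p : ℝ × ℝ) : ℝ := deriv (fun t => f (t, p.2)) p.1

/-- The second partial derivative of a real function on the plane. -/
def d2 (f : ℝ × ℝ → ℝ) (p : ℝ × ℝ) : ℝ := deriv (fun t => f (p.1, t)) p.2

/-- Real-valued smooth functions with compact support in `ω`. -/
def IsRealTest (ω : Set (ℝ × ℝ)) (f : ℝ × ℝ → ℝ) : Prop :=
  ContDiff ℝ (⊤ : ℕ∞) f ∧ HasCompactSupport f ∧ tsupport f ⊆ ω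

/-- The squared `L²` norm. -/
def sqNorm (f : ℝ × ℝ → ℝ) : ℝ := ∫ p, f p ^ 2

/-- The Dirichlet energy. -/
def dirichlet (f : ℝ × ℝ → ℝ) : ℝ := ∫ p, (d1 f p ^ 2 + d2 f p ^ 2)

/-- The Dirichlet form shifted by the lowest Dirichlet eigenvalue. -/
def shifted (ω : Set (ℝ × ℝ)) (f : ℝ × ℝ → ℝ) : ℝ := dirichlet f - E1 ω * sqNorm f

section Calculus

variable {f : ℝ × ℝ → ℝ}

lemma hasDerivAt_d1 (hf : Differentiable ℝ f) (a b : ℝ) :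
    HasDerivAt (fun t => f (t, b)) (d1 f (a, b)) a :=
  ((hf (a, b)).comp a
    ((differentiableAt_id).prodMk (differentiableAt_const b))).hasDerivAt

lemma hasDerivAt_d2 (hf : Differentiable ℝ f) (a b : ℝ) :
    HasDerivAt (fun t => f (a, t)) (d2 f (a, b)) b :=
  ((hf (a, b)).comp b
    ((differentiableAt_const a).prodMk (differentiableAt_id))).hasDerivAt

lemma d1_eq_fderiv (hf : Differentiable ℝ f) : d1 f = fun p => fderiv ℝ f p (1, 0) := by
  ext ⟨a, b⟩
  have h := (hf (a, b)).hasFDerivAt.comp_hasDerivAt a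
    ((hasDerivAt_id a).prodMk (hasDerivAt_const a b))
  exact (hasDerivAt_d1 hf a b).unique h

lemma d2_eq_fderiv (hf : Differentiable ℝ f) : d2 f = fun p => fderiv ℝ f p (0, 1) := by
  ext ⟨a, b⟩
  have h := (hf (a, b)).hasFDerivAt.comp_hasDerivAt b
    ((hasDerivAt_const b a).prodMk (hasDerivAt_id b))
  exact (hasDerivAt_d2 hf a b).unique h

lemma continuous_d1 (hf : ContDiff ℝ 1 f) : Continuous (d1 f) := by
  rw [d1_eq_fderiv (hf.differentiable one_ne_zero)]
  exact (hf.continuous_fderiv one_ne_zero).clm_apply continuous_const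

lemma continuous_d2 (hf : ContDiff ℝ 1 f) : Continuous (d2 f) := by
  rw [d2_eq_fderiv (hf.differentiable one_ne_zero)]
  exact (hf.continuous_fderiv one_ne_zero).clm_apply continuous_const

lemma hasCompactSupport_d1 (hf : Differentiable ℝ f) (hc : HasCompactSupport f) :
    HasCompactSupport (d1 f) := by
  rw [d1_eq_fderiv hf]
  exact (hc.fderiv ℝ).comp_left (g := fun L : ℝ × ℝ →L[ℝ] ℝ => L (1, 0)) rfl

lemma hasCompactSupport_d2 (hf : Differentiable ℝ f) (hc : HasCompactSupport f) :
    HasCompactSupport (d2 f) := by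
  rw [d2_eq_fderiv hf]
  exact (hc.fderiv ℝ).comp_left (g := fun L : ℝ × ℝ →L[ℝ] ℝ => L (0, 1)) rfl

lemma hasCompactSupport_pow {X : Type*} [TopologicalSpace X] {g : X → ℝ}
    (hc : HasCompactSupport g) {n : ℕ} (hn : n ≠ 0) : HasCompactSupport (fun x => g x ^ n) :=
  hc.comp_left (g := fun x : ℝ => x ^ n) (zero_pow hn)

lemma integrable_pow {X : Type*} [TopologicalSpace X] [MeasurableSpace X]
    [OpensMeasurableSpace X] {μ : Measure X} [IsFiniteMeasureOnCompacts μ] {g : X → ℝ}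
    (hg : Continuous g) (hc : HasCompactSupport g) {n : ℕ} (hn : n ≠ 0) :
    Integrable (fun x => g x ^ n) μ := by
  have h : Continuous (fun x => g x ^ n) := by fun_prop
  exact h.integrable_of_hasCompactSupport (hasCompactSupport_pow hc hn)

lemma integrable_sq_of_compactSupport {X : Type*} [TopologicalSpace X] [MeasurableSpace X]
    [OpensMeasurableSpace X] {μ : Measure X} [IsFiniteMeasureOnCompacts μ] {g : X → ℝ}
    (hg : Continuous g) (hc : HasCompactSupport g) :
    Integrable (fun x => g x ^ 2) μ :=
  integrable_pow hg hc two_ne_zero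

lemma integrable_sq (hf : ContDiff ℝ 1 f) (hc : HasCompactSupport f) :
    Integrable (fun p => f p ^ 2) :=
  integrable_sq_of_compactSupport hf.continuous hc

lemma integrable_d1_sq (hf : ContDiff ℝ 1 f) (hc : HasCompactSupport f) :
    Integrable (fun p => d1 f p ^ 2) :=
  integrable_sq_of_compactSupport (continuous_d1 hf)
    (hasCompactSupport_d1 (hf.differentiable one_ne_zero) hc)

lemma integrable_d2_sq (hf : ContDiff ℝ 1 f) (hc : HasCompactSupport f) :
    Integrable (fun p => d2 f p ^ 2) :=
  integrable_sq_of_compactSupport (continuous_d2 hf)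
    (hasCompactSupport_d2 (hf.differentiable one_ne_zero) hc)

lemma IsRealTest.contDiff_one {ω : Set (ℝ × ℝ)} (hf : IsRealTest ω f) : ContDiff ℝ 1 f :=
  hf.1.of_le (by exact_mod_cast le_top)

lemma IsRealTest.differentiable {ω : Set (ℝ × ℝ)} (hf : IsRealTest ω f) :
    Differentiable ℝ f :=
  hf.contDiff_one.differentiable one_ne_zero

lemma sqNorm_nonneg (f : ℝ × ℝ → ℝ) : 0 ≤ sqNorm f :=
  integral_nonneg fun _ => sq_nonneg _

lemma dirichlet_nonneg (f : ℝ × ℝ → ℝ) : 0 ≤ dirichlet f :=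
  integral_nonneg fun _ => by positivity

lemma sqNorm_pos (hf : Continuous f) (hc : HasCompactSupport f) (h0 : f ≠ 0) :
    0 < sqNorm f := by
  obtain ⟨x, hx⟩ := Function.ne_iff.1 h0
  have h : Continuous (fun p => f p ^ 2) := by fun_prop
  refine h.integral_pos_of_hasCompactSupport_nonneg_nonzero
    (hasCompactSupport_pow hc two_ne_zero) (fun _ => sq_nonneg _) (x := x) ?_
  exact pow_ne_zero 2 hx

end Calculus

lemma norm_fderiv_le (f : ℝ × ℝ → ℝ) (hf : Differentiable ℝ f) (p : ℝ × ℝ) :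
    ‖fderiv ℝ f p‖ ≤ |d1 f p| + |d2 f p| := by
  refine ContinuousLinearMap.opNorm_le_bound _ (by positivity) fun v => ?_
  have hv : v = v.1 • ((1 : ℝ), (0 : ℝ)) + v.2 • ((0 : ℝ), (1 : ℝ)) := by
    ext <;> simp
  have h : fderiv ℝ f p v = v.1 * d1 f p + v.2 * d2 f p := by
    rw [d1_eq_fderiv hf, d2_eq_fderiv hf]
    conv_lhs => rw [hv, map_add, map_smul, map_smul]
    simp
  rw [h, Real.norm_eq_abs]
  have h1 : |v.1| ≤ ‖v‖ := norm_fst_le v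
  have h2 : |v.2| ≤ ‖v‖ := norm_snd_le v
  calc |v.1 * d1 f p + v.2 * d2 f p| ≤ |v.1| * |d1 f p| + |v.2| * |d2 f p| := by
        rw [← abs_mul, ← abs_mul]; exact abs_add_le _ _
    _ ≤ ‖v‖ * |d1 f p| + ‖v‖ * |d2 f p| := by gcongr
    _ = _ := by ring

/-- A Ladyzhenskaya-type inequality in the plane. -/
lemma exists_integral_pow_four_le : ∃ C : ℝ, 0 ≤ C ∧ ∀ f : ℝ × ℝ → ℝ, ContDiff ℝ 1 f →
    HasCompactSupport f → ∫ p, f p ^ 4 ≤ C * (2 * sqNorm f + dirichlet f) ^ 2 := by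
  have hfr : Module.finrank ℝ (ℝ × ℝ) = 2 := by simp
  have hp : Real.HolderConjugate (Module.finrank ℝ (ℝ × ℝ)) 2 := by
    rw [hfr]; exact_mod_cast Real.HolderConjugate.two_two
  set K := lintegralPowLePowLIntegralFDerivConst (volume : Measure (ℝ × ℝ)) 2
  refine ⟨K, by positivity, fun f hf hc => ?_⟩
  set u : ℝ × ℝ → ℝ := fun p => f p ^ 2 with hu
  have hu1 : ContDiff ℝ 1 u := hf.pow 2
  have huc : HasCompactSupport u := hasCompactSupport_pow hc two_ne_zero
  have key := lintegral_pow_le_pow_lintegral_fderiv volume hu1 huc hp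
  have hfd := hf.differentiable one_ne_zero
  have hI : Integrable (fun p => 2 * f p ^ 2 + (d1 f p ^ 2 + d2 f p ^ 2)) :=
    ((integrable_sq hf hc).const_mul 2).add ((integrable_d1_sq hf hc).add (integrable_d2_sq hf hc))
  have hN : ∫ p, (2 * f p ^ 2 + (d1 f p ^ 2 + d2 f p ^ 2)) = 2 * sqNorm f + dirichlet f := by
    have hI2 : Integrable (fun p => d1 f p ^ 2 + d2 f p ^ 2) :=
      (integrable_d1_sq hf hc).add (integrable_d2_sq hf hc)
    rw [integral_add ((integrable_sq hf hc).const_mul 2) hI2, integral_const_mul]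
    rfl
  have hN0 : 0 ≤ 2 * sqNorm f + dirichlet f := by
    have := sqNorm_nonneg f; have := dirichlet_nonneg f; positivity
  have hb : ∀ p, ‖fderiv ℝ u p‖ ≤ 2 * f p ^ 2 + (d1 f p ^ 2 + d2 f p ^ 2) := by
    intro p
    have e : fderiv ℝ u p = (2 * f p) • fderiv ℝ f p := by
      rw [hu, fderiv_fun_pow 2 (hfd p)]; simp
    rw [e, norm_smul, Real.norm_eq_abs, abs_mul, abs_two]
    have := norm_fderiv_le f hfd p
    have h3 : 2 * |f p| * ‖fderiv ℝ f p‖ ≤ 2 * |f p| * (|d1 f p| + |d2 f p|) := by gcongr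
    nlinarith [sq_nonneg (|f p| - |d1 f p|), sq_nonneg (|f p| - |d2 f p|), sq_abs (f p),
      sq_abs (d1 f p), sq_abs (d2 f p)]
  have h1 : ∫⁻ p, ‖fderiv ℝ u p‖ₑ ≤ ENNReal.ofReal (2 * sqNorm f + dirichlet f) := by
    rw [← hN, ofReal_integral_eq_lintegral_ofReal hI (ae_of_all _ fun p => by positivity)]
    refine lintegral_mono fun p => ?_
    rw [← ofReal_norm]
    exact ENNReal.ofReal_le_ofReal (hb p)
  have h2 : ∫⁻ p, ‖u p‖ₑ ^ (2 : ℝ) = ENNReal.ofReal (∫ p, f p ^ 4) := by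
    rw [ofReal_integral_eq_lintegral_ofReal _ (ae_of_all _ fun p => by positivity)]
    · refine lintegral_congr fun p => ?_
      rw [← ofReal_norm, ENNReal.ofReal_rpow_of_nonneg (norm_nonneg _) (by norm_num)]
      congr 1
      simp only [hu, Real.norm_eq_abs, Real.rpow_two, sq_abs]; ring
    · exact integrable_pow hf.continuous hc four_ne_zero
  rw [h2] at key
  have h3 : ENNReal.ofReal (∫ p, f p ^ 4)
      ≤ ENNReal.ofReal (K * (2 * sqNorm f + dirichlet f) ^ 2) := by
    refine key.trans ?_
    rw [ENNReal.ofReal_mul (by positivity), ENNReal.ofReal_pow hN0, ENNReal.ofReal_coe_nnreal,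
      ENNReal.rpow_two]
    gcongr
  exact (ENNReal.ofReal_le_ofReal_iff (by positivity)).1 h3

/-- Functions bounded in `H¹` carry little `L²` mass on sets of small measure. -/
lemma setIntegral_sq_le {C : ℝ} {f : ℝ × ℝ → ℝ} (hf : ContDiff ℝ 1 f) (hc : HasCompactSupport f)
    (hC : ∫ p, f p ^ 4 ≤ C * (2 * sqNorm f + dirichlet f) ^ 2)
    {A : Set (ℝ × ℝ)} (hA : volume A ≠ ⊤) {t : ℝ} (ht : 0 < t) :
    ∫ p in A, f p ^ 2 ≤ t * volume.real A + C * (2 * sqNorm f + dirichlet f) ^ 2 / t := by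
  have h4 : Integrable (fun p => f p ^ 4) :=
    integrable_pow hf.continuous hc four_ne_zero
  have hAi : IntegrableOn (fun _ : ℝ × ℝ => t) A := integrableOn_const hA
  calc ∫ p in A, f p ^ 2 ≤ ∫ p in A, (t + f p ^ 4 / t) := by
        refine integral_mono (integrable_sq hf hc).integrableOn
          (hAi.add (h4.integrableOn.div_const t)) fun p => ?_
        have : f p ^ 2 * t ≤ t * t + f p ^ 4 := by
          nlinarith [sq_nonneg (f p ^ 2 - t), sq_nonneg (f p ^ 2), sq_nonneg t]
        have h2 : t + f p ^ 4 / t = (t * t + f p ^ 4) / t := by field_simp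
        simp only
        rw [h2, le_div_iff₀ ht]; exact this
    _ = t * volume.real A + (∫ p in A, f p ^ 4) / t := by
        rw [integral_add hAi (h4.integrableOn.div_const t), integral_div, setIntegral_const,
          smul_eq_mul, mul_comm]
    _ ≤ t * volume.real A + C * (2 * sqNorm f + dirichlet f) ^ 2 / t := by
        gcongr
        exact (setIntegral_le_integral h4 (ae_of_all _ fun p => by positivity)).trans hC

lemma sq_sub_le_aux {g g' : ℝ → ℝ} (hg : ∀ x, HasDerivAt g (g' x) x) (hc : Continuous g')
    {a b s t : ℝ} (has : a ≤ s) (hst : s ≤ t) (htb : t ≤ b) :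
    (g t - g s) ^ 2 ≤ (b - a) * ∫ x in Icc a b, g' x ^ 2 := by
  have hnn : 0 ≤ ∫ x in Icc a b, g' x ^ 2 := integral_nonneg fun _ => sq_nonneg _
  have hab : 0 ≤ b - a := by linarith
  rcases hst.eq_or_lt with rfl | hlt
  · simpa using mul_nonneg hab hnn
  have hsq : Continuous fun x => g' x ^ 2 := by fun_prop
  have e1 : ∫ x in s..t, g' x = g t - g s :=
    intervalIntegral.integral_eq_sub_of_hasDerivAt (fun x _ => hg x) (hc.intervalIntegrable _ _)
  set d := (g t - g s) / (t - s) with hd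
  have hts : 0 < t - s := by linarith
  have e2 : 0 ≤ ∫ x in s..t, (g' x - d) ^ 2 :=
    intervalIntegral.integral_nonneg hlt.le fun x _ => sq_nonneg _
  have e3 : ∫ x in s..t, (g' x - d) ^ 2
      = (∫ x in s..t, g' x ^ 2) - 2 * d * (g t - g s) + (t - s) * d ^ 2 := by
    have : ∀ x, (g' x - d) ^ 2 = g' x ^ 2 - 2 * d * g' x + d ^ 2 := fun x => by ring
    simp_rw [this]
    rw [intervalIntegral.integral_add, intervalIntegral.integral_sub,
      intervalIntegral.integral_const_mul, e1, intervalIntegral.integral_const, smul_eq_mul]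
    all_goals exact Continuous.intervalIntegrable (by fun_prop) _ _
  have e4 : ∫ x in s..t, g' x ^ 2 ≤ ∫ x in Icc a b, g' x ^ 2 := by
    rw [intervalIntegral.integral_of_le hlt.le]
    refine setIntegral_mono_set (hsq.integrableOn_Icc) (ae_of_all _ fun _ => sq_nonneg _) ?_
    exact (Ioc_subset_Icc_self.trans (Icc_subset_Icc has htb)).eventuallyLE
  have e5 : d * (t - s) = g t - g s := by rw [hd]; field_simp
  have e6 : d * (g t - g s) ≤ ∫ x in Icc a b, g' x ^ 2 := by
    have : (t - s) * d ^ 2 = d * (g t - g s) := by rw [← e5]; ring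
    linarith
  calc (g t - g s) ^ 2 = (t - s) * (d * (g t - g s)) := by
        rw [← e5]; ring
    _ ≤ (t - s) * ∫ x in Icc a b, g' x ^ 2 := by gcongr
    _ ≤ (b - a) * ∫ x in Icc a b, g' x ^ 2 := by gcongr

lemma sq_sub_le {g g' : ℝ → ℝ} (hg : ∀ x, HasDerivAt g (g' x) x) (hc : Continuous g')
    {a b s t : ℝ} (hs : s ∈ Icc a b) (ht : t ∈ Icc a b) :
    (g t - g s) ^ 2 ≤ (b - a) * ∫ x in Icc a b, g' x ^ 2 := by
  rcases le_total s t with h | h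
  · exact sq_sub_le_aux hg hc hs.1 h ht.2
  · rw [← neg_sub, neg_sq]
    exact sq_sub_le_aux hg hc ht.1 h hs.2

/-- A Poincaré inequality on a square controlling the `L²` norm by the mass on a subset. -/
lemma poincare_square {l : ℝ × ℝ → ℝ} (hl : ContDiff ℝ 1 l) {α β h : ℝ} (hh : 0 < h)
    {Z : Set (ℝ × ℝ)} (hZ : MeasurableSet Z)
    (hZQ : Z ⊆ Icc α (α + h) ×ˢ Icc β (β + h)) :
    volume.real Z * ∫ p in Icc α (α + h) ×ˢ Icc β (β + h), l p ^ 2 ≤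
      2 * h ^ 2 * (∫ p in Z, l p ^ 2) +
        4 * h ^ 4 * ∫ p in Icc α (α + h) ×ˢ Icc β (β + h), (d1 l p ^ 2 + d2 l p ^ 2) := by
  set I := Icc α (α + h) with hI
  set J := Icc β (β + h) with hJ
  set Q := I ×ˢ J with hQ
  have hQc : IsCompact Q := isCompact_Icc.prod isCompact_Icc
  have hQm : MeasurableSet Q := measurableSet_Icc.prod measurableSet_Icc
  have hvI : volume.real I = h := by simp [hI, hh.le]
  have hvJ : volume.real J = h := by simp [hJ, hh.le]
  have hvQ : volume.real Q = h ^ 2 := by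
    rw [hQ, Measure.volume_eq_prod, measureReal_prod_prod, hvI, hvJ, sq]
  have hvZ : volume.real Z ≤ h ^ 2 := by
    rw [← hvQ]; exact measureReal_mono hZQ hQc.measure_lt_top.ne
  have hZf : volume Z ≠ ⊤ := ((measure_mono hZQ).trans_lt hQc.measure_lt_top).ne
  have c0 : Continuous l := hl.continuous
  have c1 := continuous_d1 hl
  have c2 := continuous_d2 hl
  have hd := hl.differentiable one_ne_zero
  set D1 : ℝ → ℝ := fun y => ∫ s in I, d1 l (s, y) ^ 2 with hD1
  set D2 : ℝ → ℝ := fun x => ∫ s in J, d2 l (x, s) ^ 2 with hD2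
  have cD1 : Continuous D1 :=
    continuous_parametric_integral_of_continuous (by fun_prop) isCompact_Icc
  have cD2 : Continuous D2 :=
    continuous_parametric_integral_of_continuous (by fun_prop) isCompact_Icc
  have iQ : ∀ {g : ℝ × ℝ → ℝ}, Continuous g → IntegrableOn g Q := fun hg =>
    hg.continuousOn.integrableOn_compact hQc
  have iZ : ∀ {g : ℝ × ℝ → ℝ}, Continuous g → IntegrableOn g Z := fun hg =>
    (iQ hg).mono_set hZQ
  have pt : ∀ x ∈ Q, ∀ y ∈ Q,
      l x ^ 2 ≤ 2 * l y ^ 2 + 4 * h * D1 x.2 + 4 * h * D2 y.1 := by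
    rintro ⟨x1, x2⟩ hx ⟨y1, y2⟩ hy
    have e1 := sq_sub_le (g := fun t => l (t, x2)) (fun t => hasDerivAt_d1 hd t x2)
      (by fun_prop) hy.1 hx.1
    have e2 := sq_sub_le (g := fun t => l (y1, t)) (fun t => hasDerivAt_d2 hd y1 t)
      (by fun_prop) hy.2 hx.2
    rw [add_sub_cancel_left] at e1 e2
    simp only [hD1, hD2]
    simp only at e1 e2
    nlinarith [sq_nonneg (2 * l (y1, y2) - l (x1, x2)),
      sq_nonneg ((l (x1, x2) - l (y1, x2)) - (l (y1, x2) - l (y1, y2)))]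
  have iD1 : ∫ x in Q, D1 x.2 = h * ∫ p in Q, d1 l p ^ 2 := by
    have j1 : IntegrableOn (fun x : ℝ × ℝ => D1 x.2) Q := iQ (by fun_prop)
    have j2 : IntegrableOn (fun p => d1 l p ^ 2) Q := iQ (by fun_prop)
    rw [IntegrableOn, hQ, Measure.volume_eq_prod, ← Measure.prod_restrict] at j1 j2
    rw [hQ, Measure.volume_eq_prod, ← Measure.prod_restrict, integral_prod_symm _ j1,
      integral_prod_symm _ j2]
    simp only [setIntegral_const, smul_eq_mul, hvI, integral_const_mul]; rfl
  have iD2 : ∫ x in Q, D2 x.1 = h * ∫ p in Q, d2 l p ^ 2 := by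
    rw [hQ, Measure.volume_eq_prod, setIntegral_prod, setIntegral_prod]
    · simp only [setIntegral_const, smul_eq_mul, hvJ, integral_const_mul]; rfl
    · exact iQ (by fun_prop)
    · exact iQ (by fun_prop)
  have iD2Z : ∫ x in Z, D2 x.1 ≤ h * ∫ p in Q, d2 l p ^ 2 := by
    rw [← iD2]
    exact setIntegral_mono_set (iQ (by fun_prop))
      (ae_of_all _ fun _ => integral_nonneg fun _ => sq_nonneg _) hZQ.eventuallyLE
  have st1 : ∀ x ∈ Q, volume.real Z * l x ^ 2 ≤ 2 * (∫ p in Z, l p ^ 2)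
      + volume.real Z * (4 * h * D1 x.2) + 4 * h * (h * ∫ p in Q, d2 l p ^ 2) := by
    intro x hx
    have : ∫ y in Z, l x ^ 2 ≤ ∫ y in Z, (2 * l y ^ 2 + 4 * h * D1 x.2 + 4 * h * D2 y.1) :=
      setIntegral_mono_on (integrableOn_const hZf) (iZ (by fun_prop)) hZ
        fun y hy => pt x hx y (hZQ hy)
    rw [integral_add (iZ (by fun_prop)) (iZ (by fun_prop)),
      integral_add (iZ (by fun_prop)) (integrableOn_const hZf), integral_const_mul,
      integral_const_mul, setIntegral_const, setIntegral_const, smul_eq_mul, smul_eq_mul,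
      integral_const_mul] at this
    have h4 : 4 * h * ∫ x in Z, D2 x.1 ≤ 4 * h * (h * ∫ p in Q, d2 l p ^ 2) := by gcongr
    linarith
  have st2 := setIntegral_mono_on (iQ (by fun_prop)) (iQ (by fun_prop)) hQm st1
  rw [integral_const_mul, integral_add (iQ (by fun_prop)) (iQ (by fun_prop)),
    integral_add (iQ (by fun_prop)) (iQ (by fun_prop)), integral_const_mul, integral_const_mul,
    integral_const_mul, setIntegral_const, setIntegral_const, smul_eq_mul, smul_eq_mul, hvQ, iD1] at st2
  rw [integral_add (iQ (by fun_prop)) (iQ (by fun_prop))]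
  have n1 : 0 ≤ ∫ p in Q, d1 l p ^ 2 := integral_nonneg fun _ => sq_nonneg _
  have : volume.real Z * (4 * h * (h * ∫ p in Q, d1 l p ^ 2)) ≤
      h ^ 2 * (4 * h * (h * ∫ p in Q, d1 l p ^ 2)) := by gcongr
  linarith

lemma E1_nonneg (ω : Set (ℝ × ℝ)) : 0 ≤ E1 ω := by
  refine Real.sInf_nonneg ?_
  rintro r ⟨f, -, -, rfl⟩
  exact div_nonneg (integral_nonneg fun _ => by positivity) (integral_nonneg fun _ => by positivity)

lemma setIntegral_eq_integral_of_tsupport {X F : Type*} [TopologicalSpace X] [MeasurableSpace X]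
    [Zero F] {μ : Measure X} {ω : Set X} {f : X → F} (hf : tsupport f ⊆ ω) {g : X → ℝ}
    (hg : ∀ x, x ∉ tsupport f → g x = 0) : ∫ x in ω, g x ∂μ = ∫ x, g x ∂μ :=
  setIntegral_eq_integral_of_forall_compl_eq_zero fun x hx => hg x fun h => hx (hf h)

lemma d1_eq_zero {f : ℝ × ℝ → ℝ} {p : ℝ × ℝ} (hd : Differentiable ℝ f) (hp : p ∉ tsupport f) :
    d1 f p = 0 := by
  rw [d1_eq_fderiv hd]
  simp [fderiv_of_notMem_tsupport ℝ hp]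

lemma d2_eq_zero {f : ℝ × ℝ → ℝ} {p : ℝ × ℝ} (hd : Differentiable ℝ f) (hp : p ∉ tsupport f) :
    d2 f p = 0 := by
  rw [d2_eq_fderiv hd]
  simp [fderiv_of_notMem_tsupport ℝ hp]

lemma IsRealTest.isTest2 {ω : Set (ℝ × ℝ)} {f : ℝ × ℝ → ℝ} (hf : IsRealTest ω f) :
    IsTest2 ω (fun p => (f p : ℂ)) := by
  refine ⟨Complex.ofRealCLM.contDiff.comp hf.1, hf.2.1.comp_left Complex.ofReal_zero, ?_⟩
  exact (closure_mono (Function.support_comp_subset Complex.ofReal_zero f)).trans hf.2.2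

lemma pd1'_ofReal {f : ℝ × ℝ → ℝ} (hd : Differentiable ℝ f) (p : ℝ × ℝ) :
    pd1' (fun p => (f p : ℂ)) p = (d1 f p : ℂ) :=
  (hasDerivAt_d1 hd p.1 p.2).ofReal_comp.deriv

lemma pd2'_ofReal {f : ℝ × ℝ → ℝ} (hd : Differentiable ℝ f) (p : ℝ × ℝ) :
    pd2' (fun p => (f p : ℂ)) p = (d2 f p : ℂ) :=
  (hasDerivAt_d2 hd p.1 p.2).ofReal_comp.deriv

lemma shifted_nonneg {ω : Set (ℝ × ℝ)} {f : ℝ × ℝ → ℝ} (hf : IsRealTest ω f) :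
    0 ≤ shifted ω f := by
  by_cases h0 : f = 0
  · have h2 : sqNorm f = 0 := by simp [sqNorm, h0]
    rw [shifted, h2, mul_zero, sub_zero]
    exact dirichlet_nonneg f
  have hd := hf.differentiable
  have hpos := sqNorm_pos hf.1.continuous hf.2.1 h0
  have e1 : ∫ p in ω, ‖(f p : ℂ)‖ ^ 2 = sqNorm f := by
    simp only [Complex.norm_real, Real.norm_eq_abs, sq_abs]
    exact setIntegral_eq_integral_of_tsupport hf.2.2 fun p hp => by
      rw [image_eq_zero_of_notMem_tsupport hp]; norm_num
  have e2 : ∫ p in ω, (‖pd1' (fun p => (f p : ℂ)) p‖ ^ 2 + ‖pd2' (fun p => (f p : ℂ)) p‖ ^ 2)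
      = dirichlet f := by
    simp only [pd1'_ofReal hd, pd2'_ofReal hd, Complex.norm_real, Real.norm_eq_abs, sq_abs]
    exact setIntegral_eq_integral_of_tsupport hf.2.2 fun p hp => by
      rw [d1_eq_zero hd hp, d2_eq_zero hd hp]; norm_num
  have h : E1 ω ≤ dirichlet f / sqNorm f := by
    refine csInf_le ⟨0, ?_⟩ ⟨_, hf.isTest2, ?_, by rw [e1, e2]⟩
    · rintro r ⟨f, -, -, rfl⟩
      exact div_nonneg (integral_nonneg fun _ => by positivity)
        (integral_nonneg fun _ => by positivity)
    · intro h
      exact h0 (funext fun p => by simpa using congrFun h p)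
  rw [le_div_iff₀ hpos] at h
  rw [shifted]; linarith

lemma caccioppoli_pointwise {f' ph ph' F ε t : ℝ} (hε : 0 < ε) (hF : ε ≤ F) (ht : 0 < t)
    (h0 : 0 ≤ ph) (h1 : ph ≤ 1) :
    (f' + t * (2 * ph * ph' / F - ph ^ 2 * f' / F ^ 2)) ^ 2 ≤
      f' ^ 2 + t * (4 * ph' ^ 2 - ph ^ 2 * (f' / F) ^ 2)
        + t ^ 2 * (8 / ε ^ 2 * ph' ^ 2 + 2 / ε ^ 4 * f' ^ 2) := by
  have hF0 : 0 < F := hε.trans_le hF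
  set w := 2 * ph * ph' / F - ph ^ 2 * f' / F ^ 2 with hw
  have c1 : 2 * f' * w ≤ 4 * ph' ^ 2 - ph ^ 2 * (f' / F) ^ 2 := by
    have : 2 * f' * w = 4 * ph * ph' * (f' / F) - 2 * ph ^ 2 * (f' / F) ^ 2 := by
      rw [hw]; field_simp; ring
    rw [this]
    nlinarith [sq_nonneg (2 * ph' - ph * (f' / F))]
  have hi : 1 / F ≤ 1 / ε := one_div_le_one_div_of_le hε hF
  have hi0 : 0 < 1 / F := by positivity
  have c2 : w ^ 2 ≤ 8 / ε ^ 2 * ph' ^ 2 + 2 / ε ^ 4 * f' ^ 2 := by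
    have a1 : w ^ 2 ≤ 2 * (2 * ph * ph' / F) ^ 2 + 2 * (ph ^ 2 * f' / F ^ 2) ^ 2 := by
      rw [hw]
      nlinarith [sq_nonneg (2 * ph * ph' / F + ph ^ 2 * f' / F ^ 2)]
    have a2 : (2 * ph * ph' / F) ^ 2 = 4 * ph ^ 2 * (1 / F) ^ 2 * ph' ^ 2 := by
      field_simp; ring
    have a3 : (ph ^ 2 * f' / F ^ 2) ^ 2 = ph ^ 4 * (1 / F) ^ 4 * f' ^ 2 := by
      field_simp
    have a4 : 4 * ph ^ 2 * (1 / F) ^ 2 * ph' ^ 2 ≤ 4 * 1 ^ 2 * (1 / ε) ^ 2 * ph' ^ 2 := by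
      gcongr
    have a5 : ph ^ 4 * (1 / F) ^ 4 * f' ^ 2 ≤ 1 ^ 4 * (1 / ε) ^ 4 * f' ^ 2 := by
      gcongr
    have a6 : 8 / ε ^ 2 * ph' ^ 2 + 2 / ε ^ 4 * f' ^ 2 =
      2 * (4 * 1 ^ 2 * (1 / ε) ^ 2 * ph' ^ 2) + 2 * (1 ^ 4 * (1 / ε) ^ 4 * f' ^ 2) := by
      field_simp; ring
    rw [a6]; rw [a2, a3] at a1; linarith
  have c3 := mul_le_mul_of_nonneg_left c1 ht.le
  have c4 := mul_le_mul_of_nonneg_left c2 (sq_nonneg t)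
  have e : (f' + t * w) ^ 2 = f' ^ 2 + t * (2 * f' * w) + t ^ 2 * w ^ 2 := by ring
  rw [e]; linarith

lemma hasDerivAt_perturb {f ph : ℝ → ℝ} {f' ph' x ε t : ℝ} (hf : HasDerivAt f f' x)
    (hp : HasDerivAt ph ph' x) (hF : f x + ε ≠ 0) :
    HasDerivAt (fun s => f s + t * (ph s ^ 2 / (f s + ε)))
      (f' + t * (2 * ph x * ph' / (f x + ε) - ph x ^ 2 * f' / (f x + ε) ^ 2)) x := by
  have h := hf.add (((hp.fun_pow 2).fun_div (hf.add_const ε) hF).const_mul t)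
  refine h.congr_deriv ?_
  field_simp
  ring

lemma hasDerivAt_log_one_add {f : ℝ → ℝ} {f' x ε : ℝ} (hf : HasDerivAt f f' x)
    (hε : 0 < ε) (hF : 0 ≤ f x) :
    HasDerivAt (fun s => Real.log (1 + f s / ε)) (f' / (f x + ε)) x := by
  have h0 : 1 + f x / ε ≠ 0 := by positivity
  have h := ((hf.div_const ε).const_add 1).log h0
  refine h.congr_deriv ?_
  have : f x + ε ≠ 0 := by positivity
  field_simp
  rw [add_comm]

lemma dirichlet_eq {f : ℝ × ℝ → ℝ} (hf : ContDiff ℝ 1 f) (hc : HasCompactSupport f) :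
    dirichlet f = (∫ p, d1 f p ^ 2) + ∫ p, d2 f p ^ 2 :=
  integral_add (integrable_d1_sq hf hc) (integrable_d2_sq hf hc)

lemma contDiff_log_one_add {f : ℝ × ℝ → ℝ} {n : WithTop ℕ∞} (hf : ContDiff ℝ n f)
    (h0 : ∀ p, 0 ≤ f p) {ε : ℝ} (hε : 0 < ε) : ContDiff ℝ n fun p => Real.log (1 + f p / ε) :=
  (contDiff_const.add (hf.div_const ε)).log fun p => by have := h0 p; positivity

/-- Logarithmic Caccioppoli inequality for an approximate minimiser. -/
lemma log_caccioppoli {ω : Set (ℝ × ℝ)} {f ph : ℝ × ℝ → ℝ} (hf : IsRealTest ω f)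
    (h0 : ∀ p, 0 ≤ f p) (hp : IsRealTest ω ph) (hp0 : ∀ p, 0 ≤ ph p) (hp1 : ∀ p, ph p ≤ 1)
    {ε t : ℝ} (hε : 0 < ε) (ht : 0 < t) {Q : Set (ℝ × ℝ)} (hQ : MeasurableSet Q)
    (hphQ : ∀ p ∈ Q, ph p = 1) :
    ∫ p in Q, (d1 (fun p => Real.log (1 + f p / ε)) p ^ 2
        + d2 (fun p => Real.log (1 + f p / ε)) p ^ 2) ≤
      4 * dirichlet ph + shifted ω f / t
        + t * (8 / ε ^ 2 * dirichlet ph + 2 / ε ^ 4 * dirichlet f) := by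
  set l : ℝ × ℝ → ℝ := fun p => Real.log (1 + f p / ε) with hl
  have hfd := hf.differentiable
  have hpd := hp.differentiable
  have hl1 : ContDiff ℝ 1 l := contDiff_log_one_add hf.contDiff_one h0 hε
  have hF : ∀ p, f p + ε ≠ 0 := fun p => by have := h0 p; positivity
  set g : ℝ × ℝ → ℝ := fun p => f p + t * (ph p ^ 2 / (f p + ε)) with hg
  have hgs : ContDiff ℝ (⊤ : ℕ∞) g :=
    hf.1.add (contDiff_const.mul ((hp.1.pow 2).div (hf.1.add contDiff_const) hF))
  have hgsupp : Function.support g ⊆ tsupport f ∪ tsupport ph := by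
    intro p hpm
    by_contra hcon
    rw [mem_union, not_or] at hcon
    refine hpm ?_
    simp [hg, image_eq_zero_of_notMem_tsupport hcon.1, image_eq_zero_of_notMem_tsupport hcon.2]
  have hgts : tsupport g ⊆ tsupport f ∪ tsupport ph :=
    closure_minimal hgsupp ((isClosed_tsupport f).union (isClosed_tsupport ph))
  have hgt : IsRealTest ω g :=
    ⟨hgs, HasCompactSupport.of_support_subset_isCompact (hf.2.1.union hp.2.1) hgsupp,
      hgts.trans (union_subset hf.2.2 hp.2.2)⟩
  have dl1 : ∀ p, d1 l p = d1 f p / (f p + ε) := fun p =>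
    (hasDerivAt_log_one_add (hasDerivAt_d1 hfd p.1 p.2) hε (h0 p)).deriv
  have dl2 : ∀ p, d2 l p = d2 f p / (f p + ε) := fun p =>
    (hasDerivAt_log_one_add (hasDerivAt_d2 hfd p.1 p.2) hε (h0 p)).deriv
  have dg1 : ∀ p, d1 g p = _ := fun p =>
    (hasDerivAt_perturb (t := t) (hasDerivAt_d1 hfd p.1 p.2) (hasDerivAt_d1 hpd p.1 p.2)
      (hF p)).deriv
  have dg2 : ∀ p, d2 g p = _ := fun p =>
    (hasDerivAt_perturb (t := t) (hasDerivAt_d2 hfd p.1 p.2) (hasDerivAt_d2 hpd p.1 p.2)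
      (hF p)).deriv
  have hεF : ∀ p, ε ≤ f p + ε := fun p => by linarith [h0 p]
  have cl1 := continuous_d1 hl1
  have cl2 := continuous_d2 hl1
  have cph := hp.1.continuous
  have il1 : Integrable fun p => (ph p * d1 l p) ^ 2 :=
    integrable_sq_of_compactSupport (by fun_prop) hp.2.1.mul_right
  have il2 : Integrable fun p => (ph p * d2 l p) ^ 2 :=
    integrable_sq_of_compactSupport (by fun_prop) hp.2.1.mul_right
  have if1 := integrable_d1_sq hf.contDiff_one hf.2.1
  have if2 := integrable_d2_sq hf.contDiff_one hf.2.1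
  have ip1 := integrable_d1_sq hp.contDiff_one hp.2.1
  have ip2 := integrable_d2_sq hp.contDiff_one hp.2.1
  have ig1 := integrable_d1_sq hgt.contDiff_one hgt.2.1
  have ig2 := integrable_d2_sq hgt.contDiff_one hgt.2.1
  have aux : ∀ {a b c G : ℝ × ℝ → ℝ}, Integrable a → Integrable b → Integrable c →
      Integrable G →
      (∀ p, G p ≤ a p + t * (4 * b p - c p) + t ^ 2 * (8 / ε ^ 2 * b p + 2 / ε ^ 4 * a p)) →
      ∫ p, G p ≤ (∫ p, a p) + t * (4 * (∫ p, b p) - ∫ p, c p)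
        + t ^ 2 * (8 / ε ^ 2 * (∫ p, b p) + 2 / ε ^ 4 * ∫ p, a p) := by
    intro a b c G ia ib ic iG h
    have i1 : Integrable fun p => t * (4 * b p - c p) := ((ib.const_mul 4).sub ic).const_mul t
    have i2 : Integrable fun p => t ^ 2 * (8 / ε ^ 2 * b p + 2 / ε ^ 4 * a p) :=
      ((ib.const_mul _).add (ia.const_mul _)).const_mul _
    have i3 : Integrable fun p => a p + t * (4 * b p - c p) := ia.add i1
    refine (integral_mono iG (i3.add i2) h).trans_eq ?_
    simp only [Pi.add_apply]
    rw [integral_add i3 i2, integral_add ia i1, integral_const_mul, integral_const_mul,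
      integral_sub (ib.const_mul 4) ic, integral_add (ib.const_mul _) (ia.const_mul _),
      integral_const_mul, integral_const_mul, integral_const_mul]
  have k1 := aux if1 ip1 il1 ig1 fun p => by
    rw [dg1, mul_pow, dl1]
    exact caccioppoli_pointwise hε (hεF p) ht (hp0 p) (hp1 p)
  have k2 := aux if2 ip2 il2 ig2 fun p => by
    rw [dg2, mul_pow, dl2]
    exact caccioppoli_pointwise hε (hεF p) ht (hp0 p) (hp1 p)
  have k3 : sqNorm f ≤ sqNorm g := by
    refine integral_mono (integrable_sq hf.contDiff_one hf.2.1)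
      (integrable_sq hgt.contDiff_one hgt.2.1) fun p => ?_
    have : 0 ≤ t * (ph p ^ 2 / (f p + ε)) := by have := h0 p; positivity
    exact pow_le_pow_left₀ (h0 p) (by simp only [hg]; linarith) 2
  have k4 := shifted_nonneg hgt
  have k5 : ∫ p in Q, (d1 l p ^ 2 + d2 l p ^ 2) ≤
      (∫ p, (ph p * d1 l p) ^ 2) + ∫ p, (ph p * d2 l p) ^ 2 := by
    rw [← integral_add il1 il2]
    have : ∫ p in Q, (d1 l p ^ 2 + d2 l p ^ 2)
        = ∫ p in Q, ((ph p * d1 l p) ^ 2 + (ph p * d2 l p) ^ 2) :=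
      setIntegral_congr_fun hQ fun p hpQ => by simp [hphQ p hpQ]
    rw [this]
    exact setIntegral_le_integral (il1.add il2) (ae_of_all _ fun p => by positivity)
  have e1 := dirichlet_eq hf.contDiff_one hf.2.1
  have e2 := dirichlet_eq hp.contDiff_one hp.2.1
  have e3 := dirichlet_eq hgt.contDiff_one hgt.2.1
  have k6 : E1 ω * sqNorm f ≤ E1 ω * sqNorm g := mul_le_mul_of_nonneg_left k3 (E1_nonneg ω)
  rw [shifted, e3] at k4
  rw [shifted, e2, e1]
  refine k5.trans (le_of_mul_le_mul_left ?_ ht)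
  set X := 8 / ε ^ 2 with hX
  set Y := 2 / ε ^ 4 with hY
  have e4 : ∀ A B C : ℝ, t * (A + B / t + C) = t * A + B + t * C := fun A B C => by field_simp
  rw [e4]
  linarith

/-- A normalised, nonnegative, approximately minimising sequence for the shifted form. -/
structure IsMinimising (ω : Set (ℝ × ℝ)) (f : ℕ → ℝ × ℝ → ℝ) : Prop where
  test : ∀ n, IsRealTest ω (f n)
  nonneg : ∀ n p, 0 ≤ f n p
  sqNorm_le : ∀ n, sqNorm (f n) ≤ 1
  shifted_le : ∀ n, shifted ω (f n) ≤ 1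
  tendsto : Tendsto (fun n => shifted ω (f n)) atTop (nhds 0)

lemma IsMinimising.dirichlet_le {ω : Set (ℝ × ℝ)} {f : ℕ → ℝ × ℝ → ℝ} (h : IsMinimising ω f)
    (n : ℕ) : dirichlet (f n) ≤ 1 + E1 ω := by
  have h1 := h.shifted_le n
  have h2 := mul_le_mul_of_nonneg_left (h.sqNorm_le n) (E1_nonneg ω)
  rw [shifted] at h1
  linarith

/-- The `L²` mass of an approximately minimising sequence on sets of small measure. -/
lemma IsMinimising.exists_setIntegral_le {ω : Set (ℝ × ℝ)} {f : ℕ → ℝ × ℝ → ℝ}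
    (h : IsMinimising ω f) : ∃ C : ℝ, 0 ≤ C ∧ ∀ n (A : Set (ℝ × ℝ)), volume A ≠ ⊤ →
      ∀ t : ℝ, 0 < t → ∫ p in A, f n p ^ 2 ≤ t * volume.real A + C / t := by
  obtain ⟨C, hC0, hC⟩ := exists_integral_pow_four_le
  refine ⟨C * (2 + (1 + E1 ω)) ^ 2, by positivity, fun n A hA t ht => ?_⟩
  refine (setIntegral_sq_le (h.test n).contDiff_one (h.test n).2.1
    (hC _ (h.test n).contDiff_one (h.test n).2.1) hA ht).trans ?_
  have h1 := h.sqNorm_le n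
  have h2 := h.dirichlet_le n
  have h3 := sqNorm_nonneg (f n)
  have h4 := dirichlet_nonneg (f n)
  have h5 : 2 * sqNorm (f n) + dirichlet (f n) ≤ 2 + (1 + E1 ω) := by linarith
  gcongr

lemma measureReal_superlevel_mul_le {l f : ℝ × ℝ → ℝ} {Q : Set (ℝ × ℝ)} {lam B : ℝ}
    (hQ : MeasurableSet Q) (hQf : volume Q ≠ ⊤) (hf : Continuous f)
    (hl : IntegrableOn (fun p => l p ^ 2) Q) (hB : 0 ≤ B) (h : ∀ p, lam < f p → B ≤ l p) :
    volume.real (Q ∩ {p | lam < f p}) * B ^ 2 ≤ ∫ p in Q, l p ^ 2 := by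
  have hm : MeasurableSet (Q ∩ {p | lam < f p}) :=
    hQ.inter (measurableSet_lt measurable_const hf.measurable)
  have hfin : volume (Q ∩ {p | lam < f p}) ≠ ⊤ :=
    ((measure_mono inter_subset_left).trans_lt hQf.lt_top).ne
  calc volume.real (Q ∩ {p | lam < f p}) * B ^ 2
        = ∫ p in Q ∩ {p | lam < f p}, B ^ 2 := by rw [setIntegral_const, smul_eq_mul]
    _ ≤ ∫ p in Q ∩ {p | lam < f p}, l p ^ 2 :=
        setIntegral_mono_on (integrableOn_const hfin) (hl.mono_set inter_subset_left) hm
          fun p hp => pow_le_pow_left₀ hB (h p hp.2) 2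
    _ ≤ ∫ p in Q, l p ^ 2 :=
        setIntegral_mono_set hl (ae_of_all _ fun _ => sq_nonneg _) inter_subset_left.eventuallyLE

lemma setIntegral_sq_le_superlevel {f : ℝ × ℝ → ℝ} {Q : Set (ℝ × ℝ)} {lam : ℝ}
    (hQ : MeasurableSet Q) (hQf : volume Q ≠ ⊤) (hf : Continuous f) (h0 : ∀ p, 0 ≤ f p)
    (hi : Integrable fun p => f p ^ 2) :
    ∫ p in Q, f p ^ 2 ≤ lam ^ 2 * volume.real Q + ∫ p in Q ∩ {p | lam < f p}, f p ^ 2 := by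
  have hm : MeasurableSet {p | lam < f p} := measurableSet_lt measurable_const hf.measurable
  rw [← integral_inter_add_sdiff hm hi.integrableOn, add_comm]
  gcongr
  have hfin : volume (Q \ {p | lam < f p}) ≠ ⊤ :=
    ((measure_mono sdiff_subset).trans_lt hQf.lt_top).ne
  calc ∫ p in Q \ {p | lam < f p}, f p ^ 2 ≤ ∫ p in Q \ {p | lam < f p}, lam ^ 2 :=
        setIntegral_mono_on hi.integrableOn (integrableOn_const hfin) (hQ.diff hm)
          fun p hp => pow_le_pow_left₀ (h0 p) (not_lt.1 hp.2) 2
    _ = lam ^ 2 * volume.real (Q \ {p | lam < f p}) := by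
        rw [setIntegral_const, smul_eq_mul, mul_comm]
    _ ≤ lam ^ 2 * volume.real Q := by
        gcongr
        exact sdiff_subset

/-- Vanishing of `L²` mass propagates from a set of positive measure to a surrounding square. -/
lemma IsMinimising.tendsto_square {ω : Set (ℝ × ℝ)} {f : ℕ → ℝ × ℝ → ℝ} (h : IsMinimising ω f)
    {α β s : ℝ} (hs : 0 < s) {ph : ℝ × ℝ → ℝ} (hp : IsRealTest ω ph) (hp0 : ∀ p, 0 ≤ ph p)
    (hp1 : ∀ p, ph p ≤ 1) (hphQ : ∀ p ∈ Icc α (α + s) ×ˢ Icc β (β + s), ph p = 1)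
    {Z : Set (ℝ × ℝ)} (hZ : MeasurableSet Z) (hZQ : Z ⊆ Icc α (α + s) ×ˢ Icc β (β + s))
    (hZ0 : volume Z ≠ 0) (hlim : Tendsto (fun n => ∫ p in Z, f n p ^ 2) atTop (nhds 0)) :
    Tendsto (fun n => ∫ p in Icc α (α + s) ×ˢ Icc β (β + s), f n p ^ 2) atTop (nhds 0) := by
  obtain ⟨C, hC0, hC⟩ := h.exists_setIntegral_le
  set Q := Icc α (α + s) ×ˢ Icc β (β + s) with hQdef
  have hQc : IsCompact Q := isCompact_Icc.prod isCompact_Icc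
  have hQm : MeasurableSet Q := measurableSet_Icc.prod measurableSet_Icc
  have hQf : volume Q ≠ ⊤ := hQc.measure_lt_top.ne
  have hZf : volume Z ≠ ⊤ := ((measure_mono hZQ).trans_lt hQf.lt_top).ne
  have hZpos : 0 < volume.real Z := ENNReal.toReal_pos hZ0 hZf
  have hvQ : volume.real Q = s ^ 2 := by
    rw [hQdef, Measure.volume_eq_prod, measureReal_prod_prod]; simp [hs.le, sq]
  set M := 1 + 4 * s ^ 4 * (4 * dirichlet ph + 2) with hM
  have hdp := dirichlet_nonneg ph
  have hE := E1_nonneg ω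
  have hM0 : 0 < M := by positivity
  rw [Metric.tendsto_atTop]
  intro δ hδ
  set lam := √(δ / 4) / s with hlam
  have hlam0 : 0 < lam := by positivity
  have hlam2 : lam ^ 2 * s ^ 2 = δ / 4 := by
    rw [hlam, div_pow, Real.sq_sqrt (by positivity)]; field_simp
  set T := 4 * C / δ + 1 with hT
  have hT0 : 0 < T := by positivity
  have hCT : C / T ≤ δ / 4 := by
    rw [div_le_iff₀ hT0, hT]
    have : δ / 4 * (4 * C / δ + 1) = C + δ / 4 := by field_simp
    linarith
  set B := 1 + T * M / (δ / 4 * volume.real Z) with hB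
  have hB1 : 1 < B := by
    have : 0 < T * M / (δ / 4 * volume.real Z) := by positivity
    linarith
  have hBb : T * M ≤ B ^ 2 * (δ / 4 * volume.real Z) := by
    have h1 : T * M ≤ B * (δ / 4 * volume.real Z) := by
      rw [← div_le_iff₀ (by positivity)]; linarith
    have h2 : B ≤ B ^ 2 := by nlinarith
    refine h1.trans ?_
    gcongr
  have hexp : 0 < Real.exp B - 1 := by
    have := Real.add_one_le_exp B; linarith
  set ε := lam / (Real.exp B - 1) with hε
  have hε0 : 0 < ε := by positivity
  have hεB : Real.log (1 + lam / ε) = B := by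
    have : 1 + lam / ε = Real.exp B := by rw [hε]; field_simp; ring
    rw [this, Real.log_exp]
  set G := 8 / ε ^ 2 * dirichlet ph + 2 / ε ^ 4 * (1 + E1 ω) + 1 with hG
  have hG0 : 0 < G := by positivity
  have ev1 : ∀ᶠ n in atTop, shifted ω (f n) < 1 / G :=
    h.tendsto.eventually_lt_const (by positivity)
  have ev2 : ∀ᶠ n in atTop, ∫ p in Z, f n p ^ 2 < ε ^ 2 / (2 * s ^ 2) :=
    hlim.eventually_lt_const (by positivity)
  obtain ⟨n0, hn0⟩ := eventually_atTop.1 (ev1.and ev2)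
  refine ⟨n0, fun n hn => ?_⟩
  obtain ⟨hn1, hn2⟩ := hn0 n hn
  have hnn : 0 ≤ ∫ p in Q, f n p ^ 2 := integral_nonneg fun _ => sq_nonneg _
  rw [Real.dist_eq, sub_zero, abs_of_nonneg hnn]
  have hft := h.test n
  have hf0 := h.nonneg n
  have hfi := integrable_sq hft.contDiff_one hft.2.1
  set l : ℝ × ℝ → ℝ := fun p => Real.log (1 + f n p / ε) with hl
  have hl1 : ContDiff ℝ 1 l := contDiff_log_one_add hft.contDiff_one hf0 hε0
  have hlc := hl1.continuous
  have hlQ : IntegrableOn (fun p => l p ^ 2) Q :=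
    Continuous.continuousOn (by fun_prop) |>.integrableOn_compact hQc
  have b1 := log_caccioppoli hft hf0 hp hp0 hp1 hε0 (t := 1 / G) (by positivity) hQm hphQ
  have b2 : shifted ω (f n) / (1 / G) ≤ 1 := by
    rw [div_le_one (by positivity)]; exact hn1.le
  have b3 : 1 / G * (8 / ε ^ 2 * dirichlet ph + 2 / ε ^ 4 * dirichlet (f n)) ≤ 1 := by
    rw [one_div_mul_eq_div, div_le_one hG0]
    have := mul_le_mul_of_nonneg_left (h.dirichlet_le n) (by positivity : 0 ≤ 2 / ε ^ 4)
    linarith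
  have b4 : ∫ p in Z, l p ^ 2 ≤ 1 / (2 * s ^ 2) := by
    calc ∫ p in Z, l p ^ 2 ≤ ∫ p in Z, f n p ^ 2 / ε ^ 2 := by
          refine integral_mono (hlQ.mono_set hZQ) (hfi.integrableOn.div_const _) fun p => ?_
          have q0 : 0 ≤ f n p / ε := div_nonneg (hf0 p) hε0.le
          have q1 : l p ≤ f n p / ε := by
            have := Real.log_le_sub_one_of_pos (by positivity : 0 < 1 + f n p / ε)
            simp only [hl]; linarith
          have q2 : 0 ≤ l p := Real.log_nonneg (by linarith)
          simp only
          rw [← div_pow]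
          exact pow_le_pow_left₀ q2 q1 2
      _ = (∫ p in Z, f n p ^ 2) / ε ^ 2 := integral_div _ _
      _ ≤ (ε ^ 2 / (2 * s ^ 2)) / ε ^ 2 := by gcongr
      _ = 1 / (2 * s ^ 2) := by field_simp
  have b5 := poincare_square hl1 hs hZ hZQ
  have b6 : volume.real Z * ∫ p in Q, l p ^ 2 ≤ M := by
    refine b5.trans ?_
    have c1 : 2 * s ^ 2 * (∫ p in Z, l p ^ 2) ≤ 1 := by
      calc _ ≤ 2 * s ^ 2 * (1 / (2 * s ^ 2)) := by gcongr
        _ = 1 := by field_simp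
    have c2 : 4 * s ^ 4 * ∫ p in Q, (d1 l p ^ 2 + d2 l p ^ 2)
        ≤ 4 * s ^ 4 * (4 * dirichlet ph + 2) := by
      gcongr
      linarith
    linarith
  have b7 := measureReal_superlevel_mul_le (lam := lam) (B := B) hQm hQf hft.1.continuous hlQ
    (by linarith) fun p hpl => by
      rw [← hεB]
      refine Real.log_le_log (by positivity) ?_
      gcongr
  set v := volume.real (Q ∩ {p | lam < f n p}) with hv
  have b8 : T * v ≤ δ / 4 := by
    have c1 : v * B ^ 2 * volume.real Z ≤ M := by
      calc _ ≤ (∫ p in Q, l p ^ 2) * volume.real Z := by gcongr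
        _ ≤ M := by rw [mul_comm]; exact b6
    have c2 : T * v * (B ^ 2 * volume.real Z) ≤ δ / 4 * (B ^ 2 * volume.real Z) := by
      calc _ = T * (v * B ^ 2 * volume.real Z) := by ring
        _ ≤ T * M := by gcongr
        _ ≤ _ := by linarith
    exact le_of_mul_le_mul_right c2 (by positivity)
  have b9 := setIntegral_sq_le_superlevel (lam := lam) hQm hQf hft.1.continuous hf0 hfi
  have b10 := hC n (Q ∩ {p | lam < f n p})
    ((measure_mono inter_subset_left).trans_lt hQf.lt_top).ne T hT0
  rw [hvQ, hlam2] at b9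
  linarith

lemma closedBall_eq_square (x : ℝ × ℝ) (r : ℝ) : Metric.closedBall x r =
    Icc (x.1 - r) (x.1 - r + 2 * r) ×ˢ Icc (x.2 - r) (x.2 - r + 2 * r) := by
  obtain ⟨a, b⟩ := x
  rw [← closedBall_prod_same, Real.closedBall_eq_Icc, Real.closedBall_eq_Icc]
  congr 2 <;> ring

lemma IsMinimising.tendsto_closedBall {ω : Set (ℝ × ℝ)} {f : ℕ → ℝ × ℝ → ℝ}
    (h : IsMinimising ω f) {x : ℝ × ℝ} {r : ℝ} (hr : 0 < r)
    (hx : Metric.closedBall x (2 * r) ⊆ ω)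
    {Z : Set (ℝ × ℝ)} (hZ : MeasurableSet Z) (hZQ : Z ⊆ Metric.closedBall x r)
    (hZ0 : volume Z ≠ 0) (hlim : Tendsto (fun n => ∫ p in Z, f n p ^ 2) atTop (nhds 0)) :
    Tendsto (fun n => ∫ p in Metric.closedBall x r, f n p ^ 2) atTop (nhds 0) := by
  let ph : ContDiffBump x := ⟨r, 2 * r, hr, by linarith⟩
  have hb : Metric.closedBall x r = _ := closedBall_eq_square x r
  rw [hb] at hZQ ⊢
  refine h.tendsto_square (by positivity) (ph := ph)
    ⟨ph.contDiff, ph.hasCompactSupport, ?_⟩ (fun p => ph.nonneg) (fun p => ph.le_one) ?_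
    hZ hZQ hZ0 hlim
  · rw [ph.tsupport_eq]; exact hx
  · intro p hp
    rw [← hb] at hp
    exact ph.one_of_mem_closedBall hp

lemma tendsto_setIntegral_sq_mono {f : ℕ → ℝ × ℝ → ℝ}
    (hi : ∀ n, Integrable fun p => f n p ^ 2) {S T : Set (ℝ × ℝ)} (hST : S ⊆ T)
    (hT : Tendsto (fun n => ∫ p in T, f n p ^ 2) atTop (nhds 0)) :
    Tendsto (fun n => ∫ p in S, f n p ^ 2) atTop (nhds 0) :=
  squeeze_zero (fun _ => integral_nonneg fun _ => sq_nonneg _)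
    (fun n => setIntegral_mono_set (hi n).integrableOn (ae_of_all _ fun _ => sq_nonneg _)
      hST.eventuallyLE) hT

lemma IsMinimising.integrable {ω : Set (ℝ × ℝ)} {f : ℕ → ℝ × ℝ → ℝ}
    (h : IsMinimising ω f) (n : ℕ) : Integrable fun p => f n p ^ 2 :=
  integrable_sq (h.test n).contDiff_one (h.test n).2.1

/-- In a connected domain, vanishing `L²` mass on a set of positive measure propagates
to a neighbourhood of every point. -/
lemma IsMinimising.tendsto_locally {ω : Set (ℝ × ℝ)} {f : ℕ → ℝ × ℝ → ℝ}
    (h : IsMinimising ω f) (ho : IsOpen ω) (hcon : IsConnected ω)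
    {Z : Set (ℝ × ℝ)} (hZ : MeasurableSet Z) (hZω : Z ⊆ ω) (hZ0 : volume Z ≠ 0)
    (hlim : Tendsto (fun n => ∫ p in Z, f n p ^ 2) atTop (nhds 0)) :
    ∀ x ∈ ω, ∃ r, 0 < r ∧
      Tendsto (fun n => ∫ p in Metric.closedBall x r, f n p ^ 2) atTop (nhds 0) := by
  have hball : ∀ x ∈ ω, ∃ r, 0 < r ∧ Metric.closedBall x (2 * r) ⊆ ω := by
    intro x hx
    obtain ⟨ε, hε, hsub⟩ := Metric.nhds_basis_closedBall.mem_iff.1 (ho.mem_nhds hx)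
    exact ⟨ε / 2, by positivity, by rwa [mul_div_cancel₀ _ two_ne_zero]⟩
  set W : Set (ℝ × ℝ) := {x | ∃ r, 0 < r ∧
      Tendsto (fun n => ∫ p in Metric.closedBall x r, f n p ^ 2) atTop (nhds 0)} with hW
  have hWo : IsOpen W := by
    rw [Metric.isOpen_iff]
    rintro x ⟨r, hr, hx⟩
    refine ⟨r / 2, by positivity, fun y hy => ⟨r / 2, by positivity, ?_⟩⟩
    refine tendsto_setIntegral_sq_mono h.integrable ?_ hx
    refine Metric.closedBall_subset_closedBall' ?_
    rw [Metric.mem_ball] at hy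
    linarith
  refine hcon.isPreconnected.subset_of_closure_inter_subset hWo ?_ ?_
  · obtain ⟨x, hx, hxZ⟩ := exists_mem_forall_mem_nhdsWithin_pos_measure hZ0
    obtain ⟨r, hr, hsub⟩ := hball x (hZω hx)
    refine ⟨x, hZω hx, r, hr, h.tendsto_closedBall hr hsub
      (hZ.inter Metric.isClosed_closedBall.measurableSet) inter_subset_right ?_
      (tendsto_setIntegral_sq_mono h.integrable inter_subset_left hlim)⟩
    refine (hxZ _ ?_).ne'
    exact inter_mem self_mem_nhdsWithin
      (mem_nhdsWithin_of_mem_nhds (Metric.closedBall_mem_nhds x hr))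
  · rintro x ⟨hxW, hxω⟩
    obtain ⟨r, hr, hsub⟩ := hball x hxω
    obtain ⟨y, ⟨r', hr', hy⟩, hyx⟩ := Metric.mem_closure_iff.1 hxW r hr
    set ρ := min r' (r - dist x y) with hρ
    have hρ0 : 0 < ρ := lt_min hr' (by linarith)
    have hym := tendsto_setIntegral_sq_mono h.integrable
      (Metric.closedBall_subset_closedBall (min_le_left r' (r - dist x y))) hy
    refine ⟨r, hr, h.tendsto_closedBall hr hsub Metric.isClosed_closedBall.measurableSet
      ?_ (Metric.measure_closedBall_pos volume y hρ0).ne' hym⟩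
    refine Metric.closedBall_subset_closedBall' ?_
    have := min_le_right r' (r - dist x y)
    rw [dist_comm y x]; linarith

lemma IsMinimising.tendsto_compact {ω : Set (ℝ × ℝ)} {f : ℕ → ℝ × ℝ → ℝ}
    (h : IsMinimising ω f) {K : Set (ℝ × ℝ)} (hK : IsCompact K)
    (hloc : ∀ x ∈ K, ∃ r, 0 < r ∧
      Tendsto (fun n => ∫ p in Metric.closedBall x r, f n p ^ 2) atTop (nhds 0)) :
    Tendsto (fun n => ∫ p in K, f n p ^ 2) atTop (nhds 0) := by
  refine hK.induction_on
    (p := fun S => Tendsto (fun n => ∫ p in S, f n p ^ 2) atTop (nhds 0)) (by simp)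
    (fun S T hST hT => tendsto_setIntegral_sq_mono h.integrable hST hT) ?_ ?_
  · intro S T hS hT
    have hsum := hS.add hT
    rw [add_zero] at hsum
    refine squeeze_zero (fun n => integral_nonneg fun _ => sq_nonneg _) (fun n => ?_) hsum
    rw [← integral_add_measure (h.integrable n).integrableOn (h.integrable n).integrableOn]
    exact integral_mono_measure (Measure.restrict_union_le S T) (ae_of_all _ fun _ => sq_nonneg _)
      ((h.integrable n).restrict.add_measure (h.integrable n).restrict)
  · intro x hx
    obtain ⟨r, hr, hx'⟩ := hloc x hx
    exact ⟨_, mem_nhdsWithin_of_mem_nhds (Metric.closedBall_mem_nhds x hr), hx'⟩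

/-- An approximately minimising sequence cannot lose its mass on a set of positive measure
without losing all of it. -/
lemma IsMinimising.tendsto_sqNorm {ω : Set (ℝ × ℝ)} {f : ℕ → ℝ × ℝ → ℝ}
    (h : IsMinimising ω f) (ho : IsOpen ω) (hb : Bornology.IsBounded ω) (hcon : IsConnected ω)
    {Z : Set (ℝ × ℝ)} (hZ : MeasurableSet Z) (hZω : Z ⊆ ω) (hZ0 : volume Z ≠ 0)
    (hlim : Tendsto (fun n => ∫ p in Z, f n p ^ 2) atTop (nhds 0)) :
    Tendsto (fun n => sqNorm (f n)) atTop (nhds 0) := by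
  obtain ⟨C, hC0, hC⟩ := h.exists_setIntegral_le
  have hloc := h.tendsto_locally ho hcon hZ hZω hZ0 hlim
  have hωf : volume ω ≠ ⊤ := hb.measure_lt_top.ne
  rw [Metric.tendsto_atTop]
  intro δ hδ
  set T := 4 * C / δ + 1 with hT
  have hT0 : 0 < T := by positivity
  have hCT : C / T ≤ δ / 4 := by
    rw [div_le_iff₀ hT0, hT]
    have : δ / 4 * (4 * C / δ + 1) = C + δ / 4 := by field_simp
    linarith
  obtain ⟨K, hKω, hK, hKd⟩ := ho.measurableSet.exists_isCompact_sdiff_lt hωf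
    (ε := ENNReal.ofReal (δ / 4 / T)) (by simp; positivity)
  have hKt := h.tendsto_compact hK fun x hx => hloc x (hKω hx)
  obtain ⟨n0, hn0⟩ := eventually_atTop.1 (hKt.eventually_lt_const (by positivity : 0 < δ / 4))
  refine ⟨n0, fun n hn => ?_⟩
  rw [Real.dist_eq, sub_zero, abs_of_nonneg (sqNorm_nonneg _)]
  have e : sqNorm (f n) = ∫ p in ω, f n p ^ 2 :=
    (setIntegral_eq_integral_of_tsupport (h.test n).2.2 fun p hp => by
      rw [image_eq_zero_of_notMem_tsupport hp]; norm_num).symm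
  have hdf : volume (ω \ K) ≠ ⊤ := ((measure_mono sdiff_subset).trans_lt hωf.lt_top).ne
  rw [e, ← integral_inter_add_sdiff hK.measurableSet (h.integrable n).integrableOn,
    inter_eq_self_of_subset_right hKω]
  have h1 := hn0 n hn
  have h2 := hC n (ω \ K) hdf T hT0
  have h3 : volume.real (ω \ K) ≤ δ / 4 / T := ENNReal.toReal_le_of_le_ofReal (by positivity) hKd.le
  have h4 : T * volume.real (ω \ K) ≤ δ / 4 := by
    calc _ ≤ T * (δ / 4 / T) := by gcongr
      _ = δ / 4 := by field_simp
  linarith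

section Scaling

variable {f : ℝ × ℝ → ℝ} (c : ℝ)

lemma sqNorm_const_mul : sqNorm (fun p => c * f p) = c ^ 2 * sqNorm f := by
  simp_rw [sqNorm, mul_pow, integral_const_mul]

lemma d1_const_mul (hf : Differentiable ℝ f) (p : ℝ × ℝ) :
    d1 (fun p => c * f p) p = c * d1 f p :=
  ((hasDerivAt_d1 hf p.1 p.2).const_mul c).deriv

lemma d2_const_mul (hf : Differentiable ℝ f) (p : ℝ × ℝ) :
    d2 (fun p => c * f p) p = c * d2 f p :=
  ((hasDerivAt_d2 hf p.1 p.2).const_mul c).deriv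

lemma dirichlet_const_mul (hf : Differentiable ℝ f) :
    dirichlet (fun p => c * f p) = c ^ 2 * dirichlet f := by
  simp_rw [dirichlet, d1_const_mul c hf, d2_const_mul c hf, mul_pow, ← mul_add,
    integral_const_mul]

lemma shifted_const_mul (ω : Set (ℝ × ℝ)) (hf : Differentiable ℝ f) :
    shifted ω (fun p => c * f p) = c ^ 2 * shifted ω f := by
  rw [shifted, shifted, dirichlet_const_mul c hf, sqNorm_const_mul]; ring

lemma IsRealTest.const_mul {ω : Set (ℝ × ℝ)} (hf : IsRealTest ω f) :
    IsRealTest ω fun p => c * f p :=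
  ⟨contDiff_const.mul hf.1, hf.2.1.mul_left,
    (closure_mono (Function.support_mul_subset_right _ _)).trans hf.2.2⟩

end Scaling

lemma exists_mass_const_of_nonneg {ω Z : Set (ℝ × ℝ)} (ho : IsOpen ω)
    (hb : Bornology.IsBounded ω) (hcon : IsConnected ω) (hZ : MeasurableSet Z) (hZω : Z ⊆ ω)
    (hZ0 : volume Z ≠ 0) : ∃ C : ℝ, 0 < C ∧ ∀ f, IsRealTest ω f → (∀ p, 0 ≤ f p) →
      sqNorm f ≤ C * (shifted ω f + ∫ p in Z, f p ^ 2) := by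
  by_contra! hcontra
  choose f hft hf0 hf using fun n : ℕ => hcontra (n + 1) (by positivity)
  have hm : ∀ n, 0 ≤ ∫ p in Z, f n p ^ 2 := fun n => integral_nonneg fun _ => sq_nonneg _
  have hsh : ∀ n, 0 ≤ shifted ω (f n) := fun n => shifted_nonneg (hft n)
  have hpos : ∀ n, 0 < sqNorm (f n) := fun n => by
    refine lt_of_le_of_lt ?_ (hf n)
    have := hm n; have := hsh n
    positivity
  set c : ℕ → ℝ := fun n => 1 / √(sqNorm (f n)) with hc
  have hc2 : ∀ n, c n ^ 2 = 1 / sqNorm (f n) := fun n => by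
    rw [hc, div_pow, one_pow, Real.sq_sqrt (hpos n).le]
  set g : ℕ → ℝ × ℝ → ℝ := fun n p => c n * f n p with hg
  have hg1 : ∀ n, sqNorm (g n) = 1 := fun n => by
    rw [hg, sqNorm_const_mul, hc2, one_div_mul_cancel (hpos n).ne']
  have hgs : ∀ n, shifted ω (g n) = shifted ω (f n) / sqNorm (f n) := fun n => by
    rw [hg, shifted_const_mul _ _ (hft n).differentiable, hc2, one_div_mul_eq_div]
  have hgZ : ∀ n, ∫ p in Z, g n p ^ 2 = (∫ p in Z, f n p ^ 2) / sqNorm (f n) := fun n => by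
    simp_rw [hg, mul_pow, integral_const_mul, hc2, one_div_mul_eq_div]
  have hb1 : ∀ n : ℕ, shifted ω (g n) ≤ 1 / ((n : ℝ) + 1) := fun n => by
    rw [hgs, div_le_div_iff₀ (hpos n) (by positivity)]
    have h1 := hf n
    have h2 : 0 ≤ ((n : ℝ) + 1) * ∫ p in Z, f n p ^ 2 := mul_nonneg (by positivity) (hm n)
    linarith
  have hb2 : ∀ n : ℕ, ∫ p in Z, g n p ^ 2 ≤ 1 / ((n : ℝ) + 1) := fun n => by
    rw [hgZ, div_le_div_iff₀ (hpos n) (by positivity)]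
    have h1 := hf n
    have h2 : 0 ≤ ((n : ℝ) + 1) * shifted ω (f n) := mul_nonneg (by positivity) (hsh n)
    linarith
  have hgt : ∀ n, IsRealTest ω (g n) := fun n => (hft n).const_mul (c n)
  have hmin : IsMinimising ω g :=
    { test := hgt
      nonneg := fun n p => mul_nonneg (by positivity) (hf0 n p)
      sqNorm_le := fun n => (hg1 n).le
      shifted_le := fun n => (hb1 n).trans <| by
        rw [div_le_one (by positivity)]; linarith [(Nat.cast_nonneg n : (0 : ℝ) ≤ n)]
      tendsto := squeeze_zero (fun n => shifted_nonneg (hgt n)) hb1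
        tendsto_one_div_add_atTop_nhds_zero_nat }
  have hlim := hmin.tendsto_sqNorm ho hb hcon hZ hZω hZ0
    (squeeze_zero (fun n => integral_nonneg fun _ => sq_nonneg _) hb2
      tendsto_one_div_add_atTop_nhds_zero_nat)
  simp_rw [hg1] at hlim
  exact one_ne_zero (tendsto_nhds_unique tendsto_const_nhds hlim)

lemma sqrt_sub_bounds (x : ℝ) {k : ℝ} (hk : 0 < k) :
    0 ≤ √(x ^ 2 + k ^ 2) - k ∧ √(x ^ 2 + k ^ 2) - k ≤ |x| ∧ |x| - k ≤ √(x ^ 2 + k ^ 2) - k := by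
  have h1 : k ≤ √(x ^ 2 + k ^ 2) := Real.le_sqrt_of_sq_le (by nlinarith [sq_nonneg x])
  have h2 : |x| ≤ √(x ^ 2 + k ^ 2) := Real.le_sqrt_of_sq_le (by rw [sq_abs]; nlinarith)
  have h3 : √(x ^ 2 + k ^ 2) ≤ |x| + k := by
    refine (Real.sqrt_le_left (by positivity)).2 ?_
    nlinarith [sq_abs x, abs_nonneg x]
  exact ⟨by linarith, by linarith, by linarith⟩

lemma hasDerivAt_regularised_abs {f : ℝ → ℝ} {f' x k : ℝ} (hf : HasDerivAt f f' x) (hk : 0 < k) :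
    HasDerivAt (fun s => √(f s ^ 2 + k ^ 2) - k) (f x * f' / √(f x ^ 2 + k ^ 2)) x := by
  have h0 : f x ^ 2 + k ^ 2 ≠ 0 := by positivity
  have h := (((hf.fun_pow 2).add_const (k ^ 2)).sqrt h0).sub_const k
  refine h.congr_deriv ?_
  have : √(f x ^ 2 + k ^ 2) ≠ 0 := by positivity
  field_simp
  ring

lemma regularised_deriv_sq_le (x y : ℝ) {k : ℝ} (hk : 0 < k) :
    (x * y / √(x ^ 2 + k ^ 2)) ^ 2 ≤ y ^ 2 := by
  rw [div_pow, Real.sq_sqrt (by positivity), div_le_iff₀ (by positivity)]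
  nlinarith [mul_nonneg (sq_nonneg y) (sq_nonneg k)]

/-- A Poincaré-type inequality: the `L²` norm is controlled by the shifted Dirichlet form and the
mass on a subset of positive measure. -/
lemma exists_mass_const {ω Z : Set (ℝ × ℝ)} (ho : IsOpen ω)
    (hb : Bornology.IsBounded ω) (hcon : IsConnected ω) (hZ : MeasurableSet Z) (hZω : Z ⊆ ω)
    (hZ0 : volume Z ≠ 0) : ∃ C : ℝ, 0 < C ∧ ∀ f, IsRealTest ω f →
      sqNorm f ≤ C * (shifted ω f + ∫ p in Z, f p ^ 2) := by
  obtain ⟨C, hC0, hC⟩ := exists_mass_const_of_nonneg ho hb hcon hZ hZω hZ0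
  refine ⟨C, hC0, fun f hf => ?_⟩
  have hfd := hf.differentiable
  have iabs : Integrable fun p => |f p| :=
    (hf.1.continuous.integrable_of_hasCompactSupport hf.2.1).abs
  have hE := E1_nonneg ω
  have key : ∀ k : ℝ, 0 < k → sqNorm f ≤ C * (shifted ω f + ∫ p in Z, f p ^ 2)
      + k * (2 * (1 + C * E1 ω) * ∫ p, |f p|) := by
    intro k hk
    set g : ℝ × ℝ → ℝ := fun p => √(f p ^ 2 + k ^ 2) - k with hg
    have hgs : ContDiff ℝ (⊤ : ℕ∞) g :=
      (((hf.1.pow 2).add contDiff_const).sqrt fun p => by positivity).sub contDiff_const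
    have hsub : Function.support g ⊆ Function.support f := by
      intro p hp hfp
      refine hp ?_
      simp [hg, hfp, Real.sqrt_sq hk.le]
    have hgt : IsRealTest ω g :=
      ⟨hgs, hf.2.1.mono hsub, (closure_mono hsub).trans hf.2.2⟩
    have hg0 : ∀ p, 0 ≤ g p := fun p => (sqrt_sub_bounds (f p) hk).1
    have hgf : ∀ p, g p ^ 2 ≤ f p ^ 2 := fun p => by
      rw [← sq_abs (f p)]
      exact pow_le_pow_left₀ (hg0 p) (sqrt_sub_bounds (f p) hk).2.1 2
    have ig := integrable_sq hgt.contDiff_one hgt.2.1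
    have iff := integrable_sq hf.contDiff_one hf.2.1
    have h1 : sqNorm f ≤ sqNorm g + k * (2 * ∫ p, |f p|) := by
      have e : sqNorm g + k * (2 * ∫ p, |f p|) = ∫ p, (g p ^ 2 + k * (2 * |f p|)) := by
        rw [integral_add ig ((iabs.const_mul 2).const_mul k), integral_const_mul,
          integral_const_mul]; rfl
      rw [e]
      refine integral_mono iff (ig.add ((iabs.const_mul 2).const_mul k)) fun p => ?_
      obtain ⟨a1, a2, a3⟩ := sqrt_sub_bounds (f p) hk
      have a4 : |f p| ^ 2 ≤ g p ^ 2 + k * (2 * |f p|) := by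
        have b1 : |f p| - g p ≤ k := by simp only [hg]; linarith
        have b2 : 0 ≤ |f p| - g p := by simp only [hg]; linarith
        have b3 : |f p| + g p ≤ 2 * |f p| := by linarith
        have b4 := mul_le_mul b1 b3 (by have := hg0 p; positivity) hk.le
        nlinarith
      simpa [sq_abs] using a4
    have h2 : dirichlet g ≤ dirichlet f := by
      refine integral_mono ((integrable_d1_sq hgt.contDiff_one hgt.2.1).add
        (integrable_d2_sq hgt.contDiff_one hgt.2.1))
        ((integrable_d1_sq hf.contDiff_one hf.2.1).add
        (integrable_d2_sq hf.contDiff_one hf.2.1)) fun p => ?_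
      have c1 : d1 g p = _ := (hasDerivAt_regularised_abs (hasDerivAt_d1 hfd p.1 p.2) hk).deriv
      have c2 : d2 g p = _ := (hasDerivAt_regularised_abs (hasDerivAt_d2 hfd p.1 p.2) hk).deriv
      simp only [c1, c2]
      exact add_le_add (regularised_deriv_sq_le _ _ hk) (regularised_deriv_sq_le _ _ hk)
    have h3 : ∫ p in Z, g p ^ 2 ≤ ∫ p in Z, f p ^ 2 :=
      integral_mono ig.integrableOn iff.integrableOn hgf
    have h4 : shifted ω g ≤ shifted ω f + E1 ω * (k * (2 * ∫ p, |f p|)) := by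
      have := mul_le_mul_of_nonneg_left h1 hE
      rw [shifted, shifted]; linarith
    have h5 := hC g hgt hg0
    have h6 : C * (shifted ω g + ∫ p in Z, g p ^ 2) ≤
        C * ((shifted ω f + E1 ω * (k * (2 * ∫ p, |f p|))) + ∫ p in Z, f p ^ 2) := by gcongr
    linarith
  refine le_of_forall_pos_le_add fun ε hε => ?_
  set A := 2 * (1 + C * E1 ω) * ∫ p, |f p| with hA
  have hA0 : 0 ≤ A := mul_nonneg (by positivity) (integral_nonneg fun _ => abs_nonneg _)
  refine (key (ε / (A + 1)) (by positivity)).trans ?_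
  gcongr
  rw [div_mul_eq_mul_div, div_le_iff₀ (by positivity)]
  nlinarith

lemma rot_rot (α β : ℝ) (p : ℝ × ℝ) : rot α (rot β p) = rot (α + β) p := by
  simp only [rot, Real.cos_add, Real.sin_add, Prod.mk.injEq]
  constructor <;> ring

lemma rot_zero (p : ℝ × ℝ) : rot 0 p = p := by simp [rot]

lemma rot_neg_rot (α : ℝ) (p : ℝ × ℝ) : rot (-α) (rot α p) = p := by
  rw [rot_rot, neg_add_cancel, rot_zero]

lemma rot_rot_neg (α : ℝ) (p : ℝ × ℝ) : rot α (rot (-α) p) = p := by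
  rw [rot_rot, add_neg_cancel, rot_zero]

lemma continuous_rot (α : ℝ) : Continuous (rot α) := by unfold rot; fun_prop

lemma rot_image (α : ℝ) (s : Set (ℝ × ℝ)) : rot α '' s = rot (-α) ⁻¹' s :=
  congrFun (image_eq_preimage_of_inverse (rot_neg_rot α) (rot_rot_neg α)) s

lemma measurePreserving_rot (α : ℝ) : MeasurePreserving (rot α) := by
  refine ⟨(continuous_rot α).measurable, ?_⟩
  set M : Matrix (Fin 2) (Fin 2) ℝ :=
    !![Real.cos α, Real.sin α; -Real.sin α, Real.cos α] with hM
  set L := Matrix.toLin (Module.Basis.finTwoProd ℝ) (Module.Basis.finTwoProd ℝ) M with hL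
  have hrot : rot α = L := by
    ext p
    · simp [hL, hM, rot, Matrix.toLin_finTwoProd]; ring
    · simp [hL, hM, rot, Matrix.toLin_finTwoProd]; ring
  have hdet : LinearMap.det L = 1 := by
    rw [hL, LinearMap.det_toLin, hM, Matrix.det_fin_two_of]
    nlinarith [Real.sin_sq_add_cos_sq α]
  rw [hrot, Measure.map_linearMap_addHaar_eq_smul_addHaar _ (by rw [hdet]; norm_num), hdet]
  simp

lemma rot_preimage_ae_eq {ω : Set (ℝ × ℝ)} (ho : IsOpen ω) (hb : Bornology.IsBounded ω) {β : ℝ}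
    (h : volume (ω \ rot β ⁻¹' ω) = 0) : (rot β ⁻¹' ω : Set (ℝ × ℝ)) =ᵐ[volume] ω := by
  have hm : volume (rot β ⁻¹' ω) = volume ω :=
    (measurePreserving_rot β).measure_preimage ho.measurableSet.nullMeasurableSet
  refine (ae_eq_of_ae_subset_of_measure_ge (ae_le_set.2 h) hm.le
    ho.measurableSet.nullMeasurableSet ?_).symm
  rw [hm]; exact hb.measure_lt_top.ne

lemma rot_nsmul_preimage_ae_eq {ω : Set (ℝ × ℝ)} {β : ℝ}
    (h : (rot β ⁻¹' ω : Set (ℝ × ℝ)) =ᵐ[volume] ω) (n : ℕ) :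
    (rot (n * β) ⁻¹' ω : Set (ℝ × ℝ)) =ᵐ[volume] ω := by
  induction n with
  | zero =>
    have : rot ((0 : ℕ) * β) ⁻¹' ω = ω := by ext p; simp [rot_zero]
    exact Eq.eventuallyEq this
  | succ n ih =>
    have : rot ((n + 1 : ℕ) * β) ⁻¹' ω = rot (n * β) ⁻¹' (rot β ⁻¹' ω) := by
      ext p
      simp only [mem_preimage, rot_rot]
      push_cast; ring_nf
    rw [this]
    exact ((measurePreserving_rot _).quasiMeasurePreserving.preimage_ae_eq h).trans ih

/-- A cross-section without rotational symmetry is not invariant under arbitrarily small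
rotations, in either direction. -/
lemma exists_small_rot {ω : Set (ℝ × ℝ)} (ho : IsOpen ω) (hb : Bornology.IsBounded ω)
    (h : ∃ ϑ ∈ Set.Ioo (0 : ℝ) (2 * Real.pi), volume (symmDiff (rot ϑ '' ω) ω) ≠ 0)
    {κ : ℝ} (hκ : 0 < κ) : ∃ α, 0 < α ∧ α ≤ κ ∧ volume (ω \ rot α ⁻¹' ω) ≠ 0 ∧
      volume (ω \ rot (-α) ⁻¹' ω) ≠ 0 := by
  obtain ⟨ϑ, ⟨h0, -⟩, hne⟩ := h
  obtain ⟨N, hN⟩ := exists_nat_gt (ϑ / κ)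
  have hN0 : (0 : ℝ) < N := lt_trans (by positivity) hN
  rw [rot_image, Ne, measure_symmDiff_eq_zero_iff] at hne
  refine ⟨ϑ / N, by positivity, ?_, fun hz => hne ?_, fun hz => hne ?_⟩
  · rw [div_le_iff₀ hN0]
    rw [div_lt_iff₀ hκ] at hN
    linarith
  · have h1 := rot_nsmul_preimage_ae_eq (rot_preimage_ae_eq ho hb hz) N
    rw [mul_div_cancel₀ _ hN0.ne'] at h1
    have h2 := (measurePreserving_rot (-ϑ)).quasiMeasurePreserving.preimage_ae_eq h1
    have e : rot (-ϑ) ⁻¹' (rot ϑ ⁻¹' ω) = ω := by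
      ext p; simp [rot_rot_neg]
    rw [e] at h2
    exact h2.symm
  · have h1 := rot_nsmul_preimage_ae_eq (rot_preimage_ae_eq ho hb hz) N
    rwa [mul_neg, mul_div_cancel₀ _ hN0.ne'] at h1

lemma hasDerivAt_rot_fst (p : ℝ × ℝ) {g : ℝ → ℝ} {g' t : ℝ} (hg : HasDerivAt g g' t) :
    HasDerivAt (fun t => rot (g t) p) (g' • ((rot (g t) p).2, -(rot (g t) p).1)) t := by
  have h1 := (hg.cos.const_mul p.1).add (hg.sin.const_mul p.2)
  have h2 := (hg.sin.const_mul (-p.1)).add (hg.cos.const_mul p.2)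
  refine (h1.prodMk h2).congr_deriv ?_
  simp only [rot, Prod.smul_mk, smul_eq_mul, Prod.mk.injEq]
  constructor <;> ring

/-- The longitudinal derivative `∂₁ψ - σ ∂_τψ` in a twisted tube with twisting rate `σ`. -/
def twd {E : Type*} [NormedAddCommGroup E] [NormedSpace ℝ E] (σ : ℝ → ℝ)
    (ψ : ℝ × ℝ × ℝ → E) (x : ℝ × ℝ × ℝ) : E :=
  pd1 ψ x - σ x.1 • pdtau ψ x

section Space

variable {E : Type*} [NormedAddCommGroup E] [NormedSpace ℝ E] {ψ : ℝ × ℝ × ℝ → E}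

lemma hasDerivAt_pd1 (hd : Differentiable ℝ ψ) (a b c : ℝ) :
    HasDerivAt (fun t => ψ (t, b, c)) (pd1 ψ (a, b, c)) a :=
  ((hd (a, b, c)).comp a
    (differentiableAt_id.prodMk (differentiableAt_const (b, c)))).hasDerivAt

lemma hasDerivAt_pd2 (hd : Differentiable ℝ ψ) (a b c : ℝ) :
    HasDerivAt (fun t => ψ (a, t, c)) (pd2 ψ (a, b, c)) b :=
  ((hd (a, b, c)).comp b ((differentiableAt_const a).prodMk
    (differentiableAt_id.prodMk (differentiableAt_const c)))).hasDerivAt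

lemma hasDerivAt_pd3 (hd : Differentiable ℝ ψ) (a b c : ℝ) :
    HasDerivAt (fun t => ψ (a, b, t)) (pd3 ψ (a, b, c)) c :=
  ((hd (a, b, c)).comp c ((differentiableAt_const a).prodMk
    ((differentiableAt_const b).prodMk differentiableAt_id))).hasDerivAt

lemma pd1_eq_fderiv (hd : Differentiable ℝ ψ) : pd1 ψ = fun x => fderiv ℝ ψ x (1, 0, 0) := by
  ext ⟨a, b, c⟩
  exact (hasDerivAt_pd1 hd a b c).unique ((hd (a, b, c)).hasFDerivAt.comp_hasDerivAt a
    ((hasDerivAt_id a).prodMk (hasDerivAt_const a (b, c))))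

lemma pd2_eq_fderiv (hd : Differentiable ℝ ψ) : pd2 ψ = fun x => fderiv ℝ ψ x (0, 1, 0) := by
  ext ⟨a, b, c⟩
  exact (hasDerivAt_pd2 hd a b c).unique ((hd (a, b, c)).hasFDerivAt.comp_hasDerivAt b
    ((hasDerivAt_const b a).prodMk ((hasDerivAt_id b).prodMk (hasDerivAt_const b c))))

lemma pd3_eq_fderiv (hd : Differentiable ℝ ψ) : pd3 ψ = fun x => fderiv ℝ ψ x (0, 0, 1) := by
  ext ⟨a, b, c⟩
  exact (hasDerivAt_pd3 hd a b c).unique ((hd (a, b, c)).hasFDerivAt.comp_hasDerivAt c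
    ((hasDerivAt_const c a).prodMk ((hasDerivAt_const c b).prodMk (hasDerivAt_id c))))

lemma pdtau_eq_fderiv (hd : Differentiable ℝ ψ) (x : ℝ × ℝ × ℝ) :
    pdtau ψ x = fderiv ℝ ψ x (0, x.2.2, -x.2.1) := by
  have e : ((0 : ℝ), x.2.2, -x.2.1) =
      x.2.2 • ((0 : ℝ), (1 : ℝ), (0 : ℝ)) - x.2.1 • ((0 : ℝ), (0 : ℝ), (1 : ℝ)) := by
    ext <;> simp
  rw [pdtau, pd2_eq_fderiv hd, pd3_eq_fderiv hd, e, map_sub, map_smul, map_smul]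

lemma twd_eq_fderiv (hd : Differentiable ℝ ψ) (σ : ℝ → ℝ) (x : ℝ × ℝ × ℝ) :
    twd σ ψ x = fderiv ℝ ψ x (1, -σ x.1 * x.2.2, σ x.1 * x.2.1) := by
  have e : ((1 : ℝ), -σ x.1 * x.2.2, σ x.1 * x.2.1) =
      ((1 : ℝ), (0 : ℝ), (0 : ℝ)) - σ x.1 • ((0 : ℝ), x.2.2, -x.2.1) := by
    ext <;> simp
  rw [twd, pd1_eq_fderiv hd, pdtau_eq_fderiv hd, e, map_sub, map_smul]

lemma fderiv_apply_eq_zero {v x : ℝ × ℝ × ℝ} (hx : x ∉ tsupport ψ) : fderiv ℝ ψ x v = 0 := by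
  simp [fderiv_of_notMem_tsupport ℝ hx]

lemma hasCompactSupport_fderiv_apply (hc : HasCompactSupport ψ)
    (w : ℝ × ℝ × ℝ → ℝ × ℝ × ℝ) : HasCompactSupport fun x => fderiv ℝ ψ x (w x) :=
  HasCompactSupport.intro hc fun _ hx => fderiv_apply_eq_zero hx

lemma continuous_fderiv_apply' (h : ContDiff ℝ 1 ψ) {w : ℝ × ℝ × ℝ → ℝ × ℝ × ℝ}
    (hw : Continuous w) : Continuous fun x => fderiv ℝ ψ x (w x) :=
  (h.continuous_fderiv one_ne_zero).clm_apply hw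

/-- Continuity and compact support of the first order derivatives of a test function. -/
lemma continuous_hasCompactSupport_pd (h : ContDiff ℝ 1 ψ) (hc : HasCompactSupport ψ) {σ : ℝ → ℝ}
    (hσ : Continuous σ) :
    (Continuous (pd1 ψ) ∧ HasCompactSupport (pd1 ψ)) ∧
    (Continuous (pd2 ψ) ∧ HasCompactSupport (pd2 ψ)) ∧
    (Continuous (pd3 ψ) ∧ HasCompactSupport (pd3 ψ)) ∧
    (Continuous (twd σ ψ) ∧ HasCompactSupport (twd σ ψ)) := by
  have hd := h.differentiable one_ne_zero
  rw [pd1_eq_fderiv hd, pd2_eq_fderiv hd, pd3_eq_fderiv hd, funext (twd_eq_fderiv hd σ)]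
  exact ⟨⟨continuous_fderiv_apply' h (by fun_prop), hasCompactSupport_fderiv_apply hc _⟩,
    ⟨continuous_fderiv_apply' h (by fun_prop), hasCompactSupport_fderiv_apply hc _⟩,
    ⟨continuous_fderiv_apply' h (by fun_prop), hasCompactSupport_fderiv_apply hc _⟩,
    ⟨continuous_fderiv_apply' h (by fun_prop), hasCompactSupport_fderiv_apply hc _⟩⟩

lemma IsTest3.contDiff_one {Ω : Set (ℝ × ℝ × ℝ)} (h : IsTest3 Ω ψ) : ContDiff ℝ 1 ψ :=
  h.1.of_le (by exact_mod_cast le_top)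

lemma IsTest3.differentiable {Ω : Set (ℝ × ℝ × ℝ)} (h : IsTest3 Ω ψ) : Differentiable ℝ ψ :=
  h.contDiff_one.differentiable one_ne_zero

end Space

section TestFunctions

variable {ω : Set (ℝ × ℝ)} {ψ : ℝ × ℝ × ℝ → ℝ}

/-- The restriction of a function on the tube to a cross-section. -/
def slice (ψ : ℝ × ℝ × ℝ → ℝ) (t : ℝ) (p : ℝ × ℝ) : ℝ := ψ (t, p)

lemma IsTest3.slice (h : IsTest3 (Omega0 ω) ψ) (t : ℝ) : IsRealTest ω (slice ψ t) := by
  have hcl : Topology.IsClosedEmbedding (fun p : ℝ × ℝ => (t, p)) :=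
    Topology.IsClosedEmbedding.of_continuous_injective_isClosedMap (by fun_prop)
      (Prod.mk_right_injective t) (isClosedMap_prodMk_left t)
  refine ⟨h.1.comp (contDiff_const.prodMk contDiff_id), h.2.1.comp_isClosedEmbedding hcl, ?_⟩
  have h1 : tsupport (_root_.slice ψ t) ⊆ (fun p : ℝ × ℝ => (t, p)) ⁻¹' tsupport ψ :=
    closure_minimal (fun p hp => subset_tsupport _ hp)
      ((isClosed_tsupport ψ).preimage hcl.continuous)
  exact fun p hp => h.2.2 (h1 hp)

lemma IsTest3.eq_zero (h : IsTest3 (Omega0 ω) ψ) {t : ℝ} {p : ℝ × ℝ} (hp : p ∉ ω) :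
    ψ (t, p) = 0 :=
  image_eq_zero_of_notMem_tsupport fun hm => hp (h.2.2 hm)

lemma hasDerivAt_rotated (hd : Differentiable ℝ ψ) {Θ σ : ℝ → ℝ}
    (hΘ : ∀ t, HasDerivAt Θ (σ t) t) (c : ℝ) (p : ℝ × ℝ) (t : ℝ) :
    HasDerivAt (fun t => ψ (t, rot (c - Θ t) p)) (twd σ ψ (t, rot (c - Θ t) p)) t := by
  have h1 := hasDerivAt_rot_fst p ((hΘ t).const_sub c)
  have h := (hd (t, rot (c - Θ t) p)).hasFDerivAt.comp_hasDerivAt t ((hasDerivAt_id t).prodMk h1)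
  refine h.congr_deriv ?_
  rw [twd_eq_fderiv hd]
  simp

lemma continuous_rotated {γ : ℝ → ℝ} (hγ : Continuous γ) :
    Continuous fun x : ℝ × ℝ × ℝ => (x.1, rot (γ x.1) x.2) := by
  unfold rot; fun_prop

/-- Rotation of each cross-section by an angle depending on the longitudinal variable. -/
def twistHomeomorph {γ : ℝ → ℝ} (hγ : Continuous γ) : (ℝ × ℝ × ℝ) ≃ₜ (ℝ × ℝ × ℝ) where
  toFun x := (x.1, rot (γ x.1) x.2)
  invFun x := (x.1, rot (-γ x.1) x.2)
  left_inv x := by simp [rot_neg_rot]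
  right_inv x := by simp [rot_rot_neg]
  continuous_toFun := continuous_rotated hγ
  continuous_invFun := continuous_rotated hγ.neg

lemma integral_rotated (F : ℝ × ℝ → ℝ) (hF : Continuous F) (α : ℝ) :
    ∫ p, F (rot α p) = ∫ p, F p := by
  have h := measurePreserving_rot α
  have e := integral_map (μ := volume) h.measurable.aemeasurable
    (f := F) hF.aestronglyMeasurable
  rw [← e, h.map_eq]

end TestFunctions

section Fubini

variable {F : ℝ × ℝ × ℝ → ℝ}

lemma integrable_slab (hF : Integrable F) (S : Set ℝ) :
    Integrable F ((volume.restrict S).prod (volume : Measure (ℝ × ℝ))) := by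
  have h := hF.restrict (s := S ×ˢ (univ : Set (ℝ × ℝ)))
  rwa [Measure.volume_eq_prod, ← Measure.prod_restrict, Measure.restrict_univ] at h

lemma integrable_integral_slice (hF : Integrable F) : Integrable fun t => ∫ p, F (t, p) :=
  Integrable.integral_prod_left (ν := (volume : Measure (ℝ × ℝ))) hF

lemma integral_slice (hF : Integrable F) : ∫ x, F x = ∫ t, ∫ p, F (t, p) :=
  integral_prod (ν := (volume : Measure (ℝ × ℝ))) F hF

lemma setIntegral_slice_swap (hF : Integrable F) (S : Set ℝ) :
    ∫ t in S, ∫ p, F (t, p) = ∫ p, ∫ t in S, F (t, p) :=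
  integral_integral_swap (f := fun t p => F (t, p)) (integrable_slab hF S)

lemma integrable_setIntegral_slice (hF : Integrable F) (S : Set ℝ) :
    Integrable fun p : ℝ × ℝ => ∫ t in S, F (t, p) :=
  Integrable.integral_prod_right (integrable_slab hF S)

end Fubini

section Slicing

variable {ω : Set (ℝ × ℝ)} {ψ : ℝ × ℝ × ℝ → ℝ}

lemma shifted_slice_eq (h : IsTest3 (Omega0 ω) ψ) (t : ℝ) : shifted ω (slice ψ t) =
    ∫ p, (pd2 ψ (t, p) ^ 2 + pd3 ψ (t, p) ^ 2 - E1 ω * ψ (t, p) ^ 2) := by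
  have hs := h.slice t
  have e := integral_sub ((integrable_d1_sq hs.contDiff_one hs.2.1).add
    (integrable_d2_sq hs.contDiff_one hs.2.1)) ((integrable_sq hs.contDiff_one hs.2.1).const_mul
    (E1 ω))
  rw [integral_const_mul] at e
  exact e.symm

lemma integrable_pd_sq (h : IsTest3 (Omega0 ω) ψ) {σ : ℝ → ℝ} (hσ : Continuous σ) :
    (Integrable fun x => ψ x ^ 2) ∧ (Integrable fun x => pd1 ψ x ^ 2) ∧
    (Integrable fun x => pd2 ψ x ^ 2) ∧ (Integrable fun x => pd3 ψ x ^ 2) ∧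
    (Integrable fun x => twd σ ψ x ^ 2) := by
  obtain ⟨⟨a1, a2⟩, ⟨b1, b2⟩, ⟨c1, c2⟩, ⟨e1, e2⟩⟩ :=
    continuous_hasCompactSupport_pd h.contDiff_one h.2.1 hσ
  exact ⟨integrable_sq_of_compactSupport h.1.continuous h.2.1,
    integrable_sq_of_compactSupport a1 a2, integrable_sq_of_compactSupport b1 b2,
    integrable_sq_of_compactSupport c1 c2, integrable_sq_of_compactSupport e1 e2⟩

lemma integrable_shifted_density (h : IsTest3 (Omega0 ω) ψ) :
    Integrable fun x => pd2 ψ x ^ 2 + pd3 ψ x ^ 2 - E1 ω * ψ x ^ 2 := by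
  obtain ⟨i0, -, i2, i3, -⟩ := integrable_pd_sq h continuous_const (σ := fun _ => 0)
  exact (i2.add i3).sub (i0.const_mul _)

lemma integrable_shifted_slice (h : IsTest3 (Omega0 ω) ψ) :
    Integrable fun t => shifted ω (slice ψ t) := by
  simp only [shifted_slice_eq h]
  exact integrable_integral_slice (integrable_shifted_density h)

lemma integrable_sqNorm_slice (h : IsTest3 (Omega0 ω) ψ) :
    Integrable fun t => sqNorm (slice ψ t) :=
  integrable_integral_slice (integrable_sq_of_compactSupport h.1.continuous h.2.1)

/-- A test function vanishes at points rotated out of the cross-section, so its mass on them is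
controlled by the longitudinal energy. -/
lemma setIntegral_sq_le_of_rotated (h : IsTest3 (Omega0 ω) ψ) (ho : IsOpen ω) {Θ σ : ℝ → ℝ}
    (hΘ : ∀ t, HasDerivAt Θ (σ t) t) (hσ : Continuous σ) {a b t₀ t₁ : ℝ} (h0 : t₀ ∈ Icc a b)
    (h1 : t₁ ∈ Icc a b) :
    ∫ p in ω \ rot (Θ t₀ - Θ t₁) ⁻¹' ω, ψ (t₀, p) ^ 2 ≤
      (b - a) * ∫ t in Icc a b, ∫ p, twd σ ψ (t, p) ^ 2 := by
  have hab : 0 ≤ b - a := by linarith [h0.1.trans h0.2]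
  have hd := h.differentiable
  have hΘc : Continuous Θ := continuous_iff_continuousAt.2 fun t => (hΘ t).continuousAt
  have hγ : Continuous fun t => Θ t₀ - Θ t := by fun_prop
  obtain ⟨-, -, -, kc, ks⟩ := continuous_hasCompactSupport_pd h.contDiff_one h.2.1 hσ
  set F : ℝ × ℝ × ℝ → ℝ := fun x => twd σ ψ (x.1, rot (Θ t₀ - Θ x.1) x.2) ^ 2 with hF
  have hFi : Integrable F := integrable_sq_of_compactSupport (kc.comp (continuous_rotated hγ))
    (ks.comp_homeomorph (twistHomeomorph hγ))
  set Z := ω \ rot (Θ t₀ - Θ t₁) ⁻¹' ω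
  have hZ : MeasurableSet Z :=
    ho.measurableSet.diff ((continuous_rot _).measurable ho.measurableSet)
  have hpt : ∀ p ∈ Z, ψ (t₀, p) ^ 2 ≤ (b - a) * ∫ t in Icc a b, F (t, p) := by
    intro p hp
    have key := sq_sub_le (fun t => hasDerivAt_rotated hd hΘ (Θ t₀) p t)
      (kc.comp ((continuous_rotated hγ).comp (by fun_prop : Continuous fun t : ℝ => (t, p))))
      h1 h0
    have e1 : ψ (t₁, rot (Θ t₀ - Θ t₁) p) = 0 := h.eq_zero hp.2
    rw [sub_self, rot_zero, e1, sub_zero] at key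
    exact key
  have hs := h.slice t₀
  have i1 : Integrable fun p : ℝ × ℝ => ∫ t in Icc a b, F (t, p) :=
    integrable_setIntegral_slice hFi _
  calc ∫ p in Z, ψ (t₀, p) ^ 2 ≤ ∫ p in Z, (b - a) * ∫ t in Icc a b, F (t, p) :=
        setIntegral_mono_on (integrable_sq hs.contDiff_one hs.2.1).integrableOn
          (i1.const_mul _).integrableOn hZ hpt
    _ ≤ ∫ p, (b - a) * ∫ t in Icc a b, F (t, p) :=
        setIntegral_le_integral (i1.const_mul _) (ae_of_all _ fun p =>
          mul_nonneg hab (integral_nonneg fun _ => sq_nonneg _))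
    _ = (b - a) * ∫ t in Icc a b, ∫ p, F (t, p) := by
        rw [integral_const_mul, setIntegral_slice_swap hFi]
    _ = _ := by
        congr 2
        ext t
        have c1 : Continuous fun p : ℝ × ℝ => twd σ ψ (t, p) ^ 2 :=
          (kc.comp (by fun_prop : Continuous fun p : ℝ × ℝ => (t, p))).pow 2
        exact integral_rotated (fun p => twd σ ψ (t, p) ^ 2) c1 (Θ t₀ - Θ t)

/-- The local Hardy inequality in a twisted piece of the tube. -/
lemma exists_local_hardy (ho : IsOpen ω) (hb : Bornology.IsBounded ω) (hcon : IsConnected ω)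
    {α : ℝ} (h1 : volume (ω \ rot α ⁻¹' ω) ≠ 0) (h2 : volume (ω \ rot (-α) ⁻¹' ω) ≠ 0) :
    ∃ C, 0 < C ∧ ∀ (Θ σ : ℝ → ℝ), (∀ t, HasDerivAt Θ (σ t) t) → Continuous σ →
      ∀ a b : ℝ, a ≤ b → (∀ t₀ ∈ Icc a b, ∃ t₁ ∈ Icc a b, Θ t₀ - Θ t₁ = α ∨ Θ t₀ - Θ t₁ = -α) →
      ∀ ψ : ℝ × ℝ × ℝ → ℝ, IsTest3 (Omega0 ω) ψ →
        ∫ t in Icc a b, sqNorm (slice ψ t) ≤ C * ((∫ t in Icc a b, shifted ω (slice ψ t)) +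
          (b - a) ^ 2 * ∫ t in Icc a b, ∫ p, twd σ ψ (t, p) ^ 2) := by
  have hm : ∀ β : ℝ, MeasurableSet (ω \ rot β ⁻¹' ω) := fun β =>
    ho.measurableSet.diff ((continuous_rot _).measurable ho.measurableSet)
  obtain ⟨C₁, hC₁, H₁⟩ := exists_mass_const ho hb hcon (hm α) sdiff_subset h1
  obtain ⟨C₂, hC₂, H₂⟩ := exists_mass_const ho hb hcon (hm (-α)) sdiff_subset h2
  refine ⟨max C₁ C₂, by positivity, fun Θ σ hΘ hσ a b hab ht ψ h => ?_⟩
  set K := ∫ t in Icc a b, ∫ p, twd σ ψ (t, p) ^ 2 with hK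
  have hK0 : 0 ≤ K := integral_nonneg fun _ => integral_nonneg fun _ => sq_nonneg _
  have hpt : ∀ t ∈ Icc a b, sqNorm (slice ψ t) ≤
      max C₁ C₂ * (shifted ω (slice ψ t) + (b - a) * K) := by
    intro t₀ h0
    obtain ⟨t₁, ht₁, hα⟩ := ht t₀ h0
    have hs := shifted_nonneg (h.slice t₀)
    have hZ := setIntegral_sq_le_of_rotated h ho hΘ hσ h0 ht₁
    have hnn : ∀ S : Set (ℝ × ℝ), 0 ≤ ∫ p in S, slice ψ t₀ p ^ 2 := fun S =>
      integral_nonneg fun _ => sq_nonneg _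
    rcases hα with hα | hα <;> rw [hα] at hZ
    · refine (H₁ _ (h.slice t₀)).trans (mul_le_mul (le_max_left _ _) ?_
        (add_nonneg hs (hnn _)) (by positivity))
      exact add_le_add le_rfl hZ
    · refine (H₂ _ (h.slice t₀)).trans (mul_le_mul (le_max_right _ _) ?_
        (add_nonneg hs (hnn _)) (by positivity))
      exact add_le_add le_rfl hZ
  have ic : IntegrableOn (fun _ : ℝ => (b - a) * K) (Icc a b) := integrableOn_const (by simp)
  have iq : IntegrableOn (fun t => shifted ω (slice ψ t)) (Icc a b) :=
    (integrable_shifted_slice h).integrableOn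
  refine (setIntegral_mono_on (integrable_sqNorm_slice h).integrableOn
    ((iq.add ic).const_mul _) measurableSet_Icc hpt).trans_eq ?_
  rw [integral_const_mul]
  congr 1
  simp only [Pi.add_apply]
  rw [integral_add iq ic, setIntegral_const, smul_eq_mul, Measure.real, Real.volume_Icc,
    ENNReal.toReal_ofReal (by linarith)]
  ring

end Slicing

/-- The Riccati (ground state) lower bound for a one-dimensional Dirichlet energy. -/
lemma riccati_le {w w' W W' : ℝ → ℝ} (hw : ∀ x, HasDerivAt w (w' x) x) (hc : Continuous w')
    {u v : ℝ} (huv : u ≤ v) (hW : ∀ x ∈ Icc u v, HasDerivAt W (W' x) x)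
    (hWc : ContinuousOn W' (Icc u v)) :
    W v * w v ^ 2 - W u * w u ^ 2 ≤
      ∫ x in Icc u v, (w' x ^ 2 + (W' x + W x ^ 2) * w x ^ 2) := by
  have hwc : Continuous w := continuous_iff_continuousAt.2 fun x => (hw x).continuousAt
  have hWc0 : ContinuousOn W (Icc u v) := fun x hx => (hW x hx).continuousAt.continuousWithinAt
  have hu : uIcc u v = Icc u v := uIcc_of_le huv
  have c1 : ContinuousOn (fun x => W' x * w x ^ 2 + W x * (2 * w x * w' x)) (Icc u v) := by
    fun_prop
  have e := intervalIntegral.integral_eq_sub_of_hasDerivAt (a := u) (b := v)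
    (f := fun x => W x * w x ^ 2) (f' := fun x => W' x * w x ^ 2 + W x * (2 * w x * w' x))
    (fun x hx => by
      refine ((hW x (hu ▸ hx)).mul ((hw x).fun_pow 2)).congr_deriv ?_
      simp)
    (ContinuousOn.intervalIntegrable (by rwa [hu]))
  rw [← e, intervalIntegral.integral_of_le huv, ← integral_Icc_eq_integral_Ioc]
  refine setIntegral_mono_on (c1.integrableOn_Icc) (ContinuousOn.integrableOn_Icc (by fun_prop))
    measurableSet_Icc fun x _ => ?_
  nlinarith [sq_nonneg (w' x - W x * w x)]

lemma hasDerivAt_oscillator {b κ x : ℝ} (hx : 0 < x + b) :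
    HasDerivAt (fun y => (y + b)⁻¹ - κ * (y + b) / 4) (-1 / (x + b) ^ 2 - κ * 1 / 4) x := by
  have h := (hasDerivAt_id' x).add_const b
  exact (h.fun_inv hx.ne').sub ((h.const_mul κ).div_const 4)

/-- The harmonic oscillator on a half-line with a strong repulsive layer at its end point. -/
lemma halfline_oscillator_le {w w' : ℝ → ℝ} (hw : ∀ x, HasDerivAt w (w' x) x)
    (hc : Continuous w') (hs : HasCompactSupport w) {p ε k κ : ℝ} (hp : 0 ≤ p) (hε : 0 < ε)
    (hk : 0 < k) (hκ0 : 0 < κ) (hκ1 : κ < 1) :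
    (3 * κ / 4 - κ ^ 2 * (2 * ε / k) ^ 2 / (16 * (1 - κ ^ 2))) * ∫ x in Ioi (p + ε), w x ^ 2 ≤
      (∫ x in Ioi (p + ε), w' x ^ 2) + 1 / 16 * (∫ x in Ioi (p + ε), x ^ 2 * w x ^ 2)
        + 1 / 2 * (∫ x in Icc p (p + ε), w' x ^ 2)
        + 1 / 2 * (k + k ^ 2) / ε ^ 2 * ∫ x in Icc p (p + ε), w x ^ 2 := by
  set a := p + ε with ha
  set b := 2 * ε / k with hb
  have hb0 : 0 < b := by positivity
  have ha0 : 0 < a := by positivity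
  have hwc : Continuous w := continuous_iff_continuousAt.2 fun x => (hw x).continuousAt
  have ew : w' = deriv w := funext fun x => (hw x).deriv.symm
  have hs' : HasCompactSupport w' := ew ▸ hs.deriv
  have hκ : 0 < 1 - κ ^ 2 := by nlinarith
  have inner : k / ε * w a ^ 2 ≤ (∫ x in Icc p a, w' x ^ 2)
      + (k + k ^ 2) / ε ^ 2 * ∫ x in Icc p a, w x ^ 2 := by
    have h := riccati_le hw hc (u := p) (v := a) (W := fun y => k * (y - p) / ε ^ 2)
      (W' := fun _ => k * 1 / ε ^ 2) (by linarith)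
      (fun x _ => (((hasDerivAt_id' x).sub_const p).const_mul k).div_const _)
      (by fun_prop)
    have e1 : k * (a - p) / ε ^ 2 = k / ε := by rw [ha]; field_simp; ring
    simp only [e1, sub_self, mul_zero, zero_div, zero_mul, sub_zero] at h
    refine h.trans ?_
    rw [← integral_const_mul, ← integral_add
      ((by fun_prop : Continuous fun x => w' x ^ 2).integrableOn_Icc)
      ((by fun_prop : Continuous fun x => (k + k ^ 2) / ε ^ 2 * w x ^ 2).integrableOn_Icc)]
    refine setIntegral_mono_on (ContinuousOn.integrableOn_Icc (by fun_prop))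
      (ContinuousOn.integrableOn_Icc (by fun_prop)) measurableSet_Icc fun x hx => ?_
    gcongr
    have h1 : (x - p) ^ 2 ≤ ε ^ 2 := by
      have := hx.1; have := hx.2
      gcongr
      linarith
    have h2 : (k * (x - p) / ε ^ 2) ^ 2 = k ^ 2 * (x - p) ^ 2 / ε ^ 4 := by ring
    have h3 : k ^ 2 * (x - p) ^ 2 / ε ^ 4 ≤ k ^ 2 * ε ^ 2 / ε ^ 4 := by gcongr
    have h4 : k ^ 2 * ε ^ 2 / ε ^ 4 = k ^ 2 / ε ^ 2 := by field_simp
    rw [h2, add_div, mul_one]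
    linarith
  obtain ⟨R, hRa, hR⟩ : ∃ R, a ≤ R ∧ ∀ x, R ≤ x → w x = 0 ∧ w' x = 0 := by
    obtain ⟨R, hR⟩ := (hs.isCompact.union hs'.isCompact).bddAbove
    refine ⟨max a (R + 1), le_max_left _ _, fun x hx => ?_⟩
    have hx' : R < x := by linarith [le_max_right a (R + 1)]
    constructor
    · exact image_eq_zero_of_notMem_tsupport fun hm => hx'.not_ge (hR (Or.inl hm))
    · exact image_eq_zero_of_notMem_tsupport fun hm => hx'.not_ge (hR (Or.inr hm))
  have conv : ∀ g : ℝ → ℝ, (∀ x, R ≤ x → g x = 0) →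
      ∫ x in Icc a R, g x = ∫ x in Ioi a, g x := by
    intro g hg
    rw [integral_Icc_eq_integral_Ioc]
    symm
    refine setIntegral_eq_of_subset_of_forall_sdiff_eq_zero measurableSet_Ioi
      (fun x hx => hx.1) fun x hx => hg x ?_
    by_contra hlt
    exact hx.2 ⟨hx.1, (not_le.1 hlt).le⟩
  have outer : -(k / (2 * ε)) * w a ^ 2 ≤ ∫ x in Icc a R, (w' x ^ 2 +
      (x ^ 2 / 16 + κ ^ 2 * b ^ 2 / (16 * (1 - κ ^ 2)) - 3 * κ / 4) * w x ^ 2) := by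
    have hpos : ∀ x ∈ Icc a R, 0 < x + b := fun x hx => by linarith [hx.1]
    have hne : ∀ x ∈ Icc a R, (x + b) ^ 2 ≠ 0 := fun x hx => by have := hpos x hx; positivity
    have hne' : ∀ x ∈ Icc a R, x + b ≠ 0 := fun x hx => (hpos x hx).ne'
    have h := riccati_le hw hc hRa (fun x hx => hasDerivAt_oscillator (κ := κ) (hpos x hx))
      (by fun_prop (disch := assumption))
    have hWa : (a + b)⁻¹ - κ * (a + b) / 4 ≤ k / (2 * ε) := by
      have h1 : (a + b)⁻¹ ≤ b⁻¹ := inv_anti₀ hb0 (by linarith)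
      have h2 : b⁻¹ = k / (2 * ε) := by rw [hb, inv_div]
      have : 0 ≤ κ * (a + b) / 4 := by positivity
      linarith
    have h5 := mul_le_mul_of_nonneg_right hWa (sq_nonneg (w a))
    rw [(hR R le_rfl).1] at h
    refine le_trans (by linarith) (h.trans ?_)
    refine setIntegral_mono_on (ContinuousOn.integrableOn_Icc (by fun_prop (disch := assumption)))
      (ContinuousOn.integrableOn_Icc (by fun_prop)) measurableSet_Icc fun x hx => ?_
    gcongr
    have hx0 := hpos x hx
    have e1 : -1 / (x + b) ^ 2 - κ * 1 / 4 + ((x + b)⁻¹ - κ * (x + b) / 4) ^ 2 =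
        κ ^ 2 * (x + b) ^ 2 / 16 - 3 * κ / 4 := by
      field_simp; ring
    have e2 : κ ^ 2 * (x + b) ^ 2 ≤ x ^ 2 + κ ^ 2 * b ^ 2 / (1 - κ ^ 2) := by
      rw [← sub_le_iff_le_add', le_div_iff₀ hκ]
      nlinarith [sq_nonneg ((1 - κ ^ 2) * x - κ ^ 2 * b)]
    have e3 : κ ^ 2 * b ^ 2 / (16 * (1 - κ ^ 2)) = κ ^ 2 * b ^ 2 / (1 - κ ^ 2) / 16 := by
      field_simp
    rw [e1, e3]
    linarith
  rw [conv _ fun x hx => by rw [(hR x hx).1, (hR x hx).2]; ring] at outer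
  have i1 : Integrable fun x => w' x ^ 2 := integrable_sq_of_compactSupport hc hs'
  have i0 : Integrable fun x => w x ^ 2 := integrable_sq_of_compactSupport hwc hs
  have i2 : Integrable fun x => x ^ 2 * w x ^ 2 := by
    have c : Continuous fun x => x ^ 2 * w x ^ 2 := by fun_prop
    exact c.integrable_of_hasCompactSupport ((hasCompactSupport_pow hs two_ne_zero).mul_left)
  have e : ∫ x in Ioi a, (w' x ^ 2 +
      (x ^ 2 / 16 + κ ^ 2 * b ^ 2 / (16 * (1 - κ ^ 2)) - 3 * κ / 4) * w x ^ 2) =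
      (∫ x in Ioi a, w' x ^ 2) + (1 / 16 * (∫ x in Ioi a, x ^ 2 * w x ^ 2)
        - (3 * κ / 4 - κ ^ 2 * b ^ 2 / (16 * (1 - κ ^ 2))) * ∫ x in Ioi a, w x ^ 2) := by
    rw [← integral_const_mul, ← integral_const_mul,
      ← integral_sub (i2.integrableOn.const_mul _) (i0.integrableOn.const_mul _),
      ← integral_add i1.integrableOn]
    · congr 1; ext x; ring
    · exact (i2.integrableOn.const_mul _).sub (i0.integrableOn.const_mul _)
  rw [e] at outer
  have e4 : k / (2 * ε) = 1 / 2 * (k / ε) := by field_simp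
  rw [e4] at outer
  have e5 : 1 / 2 * (k + k ^ 2) / ε ^ 2 = 1 / 2 * ((k + k ^ 2) / ε ^ 2) := by ring
  rw [e5]
  linarith

lemma halfline_oscillator_le_neg {w w' : ℝ → ℝ} (hw : ∀ x, HasDerivAt w (w' x) x)
    (hc : Continuous w') (hs : HasCompactSupport w) {p ε k κ : ℝ} (hp : 0 ≤ p) (hε : 0 < ε)
    (hk : 0 < k) (hκ0 : 0 < κ) (hκ1 : κ < 1) :
    (3 * κ / 4 - κ ^ 2 * (2 * ε / k) ^ 2 / (16 * (1 - κ ^ 2))) *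
        ∫ x in Iic (-(p + ε)), w x ^ 2 ≤
      (∫ x in Iic (-(p + ε)), w' x ^ 2) + 1 / 16 * (∫ x in Iic (-(p + ε)), x ^ 2 * w x ^ 2)
        + 1 / 2 * (∫ x in Icc (-(p + ε)) (-p), w' x ^ 2)
        + 1 / 2 * (k + k ^ 2) / ε ^ 2 * ∫ x in Icc (-(p + ε)) (-p), w x ^ 2 := by
  have hw' : ∀ x, HasDerivAt (fun x => w (-x)) (-w' (-x)) x := fun x => by
    refine ((hw (-x)).scomp x (hasDerivAt_neg x)).congr_deriv ?_
    simp
  have h := halfline_oscillator_le hw' (by fun_prop) (hs.comp_homeomorph (Homeomorph.neg ℝ))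
    hp hε hk hκ0 hκ1
  have e : ∀ g : ℝ → ℝ, ∫ x in Icc p (p + ε), g (-x) = ∫ x in Icc (-(p + ε)) (-p), g x := by
    intro g
    rw [integral_Icc_eq_integral_Ioc, integral_Icc_eq_integral_Ioc,
      ← intervalIntegral.integral_of_le (by linarith),
      ← intervalIntegral.integral_of_le (by linarith), intervalIntegral.integral_comp_neg]
  have e1 := e fun x => w x ^ 2
  have e2 := e fun x => w' x ^ 2
  have f1 := integral_comp_neg_Ioi (p + ε) fun x => w x ^ 2
  have f2 := integral_comp_neg_Ioi (p + ε) fun x => w' x ^ 2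
  have f3 := integral_comp_neg_Ioi (p + ε) fun x => x ^ 2 * w x ^ 2
  simp only [neg_sq] at h f3
  rwa [e1, e2, f1, f2, f3] at h

/-- Integration of a one-dimensional inequality over the cross-section. -/
lemma integral_slice_ineq {F₀ F₁ F₂ : ℝ × ℝ × ℝ → ℝ} (h₀ : Integrable F₀) (h₁ : Integrable F₁)
    (h₂ : Integrable F₂) (S T : Set ℝ) {l m c d : ℝ}
    (h : ∀ p : ℝ × ℝ, l * ∫ t in S, F₀ (t, p) ≤ (∫ t in S, F₁ (t, p))
      + c * (∫ t in S, F₂ (t, p)) + d * (∫ t in T, F₁ (t, p)) + m * ∫ t in T, F₀ (t, p)) :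
    l * ∫ t in S, ∫ p, F₀ (t, p) ≤ (∫ t in S, ∫ p, F₁ (t, p))
      + c * (∫ t in S, ∫ p, F₂ (t, p)) + d * (∫ t in T, ∫ p, F₁ (t, p))
      + m * ∫ t in T, ∫ p, F₀ (t, p) := by
  have i0 := integrable_setIntegral_slice h₀ S
  have i1 := integrable_setIntegral_slice h₁ S
  have i2 := (integrable_setIntegral_slice h₂ S).const_mul c
  have i3 := (integrable_setIntegral_slice h₁ T).const_mul d
  have i4 := (integrable_setIntegral_slice h₀ T).const_mul m
  have key := integral_mono (i0.const_mul l) (((i1.add i2).add i3).add i4) h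
  rw [integral_add' ((i1.add i2).add i3) i4, integral_add' (i1.add i2) i3,
    integral_add' i1 i2] at key
  simpa only [integral_const_mul, setIntegral_slice_swap h₀, setIntegral_slice_swap h₁,
    setIntegral_slice_swap h₂] using key

section TubeOscillator

variable {ω : Set (ℝ × ℝ)} {ψ : ℝ × ℝ × ℝ → ℝ}

/-- The longitudinal energy of a cross-section. -/
def sliceEnergy (ψ : ℝ × ℝ × ℝ → ℝ) (t : ℝ) : ℝ := ∫ p, pd1 ψ (t, p) ^ 2

lemma integrable_weight (h : IsTest3 (Omega0 ω) ψ) : Integrable fun x => x.1 ^ 2 * ψ x ^ 2 := by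
  have hψ := h.1.continuous
  have c : Continuous fun x : ℝ × ℝ × ℝ => x.1 ^ 2 * ψ x ^ 2 := by fun_prop
  exact c.integrable_of_hasCompactSupport ((hasCompactSupport_pow h.2.1 two_ne_zero).mul_left)

lemma tube_oscillator_le (h : IsTest3 (Omega0 ω) ψ) {p ε k κ : ℝ} (hp : 0 ≤ p) (hε : 0 < ε)
    (hk : 0 < k) (hκ0 : 0 < κ) (hκ1 : κ < 1) :
    (3 * κ / 4 - κ ^ 2 * (2 * ε / k) ^ 2 / (16 * (1 - κ ^ 2))) *
        ∫ t in Ioi (p + ε), sqNorm (slice ψ t) ≤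
      (∫ t in Ioi (p + ε), sliceEnergy ψ t)
        + 1 / 16 * (∫ t in Ioi (p + ε), t ^ 2 * sqNorm (slice ψ t))
        + 1 / 2 * (∫ t in Icc p (p + ε), sliceEnergy ψ t)
        + 1 / 2 * (k + k ^ 2) / ε ^ 2 * ∫ t in Icc p (p + ε), sqNorm (slice ψ t) ∧
    (3 * κ / 4 - κ ^ 2 * (2 * ε / k) ^ 2 / (16 * (1 - κ ^ 2))) *
        ∫ t in Iic (-(p + ε)), sqNorm (slice ψ t) ≤
      (∫ t in Iic (-(p + ε)), sliceEnergy ψ t)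
        + 1 / 16 * (∫ t in Iic (-(p + ε)), t ^ 2 * sqNorm (slice ψ t))
        + 1 / 2 * (∫ t in Icc (-(p + ε)) (-p), sliceEnergy ψ t)
        + 1 / 2 * (k + k ^ 2) / ε ^ 2 * ∫ t in Icc (-(p + ε)) (-p), sqNorm (slice ψ t) := by
  obtain ⟨i0, i1, -⟩ := integrable_pd_sq h continuous_const (σ := fun _ => 0)
  have i2 := integrable_weight h
  obtain ⟨⟨c1, -⟩, -⟩ :=
    continuous_hasCompactSupport_pd h.contDiff_one h.2.1 (σ := fun _ => 0) continuous_const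
  have hd : ∀ (q : ℝ × ℝ) (t : ℝ), HasDerivAt (fun t => ψ (t, q)) (pd1 ψ (t, q)) t :=
    fun q t => hasDerivAt_pd1 h.differentiable t q.1 q.2
  have hc : ∀ q : ℝ × ℝ, Continuous fun t => pd1 ψ (t, q) :=
    fun q => c1.comp (by fun_prop : Continuous fun t : ℝ => (t, q))
  have hs : ∀ q : ℝ × ℝ, HasCompactSupport fun t => ψ (t, q) := fun q =>
    h.2.1.comp_isClosedEmbedding (Topology.IsClosedEmbedding.of_continuous_injective_isClosedMap
      (by fun_prop) (Prod.mk_left_injective q) (isClosedMap_prodMk_right q))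
  have e : ∀ t, ∫ q : ℝ × ℝ, t ^ 2 * ψ (t, q) ^ 2 = t ^ 2 * sqNorm (slice ψ t) := fun t =>
    integral_const_mul _ _
  constructor
  · have := integral_slice_ineq i0 i1 i2 (Ioi (p + ε)) (Icc p (p + ε)) fun q =>
      halfline_oscillator_le (hd q) (hc q) (hs q) hp hε hk hκ0 hκ1
    simp only [e] at this
    exact this
  · have := integral_slice_ineq i0 i1 i2 (Iic (-(p + ε))) (Icc (-(p + ε)) (-p)) fun q =>
      halfline_oscillator_le_neg (hd q) (hc q) (hs q) hp hε hk hκ0 hκ1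
    simp only [e] at this
    exact this

end TubeOscillator

lemma integral_eq_tails_add_Icc {f : ℝ → ℝ} (hf : Integrable f) {a : ℝ} (ha : 0 ≤ a) :
    ∫ t, f t = (∫ t in Iic (-a), f t) + (∫ t in Icc (-a) a, f t) + ∫ t in Ioi a, f t := by
  have h1 : Iic a = Iic (-a) ∪ Ioc (-a) a := (Iic_union_Ioc_eq_Iic (by linarith)).symm
  rw [integral_Icc_eq_integral_Ioc, ← setIntegral_union _ measurableSet_Ioc hf.integrableOn
    hf.integrableOn, ← h1, intervalIntegral.integral_Iic_add_Ioi hf.integrableOn hf.integrableOn]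
  exact Set.disjoint_left.2 fun x h1 h2 => absurd h2.1 (not_lt.2 h1)

lemma shells_le_Icc {f : ℝ → ℝ} (hf : Integrable f) (h0 : ∀ t, 0 ≤ f t) {p a : ℝ} (hp : 0 < p)
    (hpa : p ≤ a) :
    (∫ t in Icc (-a) (-p), f t) + (∫ t in Icc p a, f t) ≤ ∫ t in Icc (-a) a, f t := by
  rw [← setIntegral_union _ measurableSet_Icc hf.integrableOn hf.integrableOn]
  · refine setIntegral_mono_set hf.integrableOn (ae_of_all _ h0) (LE.le.eventuallyLE ?_)
    refine union_subset ?_ ?_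
    · exact Icc_subset_Icc le_rfl (by linarith)
    · exact Icc_subset_Icc (by linarith) le_rfl
  · exact Set.disjoint_left.2 fun x h1 h2 => by linarith [h1.2, h2.1]

section SliceForm

variable {ω : Set (ℝ × ℝ)} {ψ : ℝ × ℝ × ℝ → ℝ}

/-- The lower bound for the form of the self-similar evolution, given the local Hardy inequality
in the twisted part of the tube. -/
lemma slice_form_lower_bound (h : IsTest3 (Omega0 ω) ψ) {σ : ℝ → ℝ} (hσ : Continuous σ)
    {p ε k κ c C : ℝ} (hp : 0 < p) (hε : 0 < ε) (hσ0 : ∀ t, p ≤ |t| → σ t = 0)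
    (hk : 0 < k) (hκ0 : 0 < κ) (hκ1 : κ < 1) (hc : 0 < c) (hc1 : c * C ≤ 1)
    (hc2 : c * C * (2 * (p + ε)) ^ 2 ≤ ε ^ 2 / 2) (hkc : k + k ^ 2 ≤ c)
    (hl : 3 * κ / 4 - κ ^ 2 * (2 * ε / k) ^ 2 / (16 * (1 - κ ^ 2)) ≤ c / (2 * ε ^ 2))
    (hardy : ∫ t in Icc (-(p + ε)) (p + ε), sqNorm (slice ψ t) ≤
      C * ((∫ t in Icc (-(p + ε)) (p + ε), shifted ω (slice ψ t)) +
        (2 * (p + ε)) ^ 2 * ∫ t in Icc (-(p + ε)) (p + ε), ∫ q, twd σ ψ (t, q) ^ 2)) :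
    (3 * κ / 4 - κ ^ 2 * (2 * ε / k) ^ 2 / (16 * (1 - κ ^ 2))) * ∫ t, sqNorm (slice ψ t) ≤
      (∫ t, ∫ q, twd σ ψ (t, q) ^ 2) + 1 / 16 * (∫ t, t ^ 2 * sqNorm (slice ψ t))
        + 1 / ε ^ 2 * ∫ t, shifted ω (slice ψ t) := by
  obtain ⟨h1, h2⟩ := tube_oscillator_le h hp.le hε hk hκ0 hκ1
  set l := 3 * κ / 4 - κ ^ 2 * (2 * ε / k) ^ 2 / (16 * (1 - κ ^ 2)) with hl_def
  set a := p + ε with ha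
  have ha0 : 0 ≤ a := by positivity
  have hpa : p ≤ a := by linarith
  obtain ⟨-, -, -, -, it⟩ := integrable_pd_sq h hσ
  have iG := integrable_integral_slice it
  have iA := integrable_sqNorm_slice h
  have iq := integrable_shifted_slice h
  have iw : Integrable fun t => t ^ 2 * sqNorm (slice ψ t) := by
    have := integrable_integral_slice (integrable_weight h)
    simp only [integral_const_mul] at this
    exact this
  set G : ℝ → ℝ := fun t => ∫ q, twd σ ψ (t, q) ^ 2 with hG
  have hG0 : ∀ t, 0 ≤ G t := fun t => integral_nonneg fun _ => sq_nonneg _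
  have hA0 : ∀ t, 0 ≤ sqNorm (slice ψ t) := fun t => sqNorm_nonneg _
  have hq0 : ∀ t, 0 ≤ shifted ω (slice ψ t) := fun t => shifted_nonneg (h.slice t)
  have hw0 : ∀ t, 0 ≤ t ^ 2 * sqNorm (slice ψ t) := fun t => mul_nonneg (sq_nonneg _) (hA0 t)
  have hGD : ∀ S : Set ℝ, MeasurableSet S → (∀ t ∈ S, p ≤ |t|) →
      ∫ t in S, sliceEnergy ψ t = ∫ t in S, G t := by
    intro S hS hSp
    refine setIntegral_congr_fun hS fun t ht => ?_
    simp [sliceEnergy, hG, twd, hσ0 t (hSp t ht)]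
  have tail1 : ∀ t ∈ Ioi a, p ≤ |t| := fun t ht => by
    have : a < t := ht
    exact le_abs.2 (Or.inl (by linarith))
  have tail2 : ∀ t ∈ Iic (-a), p ≤ |t| := fun t ht => by
    have : t ≤ -a := ht
    exact le_abs.2 (Or.inr (by linarith))
  rw [hGD _ measurableSet_Ioi tail1, hGD _ measurableSet_Icc fun t ht => le_abs.2 (Or.inl ht.1)]
    at h1
  rw [hGD _ measurableSet_Iic tail2,
    hGD _ measurableSet_Icc fun t ht => le_abs.2 (Or.inr (by linarith [ht.2]))] at h2
  have sA := shells_le_Icc iA hA0 hp hpa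
  have sG := shells_le_Icc iG hG0 hp hpa
  have eA := integral_eq_tails_add_Icc iA ha0
  have eG := integral_eq_tails_add_Icc iG ha0
  have ew := integral_eq_tails_add_Icc iw ha0
  have eq := integral_eq_tails_add_Icc iq ha0
  have nw : 0 ≤ ∫ t in Icc (-a) a, t ^ 2 * sqNorm (slice ψ t) := integral_nonneg hw0
  have nq1 : 0 ≤ ∫ t in Iic (-a), shifted ω (slice ψ t) := integral_nonneg hq0
  have nq2 : 0 ≤ ∫ t in Ioi a, shifted ω (slice ψ t) := integral_nonneg hq0
  have nq : 0 ≤ ∫ t in Icc (-a) a, shifted ω (slice ψ t) := integral_nonneg hq0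
  have nG : 0 ≤ ∫ t in Icc (-a) a, G t := integral_nonneg hG0
  have nA : 0 ≤ ∫ t in Icc (-a) a, sqNorm (slice ψ t) := integral_nonneg hA0
  rw [eA, eG, ew, eq]
  generalize (∫ t in Icc (-a) a, sqNorm (slice ψ t)) = A at *
  generalize (∫ t in Icc (-a) a, shifted ω (slice ψ t)) = q at *
  generalize (∫ t in Icc (-a) a, G t) = g at *
  generalize (∫ t in Icc (-a) (-p), sqNorm (slice ψ t)) = A₁ at *
  generalize (∫ t in Icc p a, sqNorm (slice ψ t)) = A₂ at *
  have hε2 : 0 < 1 / ε ^ 2 := by positivity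
  have core : c * A ≤ q + ε ^ 2 / 2 * g := by
    have m1 := mul_le_mul_of_nonneg_left hardy hc.le
    have m2 := mul_le_mul_of_nonneg_right hc1 nq
    have m3 := mul_le_mul_of_nonneg_right hc2 nG
    linarith
  have core2 : c / ε ^ 2 * A ≤ 1 / ε ^ 2 * q + 1 / 2 * g := by
    have := mul_le_mul_of_nonneg_left core hε2.le
    have e1 : 1 / ε ^ 2 * (ε ^ 2 / 2 * g) = 1 / 2 * g := by field_simp
    have e2 : 1 / ε ^ 2 * (c * A) = c / ε ^ 2 * A := by ring
    linarith
  have r1 : 1 / 2 * (k + k ^ 2) / ε ^ 2 * (A₁ + A₂) ≤ c / (2 * ε ^ 2) * A := by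
    have e1 : 1 / 2 * (k + k ^ 2) / ε ^ 2 ≤ c / (2 * ε ^ 2) := by
      have : c / (2 * ε ^ 2) = 1 / 2 * c / ε ^ 2 := by field_simp
      rw [this]; gcongr
    refine (mul_le_mul_of_nonneg_left sA (by positivity)).trans ?_
    gcongr
  have r2 : l * A ≤ c / (2 * ε ^ 2) * A := mul_le_mul_of_nonneg_right hl nA
  have r3 : c / (2 * ε ^ 2) * A + c / (2 * ε ^ 2) * A = c / ε ^ 2 * A := by field_simp; ring
  have r4 := mul_nonneg hε2.le nq1
  have r5 := mul_nonneg hε2.le nq2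
  linarith

end SliceForm

lemma exists_angle_step {θ : ℝ → ℝ} (hθ : Continuous θ) {s t α : ℝ} (hα0 : 0 < α)
    (hα : α ≤ |θ s - θ t| / 2) {m : ℝ} (hs : s ∈ Icc (-m) m) (ht : t ∈ Icc (-m) m) {τ : ℝ}
    (hτ : τ ∈ Icc (-m) m) : ∃ τ₁ ∈ Icc (-m) m, θ τ - θ τ₁ = α ∨ θ τ - θ τ₁ = -α := by
  obtain ⟨r, hr, hrα⟩ : ∃ r ∈ Icc (-m) m, α ≤ |θ τ - θ r| := by
    by_contra! hcon
    have h1 := hcon s hs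
    have h2 := hcon t ht
    have h3 : |θ s - θ t| ≤ |θ τ - θ s| + |θ τ - θ t| := by
      have := abs_sub_le (θ s) (θ τ) (θ t)
      rwa [abs_sub_comm (θ s) (θ τ)] at this
    linarith
  have hsub : uIcc τ r ⊆ Icc (-m) m := by
    rw [← uIcc_of_le (hs.1.trans hs.2)] at hτ hr ⊢
    exact uIcc_subset_uIcc hτ hr
  have ivt := intermediate_value_uIcc (a := τ) (b := r) hθ.continuousOn
  rcases le_abs.1 hrα with h | h
  · obtain ⟨x, hx, e⟩ := ivt (mem_uIcc.2 (Or.inr ⟨by linarith, by linarith⟩) :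
      θ τ - α ∈ uIcc (θ τ) (θ r))
    exact ⟨x, hsub hx, Or.inl (by linarith)⟩
  · obtain ⟨x, hx, e⟩ := ivt (mem_uIcc.2 (Or.inl ⟨by linarith, by linarith⟩) :
      θ τ + α ∈ uIcc (θ τ) (θ r))
    exact ⟨x, hsub hx, Or.inr (by linarith)⟩

lemma hasDerivAt_rescaled_angle {θ : ℝ → ℝ} (hθ : ContDiff ℝ 1 θ) (s t : ℝ) :
    HasDerivAt (fun t => θ (Real.exp (s / 2) * t)) (sigmafun θ s t) t := by
  have h := ((hθ.differentiable one_ne_zero (Real.exp (s / 2) * t)).hasDerivAt).scomp t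
    ((hasDerivAt_id' t).const_mul (Real.exp (s / 2)))
  refine h.congr_deriv ?_
  simp [sigmafun]

lemma continuous_sigmafun {θ : ℝ → ℝ} (hθ : ContDiff ℝ 1 θ) (s : ℝ) :
    Continuous (sigmafun θ s) := by
  have := hθ.continuous_deriv_one
  unfold sigmafun
  fun_prop

lemma exists_deriv_eq_zero_outside {θ : ℝ → ℝ} (hsupp : HasCompactSupport (deriv θ)) :
    ∃ L, 0 < L ∧ ∀ t, L ≤ |t| → deriv θ t = 0 := by
  obtain ⟨R, hR⟩ := hsupp.isCompact.isBounded.subset_closedBall 0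
  refine ⟨|R| + 1, by positivity, fun t ht => image_eq_zero_of_notMem_tsupport fun hm => ?_⟩
  have := hR hm
  rw [Metric.mem_closedBall, dist_zero_right, Real.norm_eq_abs] at this
  linarith [le_abs_self R]

lemma tendsto_exp_neg_half : Tendsto (fun s : ℝ => Real.exp (-(s / 2))) atTop (nhds 0) :=
  Real.tendsto_exp_neg_atTop_nhds_zero.comp (tendsto_id.atTop_div_const two_pos)

lemma sigmafun_eq_zero {θ : ℝ → ℝ} {L : ℝ} (hL : ∀ t, L ≤ |t| → deriv θ t = 0) {s t : ℝ}
    (ht : L * Real.exp (-(s / 2)) ≤ |t|) : sigmafun θ s t = 0 := by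
  rw [sigmafun, hL, mul_zero]
  rw [abs_mul, abs_of_pos (Real.exp_pos _), mul_comm]
  have := mul_le_mul_of_nonneg_right ht (Real.exp_pos (s / 2)).le
  rwa [mul_assoc, ← Real.exp_add, neg_add_cancel, Real.exp_zero, mul_one] at this

lemma eventually_slice_form_lower_bound {ω : Set (ℝ × ℝ)} (ho : IsOpen ω)
    (hb : Bornology.IsBounded ω) (hcon : IsConnected ω) {θ : ℝ → ℝ} (hθ : ContDiff ℝ 1 θ)
    (hsupp : HasCompactSupport (deriv θ)) (htw : Twisted θ ω) {δ : ℝ} (hδ : 0 < δ) :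
    ∀ᶠ s in atTop, ∀ ψ : ℝ × ℝ × ℝ → ℝ, IsTest3 (Omega0 ω) ψ →
      (3 / 4 - δ) * ∫ t, sqNorm (slice ψ t) ≤
        (∫ t, ∫ q, twd (sigmafun θ s) ψ (t, q) ^ 2) + 1 / 16 * (∫ t, t ^ 2 * sqNorm (slice ψ t))
          + Real.exp s * ∫ t, shifted ω (slice ψ t) := by
  obtain ⟨⟨s₀, t₀, hne⟩, hrot⟩ := htw
  obtain ⟨α, hα0, hα, hZ1, hZ2⟩ := exists_small_rot ho hb hrot
    (half_pos (abs_pos.2 (sub_ne_zero.2 hne)))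
  obtain ⟨C, hC, H⟩ := exists_local_hardy ho hb hcon hZ1 hZ2
  obtain ⟨L₀, hL₀, hθ0⟩ := exists_deriv_eq_zero_outside hsupp
  set L := max L₀ (max |s₀| |t₀|) with hL_def
  have hL : 0 < L := lt_max_of_lt_left hL₀
  have hθL : ∀ t, L ≤ |t| → deriv θ t = 0 := fun t ht => hθ0 t ((le_max_left _ _).trans ht)
  have hs₀ : s₀ ∈ Icc (-(L + 1)) (L + 1) := by
    have : |s₀| ≤ L := (le_max_left _ _).trans (le_max_right _ _)
    exact abs_le.1 (by linarith)
  have ht₀ : t₀ ∈ Icc (-(L + 1)) (L + 1) := by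
    have : |t₀| ≤ L := (le_max_right _ _).trans (le_max_right _ _)
    exact abs_le.1 (by linarith)
  set c := 1 / (C * (1 + 8 * (L + 1) ^ 2)) with hc_def
  have hc : 0 < c := by positivity
  have hcC : c * C = 1 / (1 + 8 * (L + 1) ^ 2) := by rw [hc_def]; field_simp
  set k := min 1 (c / 2) with hk_def
  have hk : 0 < k := by positivity
  have hkc : k + k ^ 2 ≤ c := by
    have h1 : k ≤ 1 := min_le_left _ _
    have h2 : k ≤ c / 2 := min_le_right _ _
    nlinarith
  set κ := max (1 / 2) (1 - δ / 2) with hκ_def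
  have hκ0 : 0 < κ := lt_max_of_lt_left (by norm_num)
  have hκ1 : κ < 1 := max_lt (by norm_num) (by linarith)
  have hκδ : 3 / 4 - δ < 3 * κ / 4 := by
    have : 1 - δ / 2 ≤ κ := le_max_right _ _
    linarith
  have lim : Tendsto (fun s : ℝ => 3 * κ / 4 - κ ^ 2 * (2 * Real.exp (-(s / 2)) / k) ^ 2 /
      (16 * (1 - κ ^ 2))) atTop (nhds (3 * κ / 4)) := by
    have h := tendsto_const_nhds (x := 3 * κ / 4) (f := atTop (α := ℝ)) |>.sub
      ((((tendsto_exp_neg_half.const_mul 2).div_const k).pow 2 |>.const_mul (κ ^ 2)).div_const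
        (16 * (1 - κ ^ 2)))
    simpa using h
  filter_upwards [lim.eventually_const_lt hκδ,
    Real.tendsto_exp_atTop.eventually_ge_atTop (3 / (2 * c))] with s h1 h2 ψ hψ
  set ε := Real.exp (-(s / 2)) with hε_def
  have hε : 0 < ε := Real.exp_pos _
  have hinv : Real.exp (s / 2) * ε = 1 := by
    rw [hε_def, ← Real.exp_add, add_neg_cancel, Real.exp_zero]
  have hE : Real.exp s = 1 / ε ^ 2 := by
    rw [hε_def, ← Real.exp_nat_mul, one_div, ← Real.exp_neg]
    congr 1; push_cast; ring
  have hκ2 : 0 < 1 - κ ^ 2 := by nlinarith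
  have hl : 3 * κ / 4 - κ ^ 2 * (2 * ε / k) ^ 2 / (16 * (1 - κ ^ 2)) ≤ c / (2 * ε ^ 2) := by
    have e1 : c / (2 * ε ^ 2) = c / 2 * Real.exp s := by rw [hE]; field_simp
    have e2 : c / 2 * (3 / (2 * c)) = 3 / 4 := by field_simp; norm_num
    have e3 := mul_le_mul_of_nonneg_left h2 (half_pos hc).le
    have e4 : 0 ≤ κ ^ 2 * (2 * ε / k) ^ 2 / (16 * (1 - κ ^ 2)) := by positivity
    rw [e1]; linarith
  have hardy := H _ _ (hasDerivAt_rescaled_angle hθ s) (continuous_sigmafun hθ s)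
    (-(L * ε + ε)) (L * ε + ε) (by nlinarith [mul_pos hL hε]) (by
      intro t ht
      have hm : ∀ u, u ∈ Icc (-(L * ε + ε)) (L * ε + ε) →
          Real.exp (s / 2) * u ∈ Icc (-(L + 1)) (L + 1) := by
        intro u hu
        have e := Real.exp_pos (s / 2)
        have a1 := mul_le_mul_of_nonneg_left hu.1 e.le
        have a2 := mul_le_mul_of_nonneg_left hu.2 e.le
        have a3 : Real.exp (s / 2) * (L * ε + ε) = L + 1 := by linear_combination (L + 1) * hinv
        exact ⟨by linarith, by linarith⟩
      obtain ⟨τ, hτ, hτα⟩ := exists_angle_step hθ.continuous hα0 hα hs₀ ht₀ (hm t ht)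
      refine ⟨ε * τ, ⟨?_, ?_⟩, ?_⟩
      · nlinarith [mul_le_mul_of_nonneg_left hτ.1 hε.le]
      · nlinarith [mul_le_mul_of_nonneg_left hτ.2 hε.le]
      · rwa [← mul_assoc, hinv, one_mul]) ψ hψ
  have hsum : L * ε + ε - -(L * ε + ε) = 2 * (L * ε + ε) := by ring
  rw [hsum] at hardy
  have hD : 0 < 1 + 8 * (L + 1) ^ 2 := by positivity
  have main := slice_form_lower_bound hψ (continuous_sigmafun hθ s) (mul_pos hL hε) hε
    (fun t ht => sigmafun_eq_zero hθL ht) hk hκ0 hκ1 hc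
    (by rw [hcC, div_le_one hD]; nlinarith [sq_nonneg (L + 1)])
    (by
      have e : (2 * (L * ε + ε)) ^ 2 = 4 * (L + 1) ^ 2 * ε ^ 2 := by ring
      rw [hcC, e, div_mul_eq_mul_div, div_le_iff₀ hD]
      nlinarith [sq_nonneg ε])
    hkc hl hardy
  rw [hE]
  refine le_trans ?_ main
  exact mul_le_mul_of_nonneg_right h1.le (integral_nonneg fun _ => sqNorm_nonneg _)

section Components

variable {E F : Type*} [NormedAddCommGroup E] [NormedSpace ℝ E] [NormedAddCommGroup F]
  [NormedSpace ℝ F] {ψ : ℝ × ℝ × ℝ → E}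

lemma IsTest3.clm_comp {Ω : Set (ℝ × ℝ × ℝ)} (h : IsTest3 Ω ψ) (T : E →L[ℝ] F) :
    IsTest3 Ω (fun x => T (ψ x)) :=
  ⟨T.contDiff.comp h.1, h.2.1.comp_left (map_zero T),
    (closure_mono (Function.support_comp_subset (map_zero T) ψ)).trans h.2.2⟩

lemma fderiv_clm_comp_apply (hd : Differentiable ℝ ψ) (T : E →L[ℝ] F) (x w : ℝ × ℝ × ℝ) :
    fderiv ℝ (fun x => T (ψ x)) x w = T (fderiv ℝ ψ x w) := by
  have h : HasFDerivAt (fun x => T (ψ x)) (T.comp (fderiv ℝ ψ x)) x :=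
    T.hasFDerivAt.comp x (hd x).hasFDerivAt
  rw [h.fderiv]; rfl

lemma pd_clm_comp (hd : Differentiable ℝ ψ) (T : E →L[ℝ] F) (σ : ℝ → ℝ) (x : ℝ × ℝ × ℝ) :
    pd2 (fun x => T (ψ x)) x = T (pd2 ψ x) ∧ pd3 (fun x => T (ψ x)) x = T (pd3 ψ x) ∧
      twd σ (fun x => T (ψ x)) x = T (twd σ ψ x) := by
  have hT : Differentiable ℝ fun x => T (ψ x) := T.differentiable.comp hd
  rw [pd2_eq_fderiv hT, pd3_eq_fderiv hT, twd_eq_fderiv hT, pd2_eq_fderiv hd, pd3_eq_fderiv hd,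
    twd_eq_fderiv hd]
  exact ⟨fderiv_clm_comp_apply hd T _ _, fderiv_clm_comp_apply hd T _ _,
    fderiv_clm_comp_apply hd T _ _⟩

end Components

section LowerBound

variable {ω : Set (ℝ × ℝ)}

lemma norm_sq_eq_re_im (z : ℂ) : ‖z‖ ^ 2 = Complex.reCLM z ^ 2 + Complex.imCLM z ^ 2 := by
  rw [Complex.sq_norm, Complex.normSq_apply]
  simp only [Complex.reCLM_apply, Complex.imCLM_apply]; ring

/-- The form `J_s` of a complex function is the sum of those of its real and imaginary parts. -/
lemma Jform_eq_slices {v : ℝ × ℝ × ℝ → ℂ} (hv : IsTest3 (Omega0 ω) v) {θ : ℝ → ℝ}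
    (hθ : ContDiff ℝ 1 θ) (s : ℝ) :
    ∃ a b : ℝ × ℝ × ℝ → ℝ, IsTest3 (Omega0 ω) a ∧ IsTest3 (Omega0 ω) b ∧
      ∫ y in Omega0 ω, ‖v y‖ ^ 2 = (∫ t, sqNorm (slice a t)) + ∫ t, sqNorm (slice b t) ∧
      Jform θ ω s v =
        ((∫ t, ∫ q, twd (sigmafun θ s) a (t, q) ^ 2) + 1 / 16 * (∫ t, t ^ 2 * sqNorm (slice a t))
          + Real.exp s * ∫ t, shifted ω (slice a t)) +
        ((∫ t, ∫ q, twd (sigmafun θ s) b (t, q) ^ 2) + 1 / 16 * (∫ t, t ^ 2 * sqNorm (slice b t))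
          + Real.exp s * ∫ t, shifted ω (slice b t)) := by
  set σ := sigmafun θ s
  have hσ : Continuous σ := continuous_sigmafun hθ s
  have hd := hv.differentiable
  have ha := hv.clm_comp Complex.reCLM
  have hb := hv.clm_comp Complex.imCLM
  set a : ℝ × ℝ × ℝ → ℝ := fun x => Complex.reCLM (v x)
  set b : ℝ × ℝ × ℝ → ℝ := fun x => Complex.imCLM (v x)
  obtain ⟨ia, -, ia2, ia3, iat⟩ := integrable_pd_sq ha hσ
  obtain ⟨ib, -, ib2, ib3, ibt⟩ := integrable_pd_sq hb hσ
  have iaw := integrable_weight ha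
  have ibw := integrable_weight hb
  have pt : ∀ x, ‖pd2 v x‖ ^ 2 = pd2 a x ^ 2 + pd2 b x ^ 2 ∧
      ‖pd3 v x‖ ^ 2 = pd3 a x ^ 2 + pd3 b x ^ 2 ∧
      ‖twd σ v x‖ ^ 2 = twd σ a x ^ 2 + twd σ b x ^ 2 := fun x => by
    obtain ⟨a1, a2, a3⟩ := pd_clm_comp hd Complex.reCLM σ x
    obtain ⟨b1, b2, b3⟩ := pd_clm_comp hd Complex.imCLM σ x
    rw [norm_sq_eq_re_im, norm_sq_eq_re_im, norm_sq_eq_re_im, a1, a2, a3, b1, b2, b3]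
    exact ⟨rfl, rfl, rfl⟩
  have z : ∀ x, x ∉ tsupport v → v x = 0 ∧ pd2 v x = 0 ∧ pd3 v x = 0 ∧ twd σ v x = 0 := by
    intro x hx
    rw [pd2_eq_fderiv hd, pd3_eq_fderiv hd, twd_eq_fderiv hd]
    exact ⟨image_eq_zero_of_notMem_tsupport hx, fderiv_apply_eq_zero hx, fderiv_apply_eq_zero hx,
      fderiv_apply_eq_zero hx⟩
  have e0 : ∫ y in Omega0 ω, ‖v y‖ ^ 2 =
      (∫ t, sqNorm (slice a t)) + ∫ t, sqNorm (slice b t) := by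
    rw [setIntegral_eq_integral_of_tsupport hv.2.2 fun x hx => by simp [(z x hx).1]]
    simp only [norm_sq_eq_re_im]
    rw [integral_add ia ib, integral_slice ia, integral_slice ib]
    rfl
  have e1 : ∫ y in Omega0 ω, ‖pd1 v y - sigmafun θ s y.1 • pdtau v y‖ ^ 2 =
      (∫ t, ∫ q, twd σ a (t, q) ^ 2) + ∫ t, ∫ q, twd σ b (t, q) ^ 2 := by
    change ∫ y in Omega0 ω, ‖twd σ v y‖ ^ 2 = _
    rw [setIntegral_eq_integral_of_tsupport hv.2.2 fun x hx => by simp [(z x hx).2.2.2]]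
    simp only [fun x => (pt x).2.2]
    rw [integral_add iat ibt, integral_slice iat, integral_slice ibt]
  have e2 : ∫ y in Omega0 ω, y.1 ^ 2 * ‖v y‖ ^ 2 =
      (∫ t, t ^ 2 * sqNorm (slice a t)) + ∫ t, t ^ 2 * sqNorm (slice b t) := by
    rw [setIntegral_eq_integral_of_tsupport hv.2.2 fun x hx => by simp [(z x hx).1]]
    simp only [norm_sq_eq_re_im, mul_add]
    rw [integral_add iaw ibw, integral_slice iaw, integral_slice ibw]
    simp only [integral_const_mul]
    rfl
  have e3 : (∫ y in Omega0 ω, (‖pd2 v y‖ ^ 2 + ‖pd3 v y‖ ^ 2)) - E1 ω * ∫ y in Omega0 ω, ‖v y‖ ^ 2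
      = (∫ t, shifted ω (slice a t)) + ∫ t, shifted ω (slice b t) := by
    rw [setIntegral_eq_integral_of_tsupport hv.2.2 fun x hx => by
        simp [(z x hx).2.1, (z x hx).2.2.1],
      setIntegral_eq_integral_of_tsupport hv.2.2 fun x hx => by simp [(z x hx).1]]
    simp only [shifted_slice_eq ha, shifted_slice_eq hb]
    have ja : Integrable fun x => pd2 a x ^ 2 + pd3 a x ^ 2 := ia2.add ia3
    have jb : Integrable fun x => pd2 b x ^ 2 + pd3 b x ^ 2 := ib2.add ib3
    have k2 : Integrable fun x => pd2 a x ^ 2 + pd2 b x ^ 2 := ia2.add ib2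
    have k3 : Integrable fun x => pd3 a x ^ 2 + pd3 b x ^ 2 := ia3.add ib3
    rw [← integral_slice (integrable_shifted_density ha),
      ← integral_slice (integrable_shifted_density hb), integral_sub ja (ia.const_mul _),
      integral_sub jb (ib.const_mul _), integral_add ia2 ia3, integral_add ib2 ib3,
      integral_const_mul, integral_const_mul]
    simp only [norm_sq_eq_re_im (v _), fun x => (pt x).1, fun x => (pt x).2.1]
    rw [integral_add k2 k3, integral_add ia2 ib2, integral_add ia3 ib3,
      integral_add ia ib]
    ring
  refine ⟨a, b, ha, hb, e0, ?_⟩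
  rw [Jform, e1, e2, e3]
  ring

lemma eventually_Jform_lower_bound (ho : IsOpen ω) (hb : Bornology.IsBounded ω)
    (hcon : IsConnected ω) {θ : ℝ → ℝ} (hθ : ContDiff ℝ 1 θ)
    (hsupp : HasCompactSupport (deriv θ)) (htw : Twisted θ ω) {δ : ℝ} (hδ : 0 < δ) :
    ∀ᶠ s in atTop, ∀ v : ℝ × ℝ × ℝ → ℂ, IsTest3 (Omega0 ω) v →
      (3 / 4 - δ) * ∫ y in Omega0 ω, ‖v y‖ ^ 2 ≤ Jform θ ω s v := by
  filter_upwards [eventually_slice_form_lower_bound ho hb hcon hθ hsupp htw hδ] with s hs v hv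
  obtain ⟨a, b, ha, hb, e, eJ⟩ := Jform_eq_slices hv hθ s
  rw [e, eJ, mul_add]
  exact add_le_add (hs a ha) (hs b hb)

lemma setIntegral_norm_sq_pos {v : ℝ × ℝ × ℝ → ℂ} (hv : IsTest3 (Omega0 ω) v) (h0 : v ≠ 0) :
    0 < ∫ y in Omega0 ω, ‖v y‖ ^ 2 := by
  rw [setIntegral_eq_integral_of_tsupport hv.2.2 fun x hx => by
    simp [image_eq_zero_of_notMem_tsupport hx]]
  obtain ⟨x, hx⟩ := Function.ne_iff.1 h0
  have hc := hv.1.continuous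
  have h : Continuous (fun p => ‖v p‖ ^ 2) := by fun_prop
  refine h.integral_pos_of_hasCompactSupport_nonneg_nonzero
    (hasCompactSupport_pow hv.2.1.norm two_ne_zero) (fun _ => by positivity) (x := x) ?_
  exact pow_ne_zero 2 (norm_ne_zero_iff.2 hx)

end LowerBound

lemma exists_smoothTransition_deriv_bound :
    ∃ C : ℝ, 0 ≤ C ∧ ∀ x, |deriv Real.smoothTransition x| ≤ C ∧
      (x ∉ Icc (0 : ℝ) 1 → deriv Real.smoothTransition x = 0) := by
  have h : ContDiff ℝ 1 Real.smoothTransition := Real.smoothTransition.contDiff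
  obtain ⟨C, hC⟩ := isCompact_Icc (a := (0 : ℝ)) (b := 1) |>.exists_bound_of_continuousOn
    (h.continuous_deriv le_rfl).continuousOn
  have h0 : ∀ x, x ∉ Icc (0 : ℝ) 1 → deriv Real.smoothTransition x = 0 := by
    intro x hx
    rcases lt_or_ge x 0 with h | h
    · have : Real.smoothTransition =ᶠ[nhds x] fun _ => (0 : ℝ) := by
        filter_upwards [Iio_mem_nhds h] with y hy
        exact Real.smoothTransition.zero_of_nonpos (le_of_lt hy)
      rw [this.deriv_eq, deriv_const]
    · have hx1 : 1 < x := by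
        by_contra h'
        exact hx ⟨h, not_lt.1 h'⟩
      have : Real.smoothTransition =ᶠ[nhds x] fun _ => (1 : ℝ) := by
        filter_upwards [Ioi_mem_nhds hx1] with y hy
        exact Real.smoothTransition.one_of_one_le (le_of_lt hy)
      rw [this.deriv_eq, deriv_const]
  have hC0 : 0 ≤ C := (norm_nonneg _).trans (hC 0 ⟨le_rfl, zero_le_one⟩)
  refine ⟨C, hC0, fun x => ⟨?_, h0 x⟩⟩
  by_cases hx : x ∈ Icc (0 : ℝ) 1
  · exact hC x hx
  · rw [h0 x hx, abs_zero]; exact hC0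

/-- The first odd eigenfunction of `-d²/dt² + t²/16`. -/
def oddState (t : ℝ) : ℝ := t * Real.exp (-(t ^ 2 / 8))

lemma contDiff_oddState : ContDiff ℝ (⊤ : ℕ∞) oddState := by
  unfold oddState; fun_prop

lemma hasDerivAt_oddState (t : ℝ) :
    HasDerivAt oddState ((1 - t ^ 2 / 4) * Real.exp (-(t ^ 2 / 8))) t := by
  have h := (hasDerivAt_id t).mul ((((hasDerivAt_id t).pow 2).div_const 8).neg.exp)
  refine h.congr_deriv ?_
  simp
  ring

lemma hasDerivAt_deriv_oddState (t : ℝ) :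
    HasDerivAt (fun t => (1 - t ^ 2 / 4) * Real.exp (-(t ^ 2 / 8)))
      ((t ^ 2 / 16 - 3 / 4) * oddState t) t := by
  have h := ((((hasDerivAt_id t).pow 2).div_const 4).const_sub 1).mul
    ((((hasDerivAt_id t).pow 2).div_const 8).neg.exp)
  refine h.congr_deriv ?_
  simp [oddState]
  ring

lemma oddState_sq_le (t : ℝ) : oddState t ^ 2 ≤ t ^ 2 ∧ oddState t ^ 2 ≤ 4 := by
  have h1 : Real.exp (-(t ^ 2 / 8)) ≤ 1 := Real.exp_le_one_iff.2 (by nlinarith [sq_nonneg t])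
  have h2 := Real.exp_pos (-(t ^ 2 / 8))
  have h3 : Real.exp (-(t ^ 2 / 8)) ^ 2 * Real.exp (t ^ 2 / 4) = 1 := by
    rw [← Real.exp_nat_mul, ← Real.exp_add]; norm_num; ring
  have h4 := Real.add_one_le_exp (t ^ 2 / 4)
  have h5 : Real.exp (-(t ^ 2 / 8)) ^ 2 ≤ 1 := pow_le_one₀ h2.le h1
  have h6 : 0 < Real.exp (-(t ^ 2 / 8)) ^ 2 := by positivity
  simp only [oddState, mul_pow]
  constructor
  · nlinarith [sq_nonneg t]
  · nlinarith

/-- Integration by parts against the eigenfunction. -/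
lemma integral_oscillator_cutoff {χ : ℝ → ℝ} (hχ : ContDiff ℝ 1 χ) (hc : HasCompactSupport χ) :
    (∫ t, deriv (fun t => χ t * oddState t) t ^ 2) +
        1 / 16 * ∫ t, t ^ 2 * (χ t * oddState t) ^ 2 =
      3 / 4 * (∫ t, (χ t * oddState t) ^ 2) + ∫ t, deriv χ t ^ 2 * oddState t ^ 2 := by
  set g : ℝ → ℝ := fun t => (1 - t ^ 2 / 4) * Real.exp (-(t ^ 2 / 8))
  have hcg : Continuous g := by fun_prop
  have hco : Continuous oddState := contDiff_oddState.continuous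
  have hcχ := hχ.continuous
  have hcd : Continuous (deriv χ) := hχ.continuous_deriv le_rfl
  have hdχ : ∀ t, HasDerivAt χ (deriv χ t) t := fun t =>
    (hχ.differentiable one_ne_zero t).hasDerivAt
  have hd : ∀ t, deriv (fun t => χ t * oddState t) t = deriv χ t * oddState t + χ t * g t :=
    fun t => ((hdχ t).mul (hasDerivAt_oddState t)).deriv
  have hcd' : HasCompactSupport (deriv χ) := hc.deriv
  have int1 : ∀ k : ℝ → ℝ, Continuous k → Integrable fun t => χ t * k t := fun k hk =>
    (hcχ.mul hk).integrable_of_hasCompactSupport hc.mul_right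
  have int2 : ∀ k : ℝ → ℝ, Continuous k → Integrable fun t => deriv χ t * k t := fun k hk =>
    (hcd.mul hk).integrable_of_hasCompactSupport hcd'.mul_right
  have hF : ∀ t, HasDerivAt (fun t => χ t * (χ t * oddState t * g t))
      (deriv χ t * (χ t * oddState t * g t) + χ t * ((deriv χ t * oddState t + χ t * g t) * g t +
        χ t * oddState t * ((t ^ 2 / 16 - 3 / 4) * oddState t))) t := fun t =>
    (hdχ t).mul (((hdχ t).mul (hasDerivAt_oddState t)).mul (hasDerivAt_deriv_oddState t))
  have j4 : Integrable fun t => deriv χ t * (χ t * oddState t * g t) + χ t *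
      ((deriv χ t * oddState t + χ t * g t) * g t +
        χ t * oddState t * ((t ^ 2 / 16 - 3 / 4) * oddState t)) :=
    (int2 _ (by fun_prop)).add (int1 _ (by fun_prop))
  have z := integral_eq_zero_of_hasDerivAt_of_integrable hF j4 (int1 _ (by fun_prop))
  have j1 : Integrable fun t => (χ t * oddState t) ^ 2 :=
    (int1 (fun t => χ t * oddState t ^ 2) (by fun_prop)).congr (.of_forall fun t => by ring)
  have j2 : Integrable fun t => t ^ 2 * (χ t * oddState t) ^ 2 :=
    (int1 (fun t => t ^ 2 * χ t * oddState t ^ 2) (by fun_prop)).congr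
      (.of_forall fun t => by ring)
  have j3 : Integrable fun t => deriv χ t ^ 2 * oddState t ^ 2 :=
    (int2 (fun t => deriv χ t * oddState t ^ 2) (by fun_prop)).congr (.of_forall fun t => by ring)
  have e : ∀ t, deriv (fun t => χ t * oddState t) t ^ 2 =
      (deriv χ t * (χ t * oddState t * g t) + χ t * ((deriv χ t * oddState t + χ t * g t) * g t +
        χ t * oddState t * ((t ^ 2 / 16 - 3 / 4) * oddState t))) +
      ((3 / 4 * (χ t * oddState t) ^ 2 + deriv χ t ^ 2 * oddState t ^ 2) -
        1 / 16 * (t ^ 2 * (χ t * oddState t) ^ 2)) := fun t => by rw [hd]; ring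
  have k1 : Integrable fun t => 3 / 4 * (χ t * oddState t) ^ 2 + deriv χ t ^ 2 * oddState t ^ 2 :=
    (j1.const_mul _).add j3
  have k2 : Integrable fun t => (3 / 4 * (χ t * oddState t) ^ 2 + deriv χ t ^ 2 * oddState t ^ 2) -
        1 / 16 * (t ^ 2 * (χ t * oddState t) ^ 2) := k1.sub (j2.const_mul _)
  rw [integral_congr_ae (.of_forall e), integral_add j4 k2, z, integral_sub k1 (j2.const_mul _),
    integral_add (j1.const_mul _) j3, integral_const_mul, integral_const_mul]
  ring

/-- Cutoff vanishing on `(-∞, ε]` and `[2/ε, ∞)`, equal to `1` on `[2ε, 1/ε]`. -/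
def oscCutoff (ε t : ℝ) : ℝ := Real.smoothTransition (t / ε - 1) * Real.smoothTransition (2 - ε * t)

lemma contDiff_oscCutoff (ε : ℝ) : ContDiff ℝ (⊤ : ℕ∞) (oscCutoff ε) := by
  have h : ContDiff ℝ (⊤ : ℕ∞) Real.smoothTransition := Real.smoothTransition.contDiff
  exact (h.comp (by fun_prop : ContDiff ℝ (⊤ : ℕ∞) fun t : ℝ => t / ε - 1)).mul
    (h.comp (by fun_prop : ContDiff ℝ (⊤ : ℕ∞) fun t : ℝ => 2 - ε * t))

lemma oscCutoff_eq_zero {ε t : ℝ} (hε : 0 < ε) (ht : t ∉ Icc ε (2 / ε)) : oscCutoff ε t = 0 := by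
  rw [oscCutoff]
  by_cases h : t < ε
  · rw [Real.smoothTransition.zero_of_nonpos, zero_mul]
    rw [sub_nonpos, div_le_one hε]; exact h.le
  · have h2 : 2 / ε < t := by
      by_contra h'
      exact ht ⟨not_lt.1 h, not_lt.1 h'⟩
    rw [Real.smoothTransition.zero_of_nonpos (x := 2 - ε * t), mul_zero]
    rw [div_lt_iff₀ hε] at h2
    linarith

lemma oscCutoff_hasCompactSupport {ε : ℝ} (hε : 0 < ε) : HasCompactSupport (oscCutoff ε) :=
  HasCompactSupport.intro isCompact_Icc fun _ ht => oscCutoff_eq_zero hε ht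

lemma oscCutoff_eq_one {ε t : ℝ} (hε : 0 < ε) (hε' : ε ≤ 1 / 2) (ht : t ∈ Icc (1 : ℝ) 2) :
    oscCutoff ε t = 1 := by
  rw [oscCutoff, Real.smoothTransition.one_of_one_le, Real.smoothTransition.one_of_one_le, one_mul]
  · nlinarith [ht.2]
  · have : 2 ≤ t / ε := by rw [le_div_iff₀ hε]; linarith [ht.1]
    linarith

lemma deriv_oscCutoff_sq_mul_le {C : ℝ}
    (hC : ∀ x, |deriv Real.smoothTransition x| ≤ C ∧
      (x ∉ Icc (0 : ℝ) 1 → deriv Real.smoothTransition x = 0)) {ε : ℝ} (hε : 0 < ε) (t : ℝ) :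
    deriv (oscCutoff ε) t ^ 2 * oddState t ^ 2 ≤
      (Icc ε (2 * ε)).indicator (fun _ => 8 * C ^ 2) t +
        (Icc (1 / ε) (2 / ε)).indicator (fun _ => 8 * C ^ 2 * ε ^ 2) t := by
  have hS : ∀ x, HasDerivAt Real.smoothTransition (deriv Real.smoothTransition x) x := fun x =>
    ((Real.smoothTransition.contDiff (n := 1)).differentiable one_ne_zero x).hasDerivAt
  have d1 := (hS (t / ε - 1)).comp t (((hasDerivAt_id t).div_const ε).sub_const 1)
  have d2 := (hS (2 - ε * t)).comp t (((hasDerivAt_id t).const_mul ε).const_sub 2)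
  set A := deriv Real.smoothTransition (t / ε - 1) with hA
  set B := deriv Real.smoothTransition (2 - ε * t) with hB
  set S := Real.smoothTransition (t / ε - 1) with hSd
  set T := Real.smoothTransition (2 - ε * t) with hTd
  have hS0 : 0 ≤ S := Real.smoothTransition.nonneg _
  have hT0 : 0 ≤ T := Real.smoothTransition.nonneg _
  have hS1 : S ^ 2 ≤ 1 := pow_le_one₀ hS0 (Real.smoothTransition.le_one _)
  have hT1 : T ^ 2 ≤ 1 := pow_le_one₀ hT0 (Real.smoothTransition.le_one _)
  have hd : deriv (oscCutoff ε) t = A / ε * T - S * (B * ε) := by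
    have := (d1.mul d2).deriv
    refine Eq.trans this ?_
    change A * (1 / ε) * T + S * (B * -(ε * 1)) = _
    ring
  obtain ⟨o1, o2⟩ := oddState_sq_le t
  have o0 : 0 ≤ oddState t ^ 2 := sq_nonneg _
  have hA2 : A ^ 2 ≤ C ^ 2 := sq_le_sq' (neg_le_of_abs_le (hC _).1) (le_of_abs_le (hC _).1)
  have hB2 : B ^ 2 ≤ C ^ 2 := sq_le_sq' (neg_le_of_abs_le (hC _).1) (le_of_abs_le (hC _).1)
  have p1 : 2 * (A / ε) ^ 2 * oddState t ^ 2 ≤ (Icc ε (2 * ε)).indicator (fun _ => 8 * C ^ 2) t := by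
    by_cases ht : t ∈ Icc ε (2 * ε)
    · rw [indicator_of_mem ht]
      have : oddState t ^ 2 ≤ 4 * ε ^ 2 := o1.trans (by nlinarith [ht.1, ht.2])
      calc 2 * (A / ε) ^ 2 * oddState t ^ 2 ≤ 2 * (A / ε) ^ 2 * (4 * ε ^ 2) := by gcongr
        _ = 8 * A ^ 2 := by field_simp; ring
        _ ≤ 8 * C ^ 2 := by gcongr
    · rw [indicator_of_notMem ht]
      have : A = 0 := by
        refine (hC _).2 fun h => ht ?_
        have h1 := h.1
        have h2 := h.2
        rw [sub_nonneg, le_div_iff₀ hε] at h1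
        rw [sub_le_iff_le_add, div_le_iff₀ hε] at h2
        exact ⟨by linarith, by linarith⟩
      simp [this]
  have p2 : 2 * (B * ε) ^ 2 * oddState t ^ 2 ≤
      (Icc (1 / ε) (2 / ε)).indicator (fun _ => 8 * C ^ 2 * ε ^ 2) t := by
    by_cases ht : t ∈ Icc (1 / ε) (2 / ε)
    · rw [indicator_of_mem ht]
      calc 2 * (B * ε) ^ 2 * oddState t ^ 2 ≤ 2 * (B * ε) ^ 2 * 4 := by gcongr
        _ = 8 * B ^ 2 * ε ^ 2 := by ring
        _ ≤ 8 * C ^ 2 * ε ^ 2 := by gcongr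
    · rw [indicator_of_notMem ht]
      have : B = 0 := by
        refine (hC _).2 fun h => ht ?_
        rw [mem_Icc, div_le_iff₀ hε, le_div_iff₀ hε]
        exact ⟨by linarith [h.2], by linarith [h.1]⟩
      simp [this]
  refine le_trans ?_ (add_le_add p1 p2)
  rw [hd, ← add_mul]
  refine mul_le_mul_of_nonneg_right ?_ o0
  have q1 : (A / ε * T) ^ 2 ≤ (A / ε) ^ 2 := by
    rw [mul_pow]; exact mul_le_of_le_one_right (sq_nonneg _) hT1
  have q2 : (S * (B * ε)) ^ 2 ≤ (B * ε) ^ 2 := by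
    rw [mul_pow]; exact mul_le_of_le_one_left (sq_nonneg _) hS1
  nlinarith [sq_nonneg (A / ε * T + S * (B * ε))]

/-- Near-minimisers of the oscillator form supported away from the origin. -/
lemma exists_oscillator_trial {δ : ℝ} (hδ : 0 < δ) :
    ∃ φ : ℝ → ℝ, ContDiff ℝ (⊤ : ℕ∞) φ ∧ HasCompactSupport φ ∧
      (∃ η > 0, ∀ t, |t| < η → φ t = 0) ∧ φ ≠ 0 ∧
      (∫ t, deriv φ t ^ 2) + 1 / 16 * (∫ t, t ^ 2 * φ t ^ 2) ≤ (3 / 4 + δ) * ∫ t, φ t ^ 2 := by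
  obtain ⟨C, -, hC⟩ := exists_smoothTransition_deriv_bound
  set m := Real.exp (-1 / 2) ^ 2 with hm
  have hm0 : 0 < m := by positivity
  obtain ⟨ε, hε, hε1, hε2⟩ : ∃ ε : ℝ, 0 < ε ∧ ε ≤ 1 / 2 ∧ 16 * C ^ 2 * ε ≤ δ * m := by
    refine ⟨min (1 / 2) (δ * m / (16 * C ^ 2 + 1)), by positivity, min_le_left _ _, ?_⟩
    have h : min (1 / 2) (δ * m / (16 * C ^ 2 + 1)) ≤ δ * m / (16 * C ^ 2 + 1) := min_le_right _ _
    calc _ ≤ 16 * C ^ 2 * (δ * m / (16 * C ^ 2 + 1)) := by gcongr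
      _ = δ * m * (16 * C ^ 2 / (16 * C ^ 2 + 1)) := by ring
      _ ≤ δ * m * 1 := by
        gcongr
        rw [div_le_one (by positivity)]; linarith
      _ = _ := mul_one _
  have hχ := contDiff_oscCutoff ε
  have hc := oscCutoff_hasCompactSupport hε
  have hφ : ContDiff ℝ (⊤ : ℕ∞) fun t => oscCutoff ε t * oddState t := hχ.mul contDiff_oddState
  have hφc : HasCompactSupport fun t => oscCutoff ε t * oddState t := hc.mul_right
  have hlow : ∀ t ∈ Icc (1 : ℝ) 2, m ≤ (oscCutoff ε t * oddState t) ^ 2 := by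
    intro t ht
    rw [oscCutoff_eq_one hε hε1 ht, one_mul, hm, oddState]
    have h1 : Real.exp (-1 / 2) ≤ Real.exp (-(t ^ 2 / 8)) :=
      Real.exp_le_exp.2 (by nlinarith [ht.1, ht.2])
    have h2 := Real.exp_pos (-(t ^ 2 / 8))
    have : Real.exp (-1 / 2) ≤ t * Real.exp (-(t ^ 2 / 8)) := by nlinarith [ht.1]
    gcongr
  have hint : Integrable fun t => (oscCutoff ε t * oddState t) ^ 2 :=
    integrable_sq_of_compactSupport hφ.continuous hφc
  have hmass : m ≤ ∫ t, (oscCutoff ε t * oddState t) ^ 2 := by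
    have h1 : ∫ t in Icc (1 : ℝ) 2, m ≤ ∫ t in Icc (1 : ℝ) 2, (oscCutoff ε t * oddState t) ^ 2 :=
      setIntegral_mono_on (by simp) hint.integrableOn measurableSet_Icc hlow
    have h2 := setIntegral_le_integral (s := Icc (1 : ℝ) 2) hint
      (.of_forall fun t => sq_nonneg (oscCutoff ε t * oddState t))
    have h3 : ∫ t in Icc (1 : ℝ) 2, m = m := by
      rw [setIntegral_const, Real.volume_real_Icc_of_le (by norm_num)]; norm_num
    linarith
  have herr : ∫ t, deriv (oscCutoff ε) t ^ 2 * oddState t ^ 2 ≤ 16 * C ^ 2 * ε := by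
    have i1 : Integrable ((Icc ε (2 * ε)).indicator fun _ : ℝ => 8 * C ^ 2) :=
      (integrable_indicator_iff measurableSet_Icc).2 continuous_const.integrableOn_Icc
    have i2 : Integrable ((Icc (1 / ε) (2 / ε)).indicator fun _ : ℝ => 8 * C ^ 2 * ε ^ 2) :=
      (integrable_indicator_iff measurableSet_Icc).2 continuous_const.integrableOn_Icc
    have h := integral_mono_of_nonneg
      (.of_forall fun t => (by positivity : 0 ≤ deriv (oscCutoff ε) t ^ 2 * oddState t ^ 2))
      (i1.add i2) (.of_forall (deriv_oscCutoff_sq_mul_le hC hε))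
    refine h.trans ?_
    rw [integral_add' i1 i2, integral_indicator measurableSet_Icc,
      integral_indicator measurableSet_Icc, setIntegral_const, setIntegral_const,
      Real.volume_real_Icc_of_le (by linarith), Real.volume_real_Icc_of_le (by gcongr; norm_num)]
    simp only [smul_eq_mul]
    apply le_of_eq
    field_simp
    ring
  refine ⟨_, hφ, hφc, ⟨ε, hε, fun t ht => ?_⟩, fun h => ?_, ?_⟩
  · rw [oscCutoff_eq_zero hε fun h => (lt_irrefl ε (h.1.trans_lt ((le_abs_self t).trans_lt ht))),
      zero_mul]
  · have := hlow 1 ⟨le_rfl, one_le_two⟩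
    rw [show oscCutoff ε 1 * oddState 1 = 0 from congrFun h 1] at this
    nlinarith
  · rw [integral_oscillator_cutoff (hχ.of_le (by exact_mod_cast le_top)) hc, add_mul]
    have := mul_le_mul_of_nonneg_left hmass hδ.le
    linarith

section TensorTrial

variable {ω : Set (ℝ × ℝ)}

lemma exists_isTest2_ne_zero (ho : IsOpen ω) (hne : ω.Nonempty) : ∃ f, IsTest2 ω f ∧ f ≠ 0 := by
  obtain ⟨p, hp⟩ := hne
  obtain ⟨g, h1, h2, h3, -, h5⟩ := exists_contDiff_tsupport_subset (n := ⊤) (ho.mem_nhds hp)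
  have hg : IsRealTest ω g := ⟨h3, h2, h1⟩
  refine ⟨_, hg.isTest2, fun h => ?_⟩
  have := congrFun h p
  simp [h5] at this

/-- The product function `φ ⊗ f`. -/
def tensorTrial (φ : ℝ → ℝ) (f : ℝ × ℝ → ℂ) (x : ℝ × ℝ × ℝ) : ℂ := φ x.1 • f x.2

lemma tensorTrial_isTest3 {φ : ℝ → ℝ} (h1 : ContDiff ℝ (⊤ : ℕ∞) φ) (h2 : HasCompactSupport φ)
    {f : ℝ × ℝ → ℂ} (hf : IsTest2 ω f) : IsTest3 (Omega0 ω) (tensorTrial φ f) := by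
  have hz : ∀ x, x ∉ tsupport φ ×ˢ tsupport f → tensorTrial φ f x = 0 := by
    intro x hx
    rw [tensorTrial]
    by_cases h : x.1 ∈ tsupport φ
    · rw [image_eq_zero_of_notMem_tsupport fun h' => hx ⟨h, h'⟩, smul_zero]
    · rw [image_eq_zero_of_notMem_tsupport h, zero_smul]
  have hK : IsCompact (tsupport φ ×ˢ tsupport f) := IsCompact.prod h2 hf.2.1
  refine ⟨(h1.comp contDiff_fst).smul (hf.1.comp contDiff_snd), .intro hK fun x => hz x, ?_⟩
  refine Subset.trans (closure_minimal (fun x hx => ?_) hK.isClosed) fun x hx => hf.2.2 hx.2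
  by_contra h
  exact hx (hz x h)

lemma tensorTrial_pd {φ : ℝ → ℝ} (hφ : Differentiable ℝ φ) {f : ℝ × ℝ → ℂ}
    (hf : Differentiable ℝ f) (x : ℝ × ℝ × ℝ) :
    pd1 (tensorTrial φ f) x = deriv φ x.1 • f x.2 ∧
      pd2 (tensorTrial φ f) x = φ x.1 • pd1' f x.2 ∧
      pd3 (tensorTrial φ f) x = φ x.1 • pd2' f x.2 := by
  refine ⟨deriv_smul_const (hφ x.1) (f x.2), ?_, ?_⟩
  · exact deriv_fun_const_smul (φ x.1)
      (hf.comp (by fun_prop : Differentiable ℝ fun t : ℝ => (t, x.2.2)) _)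
  · exact deriv_fun_const_smul (φ x.1)
      (hf.comp (by fun_prop : Differentiable ℝ fun t : ℝ => (x.2.1, t)) _)

lemma setIntegral_Omega0_mul (a : ℝ → ℝ) (b : ℝ × ℝ → ℝ) :
    ∫ y in Omega0 ω, a y.1 * b y.2 = (∫ t, a t) * ∫ p in ω, b p := by
  have h : Omega0 ω = univ ×ˢ ω := by ext x; simp [Omega0]
  rw [h, Measure.volume_eq_prod, setIntegral_prod_mul, setIntegral_univ]

lemma integral_norm_sq_tensorTrial (φ : ℝ → ℝ) (f : ℝ × ℝ → ℂ) :
    ∫ y in Omega0 ω, ‖tensorTrial φ f y‖ ^ 2 = (∫ t, φ t ^ 2) * ∫ p in ω, ‖f p‖ ^ 2 := by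
  rw [← setIntegral_Omega0_mul]
  simp [tensorTrial, mul_pow]

lemma Jform_tensorTrial {φ : ℝ → ℝ} (hφ : Differentiable ℝ φ) {f : ℝ × ℝ → ℂ}
    (hf : Differentiable ℝ f) {θ : ℝ → ℝ} {s : ℝ} (h0 : ∀ t, sigmafun θ s t = 0 ∨ φ t = 0) :
    Jform θ ω s (tensorTrial φ f) =
      ((∫ t, deriv φ t ^ 2) + 1 / 16 * ∫ t, t ^ 2 * φ t ^ 2) * (∫ p in ω, ‖f p‖ ^ 2) +
      Real.exp s * ((∫ t, φ t ^ 2) *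
        ((∫ p in ω, (‖pd1' f p‖ ^ 2 + ‖pd2' f p‖ ^ 2)) - E1 ω * ∫ p in ω, ‖f p‖ ^ 2)) := by
  have e1 : ∀ y, ‖pd1 (tensorTrial φ f) y - sigmafun θ s y.1 • pdtau (tensorTrial φ f) y‖ ^ 2 =
      deriv φ y.1 ^ 2 * ‖f y.2‖ ^ 2 := by
    intro y
    obtain ⟨h1, h2, h3⟩ := tensorTrial_pd hφ hf y
    have : sigmafun θ s y.1 • pdtau (tensorTrial φ f) y = 0 := by
      rw [pdtau, h2, h3]
      rcases h0 y.1 with h | h <;> simp [h]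
    rw [this, sub_zero, h1, norm_smul, mul_pow, Real.norm_eq_abs, sq_abs]
  have e2 : ∀ y : ℝ × ℝ × ℝ, y.1 ^ 2 * ‖tensorTrial φ f y‖ ^ 2 =
      (y.1 ^ 2 * φ y.1 ^ 2) * ‖f y.2‖ ^ 2 := by
    intro y
    rw [tensorTrial, norm_smul, mul_pow, Real.norm_eq_abs, sq_abs, mul_assoc]
  have e3 : ∀ y, ‖pd2 (tensorTrial φ f) y‖ ^ 2 + ‖pd3 (tensorTrial φ f) y‖ ^ 2 =
      φ y.1 ^ 2 * (‖pd1' f y.2‖ ^ 2 + ‖pd2' f y.2‖ ^ 2) := by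
    intro y
    obtain ⟨-, h2, h3⟩ := tensorTrial_pd hφ hf y
    rw [h2, h3, norm_smul, norm_smul, mul_pow, mul_pow, Real.norm_eq_abs, sq_abs, mul_add]
  rw [Jform, integral_norm_sq_tensorTrial]
  simp only [e1, e2, e3]
  rw [setIntegral_Omega0_mul (fun t => deriv φ t ^ 2) fun p => ‖f p‖ ^ 2,
    setIntegral_Omega0_mul (fun t => t ^ 2 * φ t ^ 2) fun p => ‖f p‖ ^ 2,
    setIntegral_Omega0_mul (fun t => φ t ^ 2) fun p => ‖pd1' f p‖ ^ 2 + ‖pd2' f p‖ ^ 2]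
  ring

lemma tensorTrial_ne_zero {φ : ℝ → ℝ} (hφ : φ ≠ 0) {f : ℝ × ℝ → ℂ} (hf : f ≠ 0) :
    tensorTrial φ f ≠ 0 := by
  obtain ⟨t, ht⟩ := Function.ne_iff.1 hφ
  obtain ⟨p, hp⟩ := Function.ne_iff.1 hf
  exact Function.ne_iff.2 ⟨(t, p), smul_ne_zero ht hp⟩

lemma eventually_exists_Jform_le (ho : IsOpen ω) (hne : ω.Nonempty) {θ : ℝ → ℝ}
    (hsupp : HasCompactSupport (deriv θ)) {δ : ℝ} (hδ : 0 < δ) :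
    ∀ᶠ s in atTop, ∃ v : ℝ × ℝ × ℝ → ℂ, IsTest3 (Omega0 ω) v ∧ v ≠ 0 ∧
      Jform θ ω s v ≤ (3 / 4 + δ) * ∫ y in Omega0 ω, ‖v y‖ ^ 2 := by
  obtain ⟨φ, hφ, hφc, ⟨η, hη, hφ0⟩, hφn, hφJ⟩ := exists_oscillator_trial (half_pos hδ)
  obtain ⟨L, hL0, hL⟩ := exists_deriv_eq_zero_outside hsupp
  have hlim : Tendsto (fun s : ℝ => L * Real.exp (-(s / 2))) atTop (nhds 0) := by
    simpa using tendsto_exp_neg_half.const_mul L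
  filter_upwards [hlim.eventually_lt_const hη] with s hs
  have h0 : ∀ t, sigmafun θ s t = 0 ∨ φ t = 0 := by
    intro t
    by_cases ht : |t| < η
    · exact .inr (hφ0 t ht)
    · exact .inl (sigmafun_eq_zero hL (hs.le.trans (not_lt.1 ht)))
  have hset : { r : ℝ | ∃ f : ℝ × ℝ → ℂ, IsTest2 ω f ∧ f ≠ 0 ∧
      r = (∫ p in ω, (‖pd1' f p‖ ^ 2 + ‖pd2' f p‖ ^ 2)) / ∫ p in ω, ‖f p‖ ^ 2 }.Nonempty := by
    obtain ⟨f, hf, hf0⟩ := exists_isTest2_ne_zero ho hne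
    exact ⟨_, f, hf, hf0, rfl⟩
  have hlt : E1 ω < E1 ω + δ / 2 * Real.exp (-s) := by
    have := Real.exp_pos (-s)
    have : 0 < δ / 2 * Real.exp (-s) := by positivity
    linarith
  obtain ⟨r, ⟨f, hf, hf0, rfl⟩, hr⟩ := exists_lt_of_csInf_lt hset hlt
  have hv := tensorTrial_isTest3 hφ hφc hf
  have hv0 := tensorTrial_ne_zero hφn hf0
  refine ⟨_, hv, hv0, ?_⟩
  have hpos := setIntegral_norm_sq_pos hv hv0
  rw [integral_norm_sq_tensorTrial] at hpos ⊢
  have hM0 : 0 ≤ ∫ t, φ t ^ 2 := integral_nonneg fun _ => sq_nonneg _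
  have hN : 0 < ∫ p in ω, ‖f p‖ ^ 2 := pos_of_mul_pos_right hpos hM0
  have hM : 0 < ∫ t, φ t ^ 2 := pos_of_mul_pos_left hpos hN.le
  rw [Jform_tensorTrial (hφ.differentiable (by simp)) (hf.1.differentiable (by simp)) h0]
  rw [div_lt_iff₀ hN] at hr
  set N := ∫ p in ω, ‖f p‖ ^ 2
  set M := ∫ t, φ t ^ 2
  set D := ∫ p in ω, (‖pd1' f p‖ ^ 2 + ‖pd2' f p‖ ^ 2)
  have h1 : D - E1 ω * N ≤ δ / 2 * Real.exp (-s) * N := by linarith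
  have h2 : Real.exp s * (M * (D - E1 ω * N)) ≤ Real.exp s * (M * (δ / 2 * Real.exp (-s) * N)) := by
    gcongr
  have h3 : Real.exp s * (M * (δ / 2 * Real.exp (-s) * N)) = δ / 2 * (M * N) := by
    have : Real.exp s * Real.exp (-s) = 1 := by rw [← Real.exp_add]; simp
    linear_combination (M * (δ / 2) * N) * this
  have h4 := mul_le_mul_of_nonneg_right hφJ hN.le
  nlinarith

end TensorTrial

/-- in a twisted tube with compactly supported θ̇, μ(s) → 3/4 as
s → ∞ (3/4 being the lowest eigenvalue of the harmonic oscillator −d²/dy₁² + y₁²/16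
with an extra Dirichlet condition at y₁ = 0). -/
theorem mu_tendsto_three_quarters
    (ω : Set (ℝ × ℝ)) (hω_open : IsOpen ω) (hω_bdd : Bornology.IsBounded ω)
    (hω_conn : IsConnected ω)
    (θ : ℝ → ℝ) (hθ : ContDiff ℝ 1 θ) (hθ' : ∃ M : ℝ, ∀ t : ℝ, |deriv θ t| ≤ M)
    (hsupp : HasCompactSupport (deriv θ))
    (htw : Twisted θ ω) :
    Filter.Tendsto (mu θ ω) Filter.atTop (nhds (3 / 4)) := by
  have lower : ∀ δ > 0, ∀ᶠ s in atTop, ∀ r, (∃ v : ℝ × ℝ × ℝ → ℂ, IsTest3 (Omega0 ω) v ∧ v ≠ 0 ∧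
      r = Jform θ ω s v / ∫ y in Omega0 ω, ‖v y‖ ^ 2) → 3 / 4 - δ ≤ r := by
    intro δ hδ
    filter_upwards [eventually_Jform_lower_bound hω_open hω_bdd hω_conn hθ hsupp htw hδ] with s hs
    rintro r ⟨v, hv, hv0, rfl⟩
    rw [le_div_iff₀ (setIntegral_norm_sq_pos hv hv0)]
    exact hs v hv
  rw [tendsto_order]
  constructor
  · intro a ha
    have hδ : 0 < (3 / 4 - a) / 2 := by linarith
    filter_upwards [lower _ hδ, eventually_exists_Jform_le hω_open hω_conn.nonempty hsupp hδ]
      with s hs ⟨v, hv, hv0, _⟩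
    have h : 3 / 4 - (3 / 4 - a) / 2 ≤ mu θ ω s := le_csInf ⟨_, v, hv, hv0, rfl⟩ hs
    linarith
  · intro a ha
    have hδ : 0 < (a - 3 / 4) / 2 := by linarith
    filter_upwards [lower _ hδ, eventually_exists_Jform_le hω_open hω_conn.nonempty hsupp hδ]
      with s hs ⟨v, hv, hv0, hJ⟩
    have h : mu θ ω s ≤ Jform θ ω s v / ∫ y in Omega0 ω, ‖v y‖ ^ 2 :=
      csInf_le ⟨_, hs⟩ ⟨v, hv, hv0, rfl⟩
    have h' : Jform θ ω s v / ∫ y in Omega0 ω, ‖v y‖ ^ 2 ≤ 3 / 4 + (a - 3 / 4) / 2 := by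
      rw [div_le_iff₀ (setIntegral_norm_sq_pos hv hv0)]
      exact hJ
    linarith
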